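/- Fix real parameters γ ∈ (0,1), α > 0, μ > 0, κ > 0 with κ(1+α) ∈ (0,1). Then for every sufficiently large r > 0 there exists ε₀ > 0 such that for every ε ∈ (0, ε₀) the Hester system with parameters γ, α, μ, κ, ε admits a nonconstant periodic solution whose image Γ_ε is contained in the closed ball of radius r centered at the origin; moreover Γ_ε is the unique such periodic orbit in that ball (the image of any nonconstant periodic solution contained in the ball equals Γ_ε), and Γ_ε is attracting: there exists an open neighborhood U of Γ_ε such that every solution with initial condition in U is defined for all forward times and its distance to Γ_ε tends to 0 as t → ∞. -/

import Mathlib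

/-- The vector field of the Hester system
`ẋ = y, ẏ = −x − 2γy + μ(exp(y/ε) − κ exp((1+α)y/ε))`. -/
noncomputable def hesterField (γ α μ κ ε : ℝ) (p : ℝ × ℝ) : ℝ × ℝ :=
  (p.2, -p.1 - 2 * γ * p.2 + μ * (Real.exp (p.2 / ε) - κ * Real.exp ((1 + α) * p.2 / ε)))

/-- `p` is a nonconstant periodic solution of the planar ODE with vector field `f`. -/
def IsPeriodicSol (f : ℝ × ℝ → ℝ × ℝ) (p : ℝ → ℝ × ℝ) : Prop :=
  (∀ t : ℝ, HasDerivAt p (f (p t)) t) ∧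
  (∃ T > (0 : ℝ), ∀ t : ℝ, p (t + T) = p t) ∧
  (∃ t₁ t₂ : ℝ, p t₁ ≠ p t₂)

open Set Filter Topology

section Flow

variable {E : Type*} [NormedAddCommGroup E] [NormedSpace ℝ E]

/-- Two solutions of a Lipschitz autonomous ODE on an open interval which agree at one point. -/
theorem eqOn_of_lipschitz_ode {v : E → E} {K : NNReal} (hv : LipschitzWith K v) {a b t₀ : ℝ}
    {f g : ℝ → E} (ht₀ : t₀ ∈ Ioo a b) (hf : ∀ t ∈ Ioo a b, HasDerivAt f (v (f t)) t)
    (hg : ∀ t ∈ Ioo a b, HasDerivAt g (v (g t)) t) (h : f t₀ = g t₀) : EqOn f g (Ioo a b) :=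
  ODE_solution_unique_of_mem_Ioo (v := fun _ => v) (s := fun _ => univ) (K := K)
    (fun _ _ => hv.lipschitzOnWith) ht₀ (fun t ht => ⟨hf t ht, mem_univ _⟩)
    (fun t ht => ⟨hg t ht, mem_univ _⟩) h

theorem eq_of_lipschitz_ode {v : E → E} {K : NNReal} (hv : LipschitzWith K v) {t₀ : ℝ}
    {f g : ℝ → E} (hf : ∀ t, HasDerivAt f (v (f t)) t)
    (hg : ∀ t, HasDerivAt g (v (g t)) t) (h : f t₀ = g t₀) : f = g :=
  ODE_solution_unique_univ (v := fun _ => v) (s := fun _ => univ) (K := K) (t₀ := t₀)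
    (fun _ => hv.lipschitzOnWith) (fun t => ⟨hf t, mem_univ _⟩)
    (fun t => ⟨hg t, mem_univ _⟩) h

theorem dist_le_of_lipschitz_ode {v : E → E} {K : NNReal} (hv : LipschitzWith K v)
    {f g : ℝ → E} (hf : ∀ t, HasDerivAt f (v (f t)) t)
    (hg : ∀ t, HasDerivAt g (v (g t)) t) {s t : ℝ} (hst : s ≤ t) :
    dist (f t) (g t) ≤ dist (f s) (g s) * Real.exp (K * (t - s)) :=
  dist_le_of_trajectories_ODE (v := fun _ => v) (fun _ => hv)
    (fun t _ => (hf t).continuousAt.continuousWithinAt) (fun t _ => (hf t).hasDerivWithinAt)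
    (fun t _ => (hg t).continuousAt.continuousWithinAt) (fun t _ => (hg t).hasDerivWithinAt)
    le_rfl t ⟨hst, le_rfl⟩

theorem exists_local_solution_of_lipschitz [CompleteSpace E] {v : E → E} {K : NNReal}
    (hv : LipschitzWith K v) (x : E) :
    ∃ f : ℝ → E, f 0 = x ∧
      ∀ t ∈ Ioo (-(1 / (K + 1) : ℝ)) (1 / (K + 1)), HasDerivAt f (v (f t)) t := by
  set h : ℝ := 1 / (K + 1) with hh
  have hK : (0 : ℝ) < K + 1 := by positivity
  have hpos : 0 < h := by positivity
  let M : NNReal := ⟨‖v x‖, norm_nonneg _⟩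
  have hP : IsPicardLindelof (fun _ => v) (tmin := -h) (tmax := h) ⟨0, by constructor <;> linarith⟩
      x M 0 (K * M + M) K := by
    refine IsPicardLindelof.of_time_independent (fun y hy => ?_) hv.lipschitzOnWith ?_
    · have h1 : ‖v y - v x‖ ≤ K * ‖y - x‖ := hv.norm_sub_le y x
      have h2 : ‖y - x‖ ≤ M := by simpa [dist_eq_norm] using hy
      have h3 : ‖v y‖ ≤ ‖v y - v x‖ + ‖v x‖ := by simpa using norm_add_le (v y - v x) (v x)
      have h4 : (K : ℝ) * ‖y - x‖ ≤ K * M := by gcongr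
      have h5 : (M : ℝ) = ‖v x‖ := rfl
      push_cast
      linarith
    · have : ((K : ℝ) * M + M) * h = M := by
        rw [hh]; field_simp
      simp
      rw [this]
  obtain ⟨f, hf0, hf⟩ := hP.exists_eq_forall_mem_Icc_hasDerivWithinAt₀
  exact ⟨f, hf0, fun t ht => (hf t ⟨ht.1.le, ht.2.le⟩).hasDerivAt (Icc_mem_nhds ht.1 ht.2)⟩

theorem extend_solution_of_lipschitz {v : E → E} {K : NNReal} (hv : LipschitzWith K v) {a : ℝ}
    (ha : 0 < a)
    (h : ∀ x, ∃ f : ℝ → E, f 0 = x ∧ ∀ t ∈ Ioo (-a) a, HasDerivAt f (v (f t)) t) (x : E) :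
    ∃ f : ℝ → E, f 0 = x ∧
      ∀ t ∈ Ioo (-(3 / 2 * a)) (3 / 2 * a), HasDerivAt f (v (f t)) t := by
  obtain ⟨f, hf0, hf⟩ := h x
  obtain ⟨p, hp0, hp⟩ := h (f (a / 2))
  obtain ⟨q, hq0, hq⟩ := h (f (-(a / 2)))
  have hp' : ∀ t ∈ Ioo (-(a / 2)) (3 / 2 * a),
      HasDerivAt (fun t => p (t - a / 2)) (v (p (t - a / 2))) t := fun t ht =>
    (hp (t - a / 2) ⟨by linarith [ht.1], by linarith [ht.2]⟩).comp_sub_const t (a / 2)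
  have hq' : ∀ t ∈ Ioo (-(3 / 2 * a)) (a / 2),
      HasDerivAt (fun t => q (t + a / 2)) (v (q (t + a / 2))) t := fun t ht =>
    (hq (t + a / 2) ⟨by linarith [ht.1], by linarith [ht.2]⟩).comp_add_const t (a / 2)
  have e1 : EqOn f (fun t => p (t - a / 2)) (Ioo (-(a / 2)) a) :=
    eqOn_of_lipschitz_ode hv (t₀ := a / 2) ⟨by linarith, by linarith⟩
      (fun t ht => hf t ⟨by linarith [ht.1], by linarith [ht.2]⟩)
      (fun t ht => hp' t ⟨by linarith [ht.1], by linarith [ht.2]⟩) (by simp [hp0])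
  have e2 : EqOn f (fun t => q (t + a / 2)) (Ioo (-a) (a / 2)) :=
    eqOn_of_lipschitz_ode hv (t₀ := -(a / 2)) ⟨by linarith, by linarith⟩
      (fun t ht => hf t ⟨by linarith [ht.1], by linarith [ht.2]⟩)
      (fun t ht => hq' t ⟨by linarith [ht.1], by linarith [ht.2]⟩) (by simp [hq0])
  refine ⟨fun t => if t < 0 then q (t + a / 2) else p (t - a / 2), ?_, fun t ht => ?_⟩
  · have := e1 (x := 0) ⟨by linarith, by linarith⟩
    simp only [lt_irrefl, if_false]
    rw [← hf0, this]
  · rcases lt_trichotomy t 0 with h0 | h0 | h0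
    · simp only [h0, if_true]
      refine (hq' t ⟨ht.1, by linarith⟩).congr_of_eventuallyEq ?_
      filter_upwards [Iio_mem_nhds h0] with s hs
      simp [mem_Iio.1 hs]
    · subst h0
      have h1 : f 0 = p (0 - a / 2) := e1 (x := 0) ⟨by linarith, by linarith⟩
      simp only [lt_irrefl, if_false]
      rw [← h1]
      refine (hf 0 ⟨by linarith, by linarith⟩).congr_of_eventuallyEq ?_
      filter_upwards [Ioo_mem_nhds (show -(a / 2) < 0 by linarith) (show 0 < a / 2 by linarith)]
        with s hs
      split_ifs
      · exact (e2 ⟨by linarith [hs.1], hs.2⟩).symm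
      · exact (e1 ⟨hs.1, by linarith [hs.2]⟩).symm
    · simp only [not_lt.2 h0.le, if_false]
      refine (hp' t ⟨by linarith, ht.2⟩).congr_of_eventuallyEq ?_
      filter_upwards [Ioi_mem_nhds h0] with s hs
      simp [not_lt.2 (mem_Ioi.1 hs).le]

/-- Global solvability of an autonomous ODE with a globally Lipschitz right-hand side. -/
theorem exists_global_solution_of_lipschitz [CompleteSpace E] {v : E → E} {K : NNReal}
    (hv : LipschitzWith K v) (x : E) :
    ∃ f : ℝ → E, f 0 = x ∧ ∀ t, HasDerivAt f (v (f t)) t := by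
  set h : ℝ := 1 / (K + 1) with hh
  have hpos : 0 < h := by positivity
  have key : ∀ n : ℕ, ∀ x, ∃ f : ℝ → E, f 0 = x ∧
      ∀ t ∈ Ioo (-((3 / 2) ^ n * h)) ((3 / 2) ^ n * h), HasDerivAt f (v (f t)) t := by
    intro n
    induction n with
    | zero =>
      intro x
      rw [pow_zero, one_mul]
      exact exists_local_solution_of_lipschitz hv x
    | succ n ih =>
      intro x
      have := extend_solution_of_lipschitz hv (by positivity) ih x
      rwa [← mul_assoc, ← pow_succ'] at this
  choose f hf0 hf using fun n => key n x
  have hlim : Tendsto (fun n : ℕ => (3 / 2 : ℝ) ^ n * h) atTop atTop :=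
    (tendsto_pow_atTop_atTop_of_one_lt (by norm_num)).atTop_mul_const hpos
  have hN : ∀ t : ℝ, ∃ n : ℕ, |t| < (3 / 2) ^ n * h := fun t =>
    ((hlim.eventually_gt_atTop |t|).exists)
  choose N hN using hN
  have agree : ∀ m n : ℕ, ∀ t : ℝ, |t| < (3 / 2) ^ m * h → |t| < (3 / 2) ^ n * h →
      f m t = f n t := by
    intro m n t hm hn
    have hmin : |t| < min ((3 / 2) ^ m * h) ((3 / 2) ^ n * h) := lt_min hm hn
    have hl := min_le_left ((3 / 2) ^ m * h) ((3 / 2) ^ n * h)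
    have hr := min_le_right ((3 / 2) ^ m * h) ((3 / 2) ^ n * h)
    set c := min ((3 / 2) ^ m * h) ((3 / 2) ^ n * h)
    have hc : 0 < c := lt_of_le_of_lt (abs_nonneg t) hmin
    exact eqOn_of_lipschitz_ode hv (a := -c) (b := c) (t₀ := 0) ⟨by linarith, hc⟩
      (fun s hs => hf m s ⟨by linarith [hs.1], by linarith [hs.2]⟩)
      (fun s hs => hf n s ⟨by linarith [hs.1], by linarith [hs.2]⟩)
      (by rw [hf0, hf0]) (abs_lt.1 hmin)
  refine ⟨fun t => f (N t) t, hf0 _, fun t => ?_⟩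
  refine (hf (N t) t (abs_lt.1 (hN t))).congr_of_eventuallyEq ?_
  have hopen : ∀ᶠ s in 𝓝 t, |s| < (3 / 2) ^ (N t) * h :=
    (continuous_abs.tendsto t).eventually_lt_const (hN t)
  filter_upwards [hopen] with s hs
  exact agree _ _ s (hN s) hs

end Flow

section Barriers

/-- A continuous function which is nonnegative at the left end point and nondecreasing wherever it
is negative stays nonnegative. -/
theorem nonneg_of_deriv_nonneg_of_neg {f : ℝ → ℝ} {u v : ℝ} (hf : ContinuousOn f (Icc u v))
    (hu : 0 ≤ f u) (hd : ∀ x ∈ Ioo u v, f x < 0 → ∃ d, 0 ≤ d ∧ HasDerivAt f d x) :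
    ∀ x ∈ Icc u v, 0 ≤ f x := by
  intro x hx
  by_contra! hneg
  have hsub : Icc u x ⊆ Icc u v := Icc_subset_Icc_right hx.2
  set S := Icc u x ∩ f ⁻¹' Ici 0 with hS
  have hScl : IsClosed S := (hf.mono hsub).preimage_isClosed_of_isClosed isClosed_Icc isClosed_Ici
  have hSne : S.Nonempty := ⟨u, ⟨le_rfl, hx.1⟩, hu⟩
  have hSb : BddAbove S := ⟨x, fun z hz => hz.1.2⟩
  have hmem : sSup S ∈ S := hScl.csSup_mem hSne hSb
  set s := sSup S
  have hsx : s < x := lt_of_le_of_ne hmem.1.2 (fun h => by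
    have : 0 ≤ f s := hmem.2
    rw [h] at this; linarith)
  have hneg' : ∀ z ∈ Ioo s x, f z < 0 := by
    intro z hz
    by_contra! h
    have : z ≤ s := le_csSup hSb ⟨⟨hmem.1.1.trans hz.1.le, hz.2.le⟩, h⟩
    linarith [hz.1]
  have hmono : MonotoneOn f (Icc s x) := by
    refine monotoneOn_of_deriv_nonneg (convex_Icc s x)
      (hf.mono (Icc_subset_Icc hmem.1.1 hx.2)) ?_ ?_
    · intro z hz
      rw [interior_Icc] at hz
      obtain ⟨d, -, h⟩ := hd z ⟨hmem.1.1.trans_lt hz.1, hz.2.trans_le hx.2⟩ (hneg' z hz)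
      exact h.differentiableAt.differentiableWithinAt
    · intro z hz
      rw [interior_Icc] at hz
      obtain ⟨d, h0, h⟩ := hd z ⟨hmem.1.1.trans_lt hz.1, hz.2.trans_le hx.2⟩ (hneg' z hz)
      rwa [h.deriv]
  have h1 := hmono (left_mem_Icc.2 hsx.le) (right_mem_Icc.2 hsx.le) hsx.le
  have h2 : 0 ≤ f s := hmem.2
  linarith

/-- A continuous function which is strictly increasing whenever it returns to `0`, as long as it
has been nonnegative so far, stays nonnegative. -/
theorem nonneg_of_deriv_pos_of_eq_zero {f : ℝ → ℝ} {u v : ℝ} (hf : ContinuousOn f (Icc u v))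
    (hu : 0 ≤ f u)
    (hd : ∀ x ∈ Ico u v, (∀ z ∈ Icc u x, 0 ≤ f z) → f x = 0 → ∃ d, 0 < d ∧ HasDerivAt f d x) :
    ∀ x ∈ Icc u v, 0 ≤ f x := by
  intro x hx
  by_contra! hneg
  set S := {z | z ∈ Icc u x ∧ f z < 0} with hS
  have hSne : S.Nonempty := ⟨x, ⟨hx.1, le_rfl⟩, hneg⟩
  have hSb : BddBelow S := ⟨u, fun z hz => hz.1.1⟩
  set s := sInf S with hs
  have hus : u ≤ s := le_csInf hSne fun z hz => hz.1.1
  have hsx : s ≤ x := csInf_le hSb ⟨⟨hx.1, le_rfl⟩, hneg⟩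
  have hlt : ∀ z ∈ Ico u s, 0 ≤ f z := by
    intro z hz
    by_contra! h
    have : s ≤ z := csInf_le hSb ⟨⟨hz.1, hz.2.le.trans hsx⟩, h⟩
    linarith [hz.2]
  have hcs : ContinuousWithinAt f (Icc u v) s := hf s ⟨hus, hsx.trans hx.2⟩
  have hs0 : 0 ≤ f s := by
    rcases hus.eq_or_lt with h | h
    · rwa [← h]
    · have h1 : Tendsto f (𝓝[Ico u s] s) (𝓝 (f s)) :=
        hcs.mono (fun z hz => ⟨hz.1, hz.2.le.trans (hsx.trans hx.2)⟩)
      have : NeBot (𝓝[Ico u s] s) := by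
        rw [← mem_closure_iff_nhdsWithin_neBot, closure_Ico h.ne]
        exact ⟨h.le, le_rfl⟩
      exact ge_of_tendsto h1 (eventually_nhdsWithin_of_forall hlt)
  have hs1 : f s ≤ 0 := by
    have hcl : s ∈ closure S := csInf_mem_closure hSne hSb
    have : NeBot (𝓝[S] s) := mem_closure_iff_nhdsWithin_neBot.1 hcl
    have h1 : Tendsto f (𝓝[S] s) (𝓝 (f s)) := hcs.mono (fun z hz => ⟨hz.1.1, hz.1.2.trans hx.2⟩)
    exact le_of_tendsto h1 (eventually_nhdsWithin_of_forall fun z hz => hz.2.le)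
  have hs2 : f s = 0 := le_antisymm hs1 hs0
  have hsx' : s < x := lt_of_le_of_ne hsx fun h => by rw [← h] at hneg; linarith
  have hhist : ∀ z ∈ Icc u s, 0 ≤ f z := by
    intro z hz
    rcases hz.2.eq_or_lt with h | h
    · rwa [h]
    · exact hlt z ⟨hz.1, h⟩
  obtain ⟨d, hd0, hd1⟩ := hd s ⟨hus, hsx'.trans_le hx.2⟩ hhist hs2
  have hslope := (hasDerivAt_iff_tendsto_slope.1 hd1).eventually_const_lt hd0
  rw [eventually_nhdsWithin_iff] at hslope
  obtain ⟨δ, hδ, hball⟩ := Metric.eventually_nhds_iff.1 hslope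
  obtain ⟨z, hz, hzs⟩ := exists_lt_of_csInf_lt hSne (show sInf S < s + δ by linarith)
  have hsz : s ≤ z := csInf_le hSb hz
  rcases hsz.eq_or_lt with h | h
  · rw [← h] at hz; linarith [hz.2]
  · have h1 := hball (y := z) (by rw [Real.dist_eq, abs_of_pos (by linarith)]; linarith) h.ne'
    rw [slope_def_field, hs2, sub_zero] at h1
    have h2 : 0 < z - s := by linarith
    have := (div_pos_iff_of_pos_right h2).1 h1
    linarith [hz.2]

/-- Logarithmic growth estimate. -/
theorem abs_le_mul_exp_of_mul_deriv_le {D D' Ψ ψ : ℝ → ℝ} {u v : ℝ} (huv : u ≤ v)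
    (hD : ContinuousOn D (Icc u v)) (hΨ : ContinuousOn Ψ (Icc u v))
    (hD' : ∀ x ∈ Ioo u v, HasDerivAt D (D' x) x) (hΨ' : ∀ x ∈ Ioo u v, HasDerivAt Ψ (ψ x) x)
    (h : ∀ x ∈ Ioo u v, D x * D' x ≤ ψ x * D x ^ 2) :
    |D v| ≤ |D u| * Real.exp (Ψ v - Ψ u) := by
  have hanti : AntitoneOn (fun x => D x ^ 2 * Real.exp (-2 * Ψ x)) (Icc u v) := by
    refine antitoneOn_of_hasDerivWithinAt_nonpos
      (f' := fun x => (2 * D x * D' x) * Real.exp (-2 * Ψ x) +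
        D x ^ 2 * (Real.exp (-2 * Ψ x) * (-2 * ψ x))) (convex_Icc u v)
      ((hD.pow 2).mul (Real.continuous_exp.comp_continuousOn (hΨ.const_mul _))) ?_ ?_
    · intro x hx
      rw [interior_Icc] at hx
      have h1 := ((hD' x hx).pow 2).mul (((hΨ' x hx).const_mul (-2)).exp)
      exact (h1.congr_deriv (by simp)).hasDerivWithinAt
    · intro x hx
      rw [interior_Icc] at hx
      have := h x hx
      have h2 := Real.exp_pos (-2 * Ψ x)
      nlinarith [mul_nonneg h2.le (sub_nonneg.2 this)]
  have h1 := hanti (left_mem_Icc.2 huv) (right_mem_Icc.2 huv) huv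
  simp only at h1
  refine abs_le_of_sq_le_sq' ?_ (by positivity) |> fun h => abs_le.2 h
  have h2 : D v ^ 2 = (D v ^ 2 * Real.exp (-2 * Ψ v)) * Real.exp (2 * Ψ v) := by
    rw [mul_assoc, ← Real.exp_add]; simp
  rw [h2, mul_pow, sq_abs, ← Real.exp_nat_mul]
  calc _ ≤ D u ^ 2 * Real.exp (-2 * Ψ u) * Real.exp (2 * Ψ v) := by gcongr
    _ = _ := by
      rw [mul_assoc, ← Real.exp_add]
      congr 2
      push_cast; ring

end Barriers

section Passages

/-- `Z` is (half the square of the velocity of) an arc `y > 0` of a trajectory of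
`ẋ = y, ẏ = G y - x` which starts at `(a, 0)`, as a function of the position `x ∈ [a, e]`. -/
structure Passage (G : ℝ → ℝ) (a e : ℝ) (Z : ℝ → ℝ) : Prop where
  lt : a < e
  cont : ContinuousOn Z (Icc a e)
  left : Z a = 0
  pos : ∀ x ∈ Ioo a e, 0 < Z x
  deriv : ∀ x ∈ Ioo a e, HasDerivAt Z (G √(2 * Z x) - x) x

variable {G : ℝ → ℝ}

theorem Passage.nonneg {a e : ℝ} {Z : ℝ → ℝ} (h : Passage G a e Z) : ∀ x ∈ Icc a e, 0 ≤ Z x := by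
  have h1 : Icc a e = closure (Ioo a e) := (closure_Ioo h.lt.ne).symm
  intro x hx
  have hc : Tendsto Z (𝓝[Ioo a e] x) (𝓝 (Z x)) := (h.cont x hx).mono Ioo_subset_Icc_self
  have : NeBot (𝓝[Ioo a e] x) := by rw [← mem_closure_iff_nhdsWithin_neBot, ← h1]; exact hx
  exact ge_of_tendsto hc (eventually_nhdsWithin_of_forall fun z hz => (h.pos z hz).le)

theorem sq_sqrt_two_mul_div_two {z : ℝ} (hz : 0 ≤ z) : √(2 * z) ^ 2 / 2 = z := by
  rw [Real.sq_sqrt (by linarith)]; ring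

/-- Pointwise growth rate of the difference of two arcs. -/
theorem mul_sub_le_of_one_sided {z₁ z₂ K ψ : ℝ} (h₁ : 0 < z₁) (h₂ : 0 < z₂)
    (hK : (G √(2 * z₂) - G √(2 * z₁)) * (√(2 * z₂) - √(2 * z₁)) ≤
      K * (√(2 * z₂) - √(2 * z₁)) ^ 2)
    (hψ : 2 * K ≤ ψ * (√(2 * z₁) + √(2 * z₂))) :
    (z₂ - z₁) * (G √(2 * z₂) - G √(2 * z₁)) ≤ ψ * (z₂ - z₁) ^ 2 := by
  have e₁ := sq_sqrt_two_mul_div_two h₁.le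
  have e₂ := sq_sqrt_two_mul_div_two h₂.le
  have p₁ : 0 < √(2 * z₁) := Real.sqrt_pos.2 (by linarith)
  have p₂ : 0 < √(2 * z₂) := Real.sqrt_pos.2 (by linarith)
  set y₁ := √(2 * z₁)
  set y₂ := √(2 * z₂)
  rw [← e₁, ← e₂]
  have a1 : (y₂ ^ 2 / 2 - y₁ ^ 2 / 2) * (G y₂ - G y₁) =
      ((G y₂ - G y₁) * (y₂ - y₁)) * ((y₁ + y₂) / 2) := by ring
  have a2 : ψ * (y₂ ^ 2 / 2 - y₁ ^ 2 / 2) ^ 2 =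
      (ψ * (y₁ + y₂)) * ((y₂ - y₁) ^ 2 * ((y₁ + y₂) / 4)) := by ring
  rw [a1, a2]
  calc _ ≤ K * (y₂ - y₁) ^ 2 * ((y₁ + y₂) / 2) := by gcongr
    _ = (2 * K) * ((y₂ - y₁) ^ 2 * ((y₁ + y₂) / 4)) := by ring
    _ ≤ _ := by gcongr

/-- Growth of the difference of two arcs over an interval of positions. -/
theorem Passage.abs_sub_le {a₁ e₁ a₂ e₂ u v : ℝ} {Z₁ Z₂ Ψ ψ : ℝ → ℝ} {K : ℝ}
    (h₁ : Passage G a₁ e₁ Z₁) (h₂ : Passage G a₂ e₂ Z₂) (huv : u ≤ v)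
    (ha₁ : a₁ ≤ u) (ha₂ : a₂ ≤ u) (he₁ : v ≤ e₁) (he₂ : v ≤ e₂)
    (hΨ : ContinuousOn Ψ (Icc u v)) (hΨ' : ∀ x ∈ Ioo u v, HasDerivAt Ψ (ψ x) x)
    (hK : ∀ x ∈ Ioo u v, (G √(2 * Z₂ x) - G √(2 * Z₁ x)) * (√(2 * Z₂ x) - √(2 * Z₁ x)) ≤
      K * (√(2 * Z₂ x) - √(2 * Z₁ x)) ^ 2)
    (hψ : ∀ x ∈ Ioo u v, 2 * K ≤ ψ x * (√(2 * Z₁ x) + √(2 * Z₂ x))) :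
    |Z₂ v - Z₁ v| ≤ |Z₂ u - Z₁ u| * Real.exp (Ψ v - Ψ u) := by
  have m₁ : ∀ x ∈ Ioo u v, x ∈ Ioo a₁ e₁ := fun x hx =>
    ⟨ha₁.trans_lt hx.1, hx.2.trans_le he₁⟩
  have m₂ : ∀ x ∈ Ioo u v, x ∈ Ioo a₂ e₂ := fun x hx =>
    ⟨ha₂.trans_lt hx.1, hx.2.trans_le he₂⟩
  refine abs_le_mul_exp_of_mul_deriv_le (D := fun x => Z₂ x - Z₁ x)
    (D' := fun x => G √(2 * Z₂ x) - G √(2 * Z₁ x)) huv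
    ((h₂.cont.mono (Icc_subset_Icc ha₂ he₂)).sub (h₁.cont.mono (Icc_subset_Icc ha₁ he₁))) hΨ
    (fun x hx => ?_) hΨ' (fun x hx => ?_)
  · exact ((h₂.deriv x (m₂ x hx)).sub (h₁.deriv x (m₁ x hx))).congr_deriv (by ring)
  · exact mul_sub_le_of_one_sided (h₁.pos x (m₁ x hx)) (h₂.pos x (m₂ x hx)) (hK x hx) (hψ x hx)

/-- Two arcs at the later of the two starting positions. -/
theorem Passage.abs_sub_le_of_left {a₁ e₁ a₂ e₂ M : ℝ} {Z₁ Z₂ : ℝ → ℝ}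
    (h₁ : Passage G a₁ e₁ Z₁) (h₂ : Passage G a₂ e₂ Z₂) (ha : a₂ ≤ a₁) (he : a₁ ≤ e₂)
    (hM : ∀ y, 0 ≤ y → G y - a₂ ≤ M) : |Z₂ a₁ - Z₁ a₁| ≤ M * (a₁ - a₂) := by
  rw [h₁.left, sub_zero, abs_of_nonneg (h₂.nonneg a₁ ⟨ha, he⟩)]
  have hanti : AntitoneOn (fun x => Z₂ x - M * x) (Icc a₂ a₁) := by
    refine antitoneOn_of_hasDerivWithinAt_nonpos
      (f' := fun x => G √(2 * Z₂ x) - x - M * 1) (convex_Icc _ _)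
      ((h₂.cont.mono (Icc_subset_Icc_right he)).sub (by fun_prop)) (fun x hx => ?_)
      (fun x hx => ?_)
    · rw [interior_Icc] at hx
      exact ((h₂.deriv x ⟨hx.1, hx.2.trans_le he⟩).sub
        ((hasDerivAt_id x).const_mul M)).hasDerivWithinAt
    · rw [interior_Icc] at hx
      have := hM √(2 * Z₂ x) (Real.sqrt_nonneg _)
      linarith [hx.1]
  have := hanti (left_mem_Icc.2 ha) (right_mem_Icc.2 ha) ha
  simp only [h₂.left] at this
  linarith

theorem Passage.sub_le_of_right {a₁ b₁ a₂ b₂ xc h : ℝ} {Z₁ Z₂ : ℝ → ℝ}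
    (h₁ : Passage G a₁ b₁ Z₁) (h₂ : Passage G a₂ b₂ Z₂) (hb₁ : Z₁ b₁ = 0)
    (hh : 0 < h) (hG : ∀ y, 0 ≤ y → G y ≤ xc - h) (ha₁ : a₁ < xc) (ha₂ : a₂ < xc)
    (he₁ : xc < b₁) :
    b₂ - b₁ ≤ |Z₂ xc - Z₁ xc| / h := by
  by_contra! hcon
  set E := |Z₂ xc - Z₁ xc| / h with hE
  have hE0 : 0 ≤ E := by positivity
  obtain ⟨E', hE1, hE2⟩ := exists_between hcon
  have hE' : 0 < E' := hE0.trans_lt hE1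
  have hdrop : Z₂ (xc + E') ≤ Z₂ xc - h * E' := by
    have hanti : AntitoneOn (fun x => Z₂ x + h * x) (Icc xc (xc + E')) := by
      refine antitoneOn_of_hasDerivWithinAt_nonpos
        (f' := fun x => G √(2 * Z₂ x) - x + h * 1) (convex_Icc _ _)
        ((h₂.cont.mono (Icc_subset_Icc ha₂.le (by linarith))).add (by fun_prop)) (fun x hx => ?_)
        (fun x hx => ?_)
      · rw [interior_Icc] at hx
        exact ((h₂.deriv x ⟨by linarith [hx.1], by linarith [hx.2]⟩).add
          ((hasDerivAt_id x).const_mul h)).hasDerivWithinAt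
      · rw [interior_Icc] at hx
        have := hG √(2 * Z₂ x) (Real.sqrt_nonneg _)
        linarith [hx.1]
    have := hanti (left_mem_Icc.2 (by linarith)) (right_mem_Icc.2 (by linarith))
      (show xc ≤ xc + E' by linarith)
    simp only at this
    linarith
  have hEh : |Z₂ xc - Z₁ xc| < h * E' := by
    rw [hE, div_lt_iff₀ hh] at hE1; linarith
  have hstart : 0 ≤ Z₁ xc - Z₂ (xc + E') := by
    have := le_abs_self (Z₂ xc - Z₁ xc); linarith
  have hbar := nonneg_of_deriv_pos_of_eq_zero (f := fun x => Z₁ x - Z₂ (x + E')) (u := xc)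
    (v := b₁) ?_ hstart ?_ b₁ ⟨he₁.le, le_rfl⟩
  · simp only [hb₁] at hbar
    have := h₂.pos (b₁ + E') ⟨by linarith, by linarith⟩
    linarith
  · refine (h₁.cont.mono (Icc_subset_Icc_left ha₁.le)).sub
      (h₂.cont.comp (by fun_prop) fun x hx => ⟨by linarith [hx.1], by linarith [hx.2]⟩)
  · intro x hx _ h0
    refine ⟨E', hE', ?_⟩
    have d₁ := h₁.deriv x ⟨by linarith [hx.1], hx.2⟩
    have d₂ := (h₂.deriv (x + E') ⟨by linarith [hx.1], by linarith [hx.2]⟩).comp_add_const x E'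
    have hz : Z₂ (x + E') = Z₁ x := by linarith
    rw [hz] at d₂
    exact (d₁.sub d₂).congr_deriv (by ring)

end Passages

section Trajectories

variable {G x y : ℝ → ℝ}

/-- A strictly monotone continuous function on `[0, τ]` has a continuous inverse. -/
theorem exists_continuousOn_inverse {x : ℝ → ℝ} {τ : ℝ} (hτ : 0 ≤ τ)
    (hx : StrictMonoOn x (Icc 0 τ)) (hc : ContinuousOn x (Icc 0 τ)) :
    ∃ g : ℝ → ℝ, ContinuousOn g (Icc (x 0) (x τ)) ∧ (∀ t ∈ Icc 0 τ, g (x t) = t) ∧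
      ∀ ξ ∈ Icc (x 0) (x τ), g ξ ∈ Icc 0 τ ∧ x (g ξ) = ξ := by
  have himg : x '' Icc 0 τ = Icc (x 0) (x τ) := by
    refine Subset.antisymm ?_ (intermediate_value_Icc hτ hc)
    rintro _ ⟨t, ht, rfl⟩
    exact ⟨hx.monotoneOn (left_mem_Icc.2 hτ) ht ht.1, hx.monotoneOn ht (right_mem_Icc.2 hτ) ht.2⟩
  have hord : OrdConnected (x '' Icc 0 τ) := by rw [himg]; exact ordConnected_Icc
  have hleft : ∀ t ∈ Icc 0 τ, Function.invFunOn x (Icc 0 τ) (x t) = t := fun t ht =>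
    hx.injOn.leftInvOn_invFunOn ht
  refine ⟨Function.invFunOn x (Icc 0 τ), ?_, hleft, fun ξ hξ => ?_⟩
  · rw [← himg, continuousOn_iff_continuous_domRestrict]
    have h1 : Continuous fun ξ : x '' Icc 0 τ => ((hx.orderIso x (Icc 0 τ)).symm ξ : ℝ) :=
      continuous_subtype_val.comp (hx.orderIso x (Icc 0 τ)).symm.continuous
    convert h1 using 1
    funext ξ
    obtain ⟨t, rfl⟩ := (hx.orderIso x (Icc 0 τ)).surjective ξ
    rw [OrderIso.symm_apply_apply]
    exact hleft t t.2
  · rw [← himg] at hξ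
    exact ⟨Function.invFunOn_mem hξ, Function.invFunOn_eq hξ⟩

/-- The arc of a trajectory in the half plane `y > 0`, parametrised by position. -/
theorem exists_passage_of_trajectory {τ : ℝ} (hτ : 0 < τ)
    (hx : ∀ t, HasDerivAt x (y t) t) (hy : ∀ t, HasDerivAt y (G (y t) - x t) t)
    (h0 : y 0 = 0) (hpos : ∀ t ∈ Ioo 0 τ, 0 < y t) :
    StrictMonoOn x (Icc 0 τ) ∧
      ∃ Z, Passage G (x 0) (x τ) Z ∧ ∀ t ∈ Icc 0 τ, Z (x t) = y t ^ 2 / 2 := by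
  have hxc : Continuous x := continuous_iff_continuousAt.2 fun t => (hx t).continuousAt
  have hyc : Continuous y := continuous_iff_continuousAt.2 fun t => (hy t).continuousAt
  have hmono : StrictMonoOn x (Icc 0 τ) := by
    refine strictMonoOn_of_deriv_pos (convex_Icc 0 τ) hxc.continuousOn fun t ht => ?_
    rw [interior_Icc] at ht
    rw [(hx t).deriv]
    exact hpos t ht
  refine ⟨hmono, ?_⟩
  obtain ⟨g, hgc, hgl, hgr⟩ := exists_continuousOn_inverse hτ.le hmono hxc.continuousOn
  have hgI : ∀ ξ ∈ Ioo (x 0) (x τ), g ξ ∈ Ioo 0 τ := by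
    intro ξ hξ
    obtain ⟨h1, h2⟩ := hgr ξ ⟨hξ.1.le, hξ.2.le⟩
    refine ⟨lt_of_le_of_ne h1.1 fun h => ?_, lt_of_le_of_ne h1.2 fun h => ?_⟩
    · rw [← h] at h2; linarith [hξ.1]
    · rw [h] at h2; linarith [hξ.2]
  refine ⟨fun ξ => y (g ξ) ^ 2 / 2, ⟨?_, ?_, ?_, ?_, ?_⟩, fun t ht => by simp only [hgl t ht]⟩
  · exact hmono (left_mem_Icc.2 hτ.le) (right_mem_Icc.2 hτ.le) hτ
  · exact ((hyc.comp_continuousOn hgc).pow 2).div_const 2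
  · simp only [hgl 0 (left_mem_Icc.2 hτ.le), h0]; norm_num
  · intro ξ hξ
    have := hpos _ (hgI ξ hξ)
    positivity
  · intro ξ hξ
    have hp := hpos _ (hgI ξ hξ)
    have h1 : HasDerivAt g (y (g ξ))⁻¹ ξ := by
      refine HasDerivAt.of_local_left_inverse
        ((hgc ξ ⟨hξ.1.le, hξ.2.le⟩).continuousAt (Icc_mem_nhds hξ.1 hξ.2)) (hx (g ξ)) hp.ne' ?_
      filter_upwards [Ioo_mem_nhds hξ.1 hξ.2] with ζ hζ
      exact (hgr ζ ⟨hζ.1.le, hζ.2.le⟩).2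
    have h2 : HasDerivAt (fun ξ => y (g ξ) ^ 2 / 2) _ ξ :=
      (((hy (g ξ)).comp ξ h1).pow 2).div_const 2
    have h3 : √(2 * (y (g ξ) ^ 2 / 2)) = y (g ξ) := by
      rw [mul_div_cancel₀ _ (two_ne_zero), Real.sqrt_sq hp.le]
    refine h2.congr_deriv ?_
    simp only [Function.comp, h3, (hgr ξ ⟨hξ.1.le, hξ.2.le⟩).2]
    field_simp
    ring

/-- Starting on the axis `y = 0` with `ẏ > 0`, a trajectory either stays in `y > 0` up to a given
time, or returns to `y = 0` before. -/
theorem exists_first_return_or_pos {T : ℝ} (hyc : Continuous y) {d : ℝ}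
    (hd : 0 < d) (hy : HasDerivAt y d 0) (h0 : y 0 = 0) :
    (∃ t ∈ Ioc 0 T, y t = 0 ∧ ∀ s ∈ Ioo 0 t, 0 < y s) ∨ ∀ s ∈ Ioc 0 T, 0 < y s := by
  have hslope := (hasDerivAt_iff_tendsto_slope.1 hy).eventually_const_lt hd
  rw [eventually_nhdsWithin_iff] at hslope
  obtain ⟨δ, hδ, hball⟩ := Metric.eventually_nhds_iff.1 hslope
  have hsmall : ∀ s ∈ Ioo 0 δ, 0 < y s := by
    intro s hs
    have h1 := hball (y := s) (by rw [Real.dist_eq, sub_zero, abs_of_pos hs.1]; exact hs.2) hs.1.ne'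
    rw [slope_def_field, h0, sub_zero, sub_zero] at h1
    exact (div_pos_iff_of_pos_right hs.1).1 h1
  by_cases hall : ∀ s ∈ Ioc 0 T, 0 < y s
  · exact Or.inr hall
  left
  push Not at hall
  obtain ⟨s₀, hs₀, hy₀⟩ := hall
  have hδs : δ ≤ s₀ := by
    by_contra! h
    linarith [hsmall s₀ ⟨hs₀.1, h⟩]
  set S := Icc (δ / 2) s₀ ∩ y ⁻¹' Iic 0 with hS
  have hScl : IsClosed S := isClosed_Icc.inter (isClosed_Iic.preimage hyc)
  have hSne : S.Nonempty := ⟨s₀, ⟨by linarith, le_rfl⟩, hy₀⟩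
  have hSb : BddBelow S := ⟨δ / 2, fun z hz => hz.1.1⟩
  have hmem := hScl.csInf_mem hSne hSb
  set t := sInf S
  have hpos : ∀ s ∈ Ioo 0 t, 0 < y s := by
    intro s hs
    by_cases h : s < δ
    · exact hsmall s ⟨hs.1, h⟩
    · by_contra! hle
      have : t ≤ s := csInf_le hSb ⟨⟨by linarith, hs.2.le.trans hmem.1.2⟩, hle⟩
      linarith [hs.2]
  have ht0 : 0 < t := by linarith [hmem.1.1]
  refine ⟨t, ⟨ht0, hmem.1.2.trans hs₀.2⟩, le_antisymm hmem.2 ?_, hpos⟩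
  have hc : Tendsto y (𝓝[Ioo 0 t] t) (𝓝 (y t)) := hyc.continuousAt.continuousWithinAt
  have : NeBot (𝓝[Ioo 0 t] t) := by
    rw [← mem_closure_iff_nhdsWithin_neBot, closure_Ioo ht0.ne]
    exact ⟨ht0.le, le_rfl⟩
  exact ge_of_tendsto hc (eventually_nhdsWithin_of_forall fun z hz => (hpos z hz).le)

/-- Existence of a half turn together with a bound for its duration, from a priori bounds on
arcs. -/
theorem exists_half_turn {m c h xc Y : ℝ} (hm : 0 < m) (hc : 0 < c) (hh : 0 < h) (hY : 0 < Y)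
    (hx : ∀ t, HasDerivAt x (y t) t) (hy : ∀ t, HasDerivAt y (G (y t) - x t) t)
    (h0 : y 0 = 0) (hG0 : 0 < G 0 - x 0) (hxc : x 0 < xc)
    (low : ∀ e Z, Passage G (x 0) e Z → ∀ ξ ∈ Icc (x 0) (min e xc),
      min (m * (ξ - x 0)) (c ^ 2 / 2) ≤ Z ξ)
    (high : ∀ e Z, Passage G (x 0) e Z → ∀ ξ ∈ Icc (x 0) e, Z ξ ≤ Y ^ 2 / 2)
    (hG : ∀ v ∈ Icc 0 Y, G v ≤ xc - h) :
    ∃ t₁ ∈ Ioc 0 (c / m + (xc - x 0) / c + Y / h), y t₁ = 0 ∧ (∀ t ∈ Ioo 0 t₁, 0 < y t) ∧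
      xc < x t₁ ∧ ∃ Z, Passage G (x 0) (x t₁) Z ∧ Z (x t₁) = 0 ∧
        ∀ t ∈ Icc 0 t₁, x t ∈ Icc (x 0) (x t₁) ∧ Z (x t) = y t ^ 2 / 2 := by
  have hyc : Continuous y := continuous_iff_continuousAt.2 fun t => (hy t).continuousAt
  have hxcont : Continuous x := continuous_iff_continuousAt.2 fun t => (hx t).continuousAt
  have hd1 : 0 < c / m := by positivity
  have hd2 : 0 < (xc - x 0) / c := div_pos (by linarith) hc
  have hd3 : 0 < Y / h := by positivity
  set T₁ := c / m with hT₁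
  set T₂ := T₁ + (xc - x 0) / c with hT₂
  set T := T₂ + Y / h with hT
  have hT0 : 0 < T := by positivity
  have hy0 : HasDerivAt y (G 0 - x 0) 0 := by simpa [h0] using hy 0
  rcases exists_first_return_or_pos (T := T) hyc hG0 hy0 h0 with ⟨t₁, ht₁, hyt, hpos⟩ | hpos
  · refine ⟨t₁, ht₁, hyt, hpos, ?_⟩
    obtain ⟨hmono, Z, hZ, hZy⟩ := exists_passage_of_trajectory ht₁.1 hx hy h0 hpos
    have hZ1 : Z (x t₁) = 0 := by rw [hZy t₁ ⟨ht₁.1.le, le_rfl⟩, hyt]; norm_num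
    refine ⟨?_, Z, hZ, hZ1, fun t ht => ⟨⟨hmono.monotoneOn (left_mem_Icc.2 ht₁.1.le) ht ht.1,
      hmono.monotoneOn ht (right_mem_Icc.2 ht₁.1.le) ht.2⟩, hZy t ht⟩⟩
    by_contra! hle
    have h1 := low _ _ hZ (x t₁) ⟨hZ.lt.le, by simp [hle]⟩
    rw [hZ1] at h1
    have h2 := hZ.lt
    have : 0 < min (m * (x t₁ - x 0)) (c ^ 2 / 2) :=
      lt_min (mul_pos hm (by linarith)) (by positivity)
    linarith
  · exfalso
    obtain ⟨hmono, Z, hZ, hZy⟩ := exists_passage_of_trajectory hT0 hx hy h0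
      fun t ht => hpos t ⟨ht.1, ht.2.le⟩
    have hm' := hmono.monotoneOn
    have hT₁T₂ : T₁ < T₂ := by linarith
    have hT₂T : T₂ < T := by linarith
    have hlow : ∀ t ∈ Icc 0 T, x t ≤ xc → min (m * (x t - x 0)) (c ^ 2 / 2) ≤ y t ^ 2 / 2 := by
      intro t ht hle
      rw [← hZy t ht]
      exact low _ _ hZ (x t) ⟨hm' (left_mem_Icc.2 hT0.le) ht ht.1,
        le_min (hm' ht (right_mem_Icc.2 hT0.le) ht.2) hle⟩
    have hyY : ∀ t ∈ Ioc 0 T, y t ≤ Y := by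
      intro t ht
      have h1 := high _ _ hZ (x t) ⟨hm' (left_mem_Icc.2 hT0.le) ⟨ht.1.le, ht.2⟩ ht.1.le,
        hm' ⟨ht.1.le, ht.2⟩ (right_mem_Icc.2 hT0.le) ht.2⟩
      rw [hZy t ⟨ht.1.le, ht.2⟩] at h1
      exact abs_le_of_sq_le_sq (by linarith) hY.le |> fun h => (abs_le.1 h).2
    have hx2 : xc ≤ x T₂ := by
      by_contra! hlt
      have hmid : ∀ t ∈ Icc 0 T₂, x t ≤ xc := fun t ht =>
        (hm' ⟨ht.1, ht.2.trans hT₂T.le⟩ ⟨by linarith, hT₂T.le⟩ ht.2).trans hlt.le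
      have hT1 : c ^ 2 / 2 ≤ m * (x T₁ - x 0) := by
        by_contra! hcon
        have hs : ∀ t ∈ Ioo 0 T₁, 0 < x t - x 0 := fun t ht => by
          have := hmono (left_mem_Icc.2 hT0.le) ⟨ht.1.le, by linarith [ht.2]⟩ ht.1
          linarith
        have hmo : MonotoneOn (fun t => √(x t - x 0) - √(m / 2) * t) (Icc 0 T₁) := by
          refine monotoneOn_of_hasDerivWithinAt_nonneg
            (f' := fun t => y t / (2 * √(x t - x 0)) - √(m / 2) * 1) (convex_Icc _ _)
            (by fun_prop) (fun t ht => ?_) (fun t ht => ?_)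
          · rw [interior_Icc] at ht
            exact ((((hx t).sub_const (x 0)).sqrt (hs t ht).ne').sub
              ((hasDerivAt_id t).const_mul _)).hasDerivWithinAt
          · rw [interior_Icc] at ht
            have hst := hs t ht
            have hyp := hpos t ⟨ht.1, by linarith [ht.2]⟩
            have h1 := hlow t ⟨ht.1.le, by linarith [ht.2]⟩ (hmid t ⟨ht.1.le, by linarith [ht.2]⟩)
            have h2 : x t ≤ x T₁ := hm' ⟨ht.1.le, by linarith [ht.2]⟩ ⟨hd1.le, by linarith⟩ ht.2.le
            have h3 : m * (x t - x 0) < c ^ 2 / 2 := lt_of_le_of_lt (by gcongr) hcon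
            rw [min_eq_left h3.le] at h1
            rw [mul_one, sub_nonneg, le_div_iff₀ (by positivity)]
            have h4 : √(m / 2) * (2 * √(x t - x 0)) = √(2 * (m * (x t - x 0))) := by
              have : 2 * (m * (x t - x 0)) = (m / 2) * (2 ^ 2 * (x t - x 0)) := by ring
              rw [this, Real.sqrt_mul (by positivity), Real.sqrt_mul (by positivity),
                Real.sqrt_sq (by norm_num)]
            rw [h4, Real.sqrt_le_left hyp.le]
            linarith
        have h5 := hmo (left_mem_Icc.2 hd1.le) (right_mem_Icc.2 hd1.le) hd1.le
        simp only [sub_self, Real.sqrt_zero, mul_zero] at h5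
        have h6 : √(m / 2) * T₁ ≤ √(x T₁ - x 0) := by linarith
        have h7 : 0 ≤ x T₁ - x 0 := by
          have := hm' (left_mem_Icc.2 hT0.le) ⟨hd1.le, by linarith⟩ hd1.le; linarith
        have h8 : (√(m / 2) * T₁) ^ 2 ≤ √(x T₁ - x 0) ^ 2 := by gcongr
        rw [mul_pow, Real.sq_sqrt (by positivity), Real.sq_sqrt h7, hT₁] at h8
        have h9 : m / 2 * (c / m) ^ 2 = c ^ 2 / 2 / m := by field_simp
        rw [h9, div_le_iff₀ hm] at h8
        linarith
      have hmo : MonotoneOn (fun t => x t - c * t) (Icc T₁ T₂) := by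
        refine monotoneOn_of_hasDerivWithinAt_nonneg
            (f' := fun t => y t - c * 1) (convex_Icc _ _)
            (by fun_prop) (fun t ht => ?_) (fun t ht => ?_)
        · exact ((hx t).sub ((hasDerivAt_id t).const_mul _)).hasDerivWithinAt
        · rw [interior_Icc] at ht
          have hyp := hpos t ⟨by linarith [ht.1], by linarith [ht.2]⟩
          have h1 := hlow t ⟨by linarith [ht.1], by linarith [ht.2]⟩
            (hmid t ⟨by linarith [ht.1], by linarith [ht.2]⟩)
          have h2 : x T₁ ≤ x t := hm' ⟨hd1.le, by linarith⟩ ⟨by linarith [ht.1], by linarith [ht.2]⟩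
            ht.1.le
          have h3 : m * (x T₁ - x 0) ≤ m * (x t - x 0) := by gcongr
          rw [min_eq_right (by linarith)] at h1
          have := abs_le_of_sq_le_sq (show c ^ 2 ≤ y t ^ 2 by linarith) hyp.le
          linarith [(abs_le.1 this).2]
      have h5 := hmo (left_mem_Icc.2 hT₁T₂.le) (right_mem_Icc.2 hT₁T₂.le) hT₁T₂.le
      have h6 : c * (T₂ - T₁) = xc - x 0 := by rw [hT₂]; field_simp; ring
      have h7 := hm' (left_mem_Icc.2 hT0.le) ⟨hd1.le, by linarith⟩ hd1.le
      simp only at h5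
      linarith
    have hmo : AntitoneOn (fun t => y t + h * t) (Icc T₂ T) := by
      refine antitoneOn_of_hasDerivWithinAt_nonpos
          (f' := fun t => G (y t) - x t + h * 1) (convex_Icc _ _)
          (by fun_prop) (fun t ht => ?_) (fun t ht => ?_)
      · exact ((hy t).add ((hasDerivAt_id t).const_mul _)).hasDerivWithinAt
      · rw [interior_Icc] at ht
        have htm : t ∈ Ioc 0 T := ⟨by linarith [ht.1], ht.2.le⟩
        have h1 := hG (y t) ⟨(hpos t htm).le, hyY t htm⟩
        have h2 := hm' ⟨by linarith, hT₂T.le⟩ ⟨htm.1.le, htm.2⟩ ht.1.le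
        linarith
    have h5 := hmo (left_mem_Icc.2 hT₂T.le) (right_mem_Icc.2 hT₂T.le) hT₂T.le
    have h6 : h * (T - T₂) = Y := by rw [hT]; field_simp; ring
    have h7 := hyY T₂ ⟨by linarith, hT₂T.le⟩
    have h8 := hpos T ⟨hT0, le_rfl⟩
    simp only at h5
    linarith

end Trajectories

section HalfTurns

variable {G : ℝ → ℝ} {a e : ℝ} {Z : ℝ → ℝ}

theorem sqrt_two_mul_lt_of_lt {z c : ℝ} (hc : 0 < c) (h : z < c ^ 2 / 2) : √(2 * z) < c :=
  (Real.sqrt_lt' hc).2 (by linarith)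

theorem le_sqrt_two_mul_of_le {z c : ℝ} (h : c ^ 2 / 2 ≤ z) : c ≤ √(2 * z) :=
  Real.le_sqrt_of_sq_le (by linarith)

theorem sqrt_two_mul_le_of_le {z c : ℝ} (hc : 0 ≤ c) (h : z ≤ c ^ 2 / 2) : √(2 * z) ≤ c :=
  (Real.sqrt_le_left hc).2 (by linarith)

/-- Initial growth of an arc. -/
theorem Passage.min_le (hZ : Passage G a e Z) {m c l : ℝ} (hm : 0 < m) (hc : 0 < c)
    (H : ∀ x ∈ Ioo a (min e l), √(2 * Z x) < c → m ≤ G √(2 * Z x) - x) :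
    ∀ x ∈ Icc a (min e l), min (m * (x - a)) (c ^ 2 / 2) ≤ Z x := by
  have first : ∀ x ∈ Icc a (min e l), m * (x - a) ≤ c ^ 2 / 2 → m * (x - a) ≤ Z x := by
    intro x hx hxc
    have hxe : x ≤ e := hx.2.trans (min_le_left _ _)
    have := nonneg_of_deriv_nonneg_of_neg (f := fun x => Z x - m * (x - a)) (u := a) (v := x)
      ((hZ.cont.mono (Icc_subset_Icc_right hxe)).sub (by fun_prop)) (by simp [hZ.left])
      (fun ξ hξ hneg => ?_) x ⟨hx.1, le_rfl⟩
    · linarith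
    · refine ⟨_, ?_, (hZ.deriv ξ ⟨hξ.1, hξ.2.trans_le hxe⟩).sub
        (((hasDerivAt_id ξ).sub_const a).const_mul m)⟩
      have h1 : m * (ξ - a) ≤ m * (x - a) := by gcongr; exact hξ.2.le
      have := H ξ ⟨hξ.1, hξ.2.trans_le hx.2⟩ (sqrt_two_mul_lt_of_lt hc (by linarith))
      linarith
  intro x hx
  rcases le_total (m * (x - a)) (c ^ 2 / 2) with h | h
  · exact (min_le_left _ _).trans (first x hx h)
  · refine (min_le_right _ _).trans ?_
    have hs : a < a + c ^ 2 / 2 / m := by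
      have : 0 < c ^ 2 / 2 / m := by positivity
      linarith
    have hsx : a + c ^ 2 / 2 / m ≤ x := by
      have : c ^ 2 / 2 / m ≤ x - a := by rw [div_le_iff₀ hm]; linarith
      linarith
    have hxe : x ≤ e := hx.2.trans (_root_.min_le_left _ _)
    have h0 : c ^ 2 / 2 ≤ Z (a + c ^ 2 / 2 / m) := by
      have e1 : m * (a + c ^ 2 / 2 / m - a) = c ^ 2 / 2 := by field_simp; ring
      have := first (a + c ^ 2 / 2 / m) ⟨hs.le, hsx.trans hx.2⟩ e1.le
      rwa [e1] at this
    have := nonneg_of_deriv_nonneg_of_neg (f := fun x => Z x - c ^ 2 / 2)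
      (u := a + c ^ 2 / 2 / m) (v := x)
      ((hZ.cont.mono (Icc_subset_Icc hs.le hxe)).sub (by fun_prop)) (by linarith)
      (fun ξ hξ hneg => ?_) x ⟨hsx, le_rfl⟩
    · linarith
    · have hξa : a < ξ := hs.trans hξ.1
      refine ⟨_, ?_, (hZ.deriv ξ ⟨hξa, hξ.2.trans_le hxe⟩).sub_const _⟩
      have := H ξ ⟨hξa, hξ.2.trans_le hx.2⟩ (sqrt_two_mul_lt_of_lt hc (by linarith))
      linarith

/-- The difference of two arcs just after the start of the later one. -/
theorem Passage.abs_sub_le_of_start {a₁ e₁ a₂ e₂ m s K : ℝ} {Z₁ Z₂ : ℝ → ℝ}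
    (h₁ : Passage G a₁ e₁ Z₁) (h₂ : Passage G a₂ e₂ Z₂) (ha : a₂ ≤ a₁) (hs : 0 ≤ s)
    (he₁ : a₁ + s ≤ e₁) (he₂ : a₁ + s ≤ e₂) (hm : 0 < m) (hK0 : 0 ≤ K)
    (hZ : ∀ x ∈ Ioo a₁ (a₁ + s), m * (x - a₁) ≤ Z₁ x)
    (hK : ∀ y₁ y₂, 0 ≤ y₁ → 0 ≤ y₂ → (G y₂ - G y₁) * (y₂ - y₁) ≤ K * (y₂ - y₁) ^ 2) :
    |Z₂ (a₁ + s) - Z₁ (a₁ + s)| ≤ |Z₂ a₁ - Z₁ a₁| * Real.exp (2 * K * √(2 * s / m)) := by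
  have := h₁.abs_sub_le h₂ (u := a₁) (v := a₁ + s) (K := K)
    (Ψ := fun x => 2 * K * √(2 * (x - a₁) / m))
    (ψ := fun x => 2 * K / √(2 * (m * (x - a₁)))) (by linarith) le_rfl ha he₁ he₂
    (by fun_prop) ?_ (fun x _ => hK _ _ (Real.sqrt_nonneg _) (Real.sqrt_nonneg _)) ?_
  · simpa using this
  · intro x hx
    have hxa : 0 < x - a₁ := by linarith [hx.1]
    have h0 : HasDerivAt (fun x => 2 * (x - a₁) / m) (2 * 1 / m) x :=
      ((((hasDerivAt_id x).sub_const a₁).const_mul 2).div_const m)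
    refine ((h0.sqrt (by positivity)).const_mul (2 * K)).congr_deriv ?_
    have e1 : √(2 * (m * (x - a₁))) = m * √(2 * (x - a₁) / m) := by
      have : 2 * (m * (x - a₁)) = m ^ 2 * (2 * (x - a₁) / m) := by field_simp
      rw [this, Real.sqrt_mul (by positivity), Real.sqrt_sq hm.le]
    rw [e1]
    have : 0 < √(2 * (x - a₁) / m) := Real.sqrt_pos.2 (by positivity)
    field_simp
  · intro x hx
    have hxa : 0 < x - a₁ := by linarith [hx.1]
    have hp : 0 < √(2 * (m * (x - a₁))) := Real.sqrt_pos.2 (by positivity)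
    have h1 : √(2 * (m * (x - a₁))) ≤ √(2 * Z₁ x) :=
      Real.sqrt_le_sqrt (by linarith [hZ x hx])
    have h2 : 0 ≤ √(2 * Z₂ x) := Real.sqrt_nonneg _
    rw [div_mul_eq_mul_div, le_div_iff₀ hp]
    gcongr
    linarith

end HalfTurns

section Upper

/-- The properties of the friction force used for the half turns in `y > 0`. -/
structure UpperField (F : ℝ → ℝ) (r δ gs m yd yu K C b h : ℝ) : Prop where
  δ_pos : 0 < δ
  δr : δ ≤ r
  m_pos : 0 < m
  b_pos : 0 < b
  b_yd : b ≤ yd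
  yd_yu : yd ≤ yu
  yu2 : yu ≤ 2
  K_nonneg : 0 ≤ K
  C_nonneg : 0 ≤ C
  h_pos : 0 < h
  h1 : h ≤ 1
  h2 : (gs + 1) * h ≤ b ^ 2 / 4
  start : yd ^ 2 / 2 / m ≤ δ / 2
  le_gs : ∀ y, 0 ≤ y → F y ≤ gs
  le_b : ∀ y, 0 ≤ y → F y ≤ F b
  ge_m : ∀ y ∈ Icc 0 yd, m ≤ F y
  le_r : ∀ y, yu ≤ y → F y ≤ -r - 1
  lip : ∀ y₁ y₂, 0 ≤ y₁ → 0 ≤ y₂ → (F y₂ - F y₁) * (y₂ - y₁) ≤ K * (y₂ - y₁) ^ 2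
  contr : ∀ y₁ y₂, yd ≤ y₁ → y₁ ≤ yu → yd ≤ y₂ → y₂ ≤ yu →
    (F y₂ - F y₁) * (y₂ - y₁) ≤ -C * (y₂ - y₁) ^ 2
  anti : AntitoneOn F (Ici b)

namespace UpperField

variable {F : ℝ → ℝ} {r δ gs m yd yu K C b h : ℝ}

theorem Fb_pos (H : UpperField F r δ gs m yd yu K C b h) : 0 < F b :=
  H.m_pos.trans_le (H.ge_m b ⟨H.b_pos.le, H.b_yd⟩)

theorem Fb_le (H : UpperField F r δ gs m yd yu K C b h) : F b ≤ gs := H.le_gs b H.b_pos.le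

variable {a e : ℝ} {Z : ℝ → ℝ}

theorem high (H : UpperField F r δ gs m yd yu K C b h) (hZ : Passage F a e Z) (ha : -r ≤ a) :
    ∀ x ∈ Icc a e, Z x ≤ yu ^ 2 / 2 := by
  intro x hx
  have := nonneg_of_deriv_nonneg_of_neg (f := fun x => yu ^ 2 / 2 - Z x) (u := a) (v := e)
    (continuousOn_const.sub hZ.cont) (by simp [hZ.left]; positivity) (fun ξ hξ hneg => ?_) x hx
  · linarith
  · refine ⟨_, ?_, (hZ.deriv ξ hξ).const_sub _⟩
    have := H.le_r √(2 * Z ξ) (le_sqrt_two_mul_of_le (by linarith))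
    linarith [hξ.1]

theorem low_left (H : UpperField F r δ gs m yd yu K C b h) (hZ : Passage F a e Z) :
    ∀ x ∈ Icc a (min e 0), min (m * (x - a)) (yd ^ 2 / 2) ≤ Z x := by
  refine hZ.min_le H.m_pos (H.b_pos.trans_le H.b_yd) fun x hx hlt => ?_
  have := H.ge_m √(2 * Z x) ⟨Real.sqrt_nonneg _, hlt.le⟩
  have := hx.2.trans_le (min_le_right _ _)
  linarith

theorem yd_le_of_left (H : UpperField F r δ gs m yd yu K C b h) (hZ : Passage F a e Z) :
    ∀ x ∈ Icc (a + yd ^ 2 / 2 / m) (min e 0), yd ^ 2 / 2 ≤ Z x := by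
  intro x hx
  have hm := H.m_pos
  have h0 : 0 ≤ yd ^ 2 / 2 / m := by positivity
  have h1 := H.low_left hZ x ⟨by linarith [hx.1], hx.2⟩
  have h2 : yd ^ 2 / 2 ≤ m * (x - a) := by
    have : yd ^ 2 / 2 / m ≤ x - a := by linarith [hx.1]
    rw [div_le_iff₀ hm] at this; linarith
  rwa [min_eq_right h2] at h1

theorem low_mid (H : UpperField F r δ gs m yd yu K C b h) (hZ : Passage F a e Z) (ha : a ≤ -δ) :
    ∀ x ∈ Icc 0 (min e (F b)), b ^ 2 / 2 ≤ Z x := by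
  intro x hx
  have hδ := H.δ_pos
  have hb := H.b_pos
  have hxe : x ≤ e := hx.2.trans (min_le_left _ _)
  have hxF : x ≤ F b := hx.2.trans (min_le_right _ _)
  have h0 : b ^ 2 / 2 ≤ Z 0 := by
    have h1 := H.yd_le_of_left hZ 0 ⟨by linarith [H.start], le_min (hx.1.trans hxe) le_rfl⟩
    have : b ^ 2 ≤ yd ^ 2 := by gcongr; exact H.b_yd
    linarith
  have := nonneg_of_deriv_pos_of_eq_zero (f := fun x => Z x - b ^ 2 / 2) (u := 0) (v := x)
    ((hZ.cont.mono (Icc_subset_Icc (by linarith) hxe)).sub continuousOn_const) (by linarith)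
    (fun ξ hξ _ heq => ?_) x ⟨hx.1, le_rfl⟩
  · linarith
  · refine ⟨_, ?_, (hZ.deriv ξ ⟨by linarith [hξ.1], hξ.2.trans_le hxe⟩).sub_const _⟩
    have : Z ξ = b ^ 2 / 2 := by linarith
    rw [this, mul_div_cancel₀ _ (two_ne_zero), Real.sqrt_sq hb.le]
    linarith [hξ.2]

theorem low_right (H : UpperField F r δ gs m yd yu K C b h) (hZ : Passage F a e Z) (ha : a ≤ -δ) :
    ∀ x ∈ Icc (F b) (min e (F b + h)), (b / 2) ^ 2 / 2 ≤ Z x := by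
  intro x hx
  have hδ := H.δ_pos
  have hb := H.b_pos
  have hF := H.Fb_pos
  have hxe : x ≤ e := hx.2.trans (min_le_left _ _)
  have hxF : x ≤ F b + h := hx.2.trans (min_le_right _ _)
  have h0 := H.low_mid hZ ha (F b) ⟨hF.le, le_min (hx.1.trans hxe) le_rfl⟩
  have := nonneg_of_deriv_nonneg_of_neg (f := fun x => Z x - b ^ 2 / 2 + (gs + 1) * (x - F b))
    (u := F b) (v := x)
    (((hZ.cont.mono (Icc_subset_Icc (by linarith) hxe)).sub continuousOn_const).add (by fun_prop))
    (by linarith) (fun ξ hξ hneg => ?_) x ⟨hx.1, le_rfl⟩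
  · have h1 : (gs + 1) * (x - F b) ≤ (gs + 1) * h := by
      have := H.Fb_le
      gcongr
      · linarith
      · linarith
    have := H.h2
    nlinarith
  · refine ⟨_, ?_, ((hZ.deriv ξ ⟨by linarith [hξ.1], hξ.2.trans_le hxe⟩).sub_const _).add
      (((hasDerivAt_id ξ).sub_const (F b)).const_mul (gs + 1))⟩
    have h3 : 0 ≤ (gs + 1) * (ξ - F b) :=
      mul_nonneg (by linarith [H.Fb_le]) (by linarith [hξ.1])
    have h2 := H.ge_m √(2 * Z ξ) ⟨Real.sqrt_nonneg _,
      (sqrt_two_mul_lt_of_lt hb (by linarith)).le.trans H.b_yd⟩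
    linarith [hξ.2, H.Fb_le, H.h1, H.m_pos]

theorem low (H : UpperField F r δ gs m yd yu K C b h) (hZ : Passage F a e Z) (ha : a ≤ -δ) :
    ∀ x ∈ Icc a (min e (F b + h)), min (m * (x - a)) ((b / 2) ^ 2 / 2) ≤ Z x := by
  intro x hx
  have hb := H.b_pos
  have hxe : x ≤ e := hx.2.trans (min_le_left _ _)
  have hxF : x ≤ F b + h := hx.2.trans (min_le_right _ _)
  have hbb : (b / 2) ^ 2 / 2 ≤ b ^ 2 / 2 := by nlinarith
  rcases le_total x 0 with h0 | h0
  · refine le_trans ?_ (H.low_left hZ x ⟨hx.1, le_min hxe h0⟩)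
    have : b ^ 2 ≤ yd ^ 2 := by gcongr; exact H.b_yd
    exact min_le_min le_rfl (by linarith)
  · refine (min_le_right _ _).trans ?_
    rcases le_total x (F b) with h1 | h1
    · exact hbb.trans (H.low_mid hZ ha x ⟨h0, le_min hxe h1⟩)
    · exact H.low_right hZ ha x ⟨h1, le_min hxe hxF⟩

theorem exit_le (H : UpperField F r δ gs m yd yu K C b h) (hZ : Passage F a e Z) (ha : -r ≤ a)
    (ha' : a ≤ -δ) (he : 0 < e) (he0 : Z e = 0) : e ≤ 2 * gs + 2 := by
  have hδ := H.δ_pos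
  have hanti : AntitoneOn (fun x => Z x + x ^ 2 / 2 - gs * x) (Icc 0 e) := by
    refine antitoneOn_of_hasDerivWithinAt_nonpos
      (f' := fun x => F √(2 * Z x) - x + x - gs * 1) (convex_Icc _ _)
      (((hZ.cont.mono (Icc_subset_Icc_left (by linarith))).add (by fun_prop)).sub (by fun_prop))
      (fun x hx => ?_) (fun x hx => ?_)
    · rw [interior_Icc] at hx
      have h1 : HasDerivAt (fun x : ℝ => x ^ 2 / 2) x x :=
        (((hasDerivAt_id x).pow 2).div_const 2).congr_deriv (by simp)
      exact (((hZ.deriv x ⟨by linarith [hx.1], hx.2⟩).add h1).sub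
        ((hasDerivAt_id x).const_mul gs)).hasDerivWithinAt
    · have := H.le_gs √(2 * Z x) (Real.sqrt_nonneg _)
      linarith
  have h1 := hanti (left_mem_Icc.2 he.le) (right_mem_Icc.2 he.le) he.le
  have h2 := H.high hZ ha 0 ⟨by linarith, he.le⟩
  have h3 : 0 < yu := H.b_pos.trans_le (H.b_yd.trans H.yd_yu)
  have h4 := H.yu2
  have h5 : 0 < gs := H.Fb_pos.trans_le H.Fb_le
  simp only [he0] at h1
  by_contra! hcon
  nlinarith

theorem abs_sub_le (H : UpperField F r δ gs m yd yu K C b h) {a₁ b₁ a₂ b₂ : ℝ} {Z₁ Z₂ : ℝ → ℝ}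
    (h₁ : Passage F a₁ b₁ Z₁) (h₂ : Passage F a₂ b₂ Z₂) (ha : a₂ ≤ a₁) (hr : -r ≤ a₂)
    (hδ : a₁ ≤ -δ) (hb₁ : Z₁ b₁ = 0) (hb₂ : Z₂ b₂ = 0) (hc₁ : F b + h < b₁)
    (hc₂ : F b + h < b₂) :
    |b₁ - b₂| ≤ (gs + r) * Real.exp (2 * K * yd / m - C * δ / (2 * yu) + 2 * K * h / b) / h *
      |a₁ - a₂| := by
  have hδ0 := H.δ_pos
  have hm := H.m_pos
  have hb := H.b_pos
  have hh := H.h_pos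
  have hF := H.Fb_pos
  have hyd : 0 < yd := hb.trans_le H.b_yd
  have hyu : 0 < yu := hyd.trans_le H.yd_yu
  have hgr : 0 < gs + r := by linarith [H.Fb_le, H.δr]
  set s := yd ^ 2 / 2 / m with hs
  have hs0 : 0 < s := by positivity
  have hsδ : s ≤ δ / 2 := H.start
  have i0 : |Z₂ a₁ - Z₁ a₁| ≤ (gs + r) * (a₁ - a₂) :=
    h₁.abs_sub_le_of_left h₂ ha (by linarith) fun y hy => by linarith [H.le_gs y hy]
  have i1 : |Z₂ (a₁ + s) - Z₁ (a₁ + s)| ≤ |Z₂ a₁ - Z₁ a₁| * Real.exp (2 * K * (yd / m)) := by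
    have h1 := h₁.abs_sub_le_of_start h₂ ha hs0.le (by linarith) (by linarith) hm H.K_nonneg
      (fun x hx => ?_) H.lip
    · have : √(2 * s / m) = yd / m := by
        rw [hs, show 2 * (yd ^ 2 / 2 / m) / m = (yd / m) ^ 2 by field_simp,
          Real.sqrt_sq (by positivity)]
      rwa [this] at h1
    · have h2 := H.low_left h₁ x ⟨hx.1.le, le_min (by linarith [hx.2]) (by linarith [hx.2])⟩
      have h3 : m * (x - a₁) ≤ yd ^ 2 / 2 := by
        have : x - a₁ ≤ yd ^ 2 / 2 / m := by linarith [hx.2]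
        rw [le_div_iff₀ hm] at this; linarith
      rwa [min_eq_left h3] at h2
  have i2 : |Z₂ 0 - Z₁ 0| ≤ |Z₂ (a₁ + s) - Z₁ (a₁ + s)| * Real.exp (-(C * δ / (2 * yu))) := by
    have bnd : ∀ x ∈ Ioo (a₁ + s) 0, (yd ≤ √(2 * Z₁ x) ∧ √(2 * Z₁ x) ≤ yu) ∧
        yd ≤ √(2 * Z₂ x) ∧ √(2 * Z₂ x) ≤ yu := fun x hx =>
      ⟨⟨le_sqrt_two_mul_of_le
        (H.yd_le_of_left h₁ x ⟨hx.1.le, le_min (by linarith [hx.2]) hx.2.le⟩),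
        sqrt_two_mul_le_of_le hyu.le
          (H.high h₁ (by linarith) x ⟨by linarith [hx.1], by linarith [hx.2]⟩)⟩,
       le_sqrt_two_mul_of_le
        (H.yd_le_of_left h₂ x ⟨by linarith [hx.1], le_min (by linarith [hx.2]) hx.2.le⟩),
        sqrt_two_mul_le_of_le hyu.le
          (H.high h₂ (by linarith) x ⟨by linarith [hx.1], by linarith [hx.2]⟩)⟩
    have h1 := h₁.abs_sub_le h₂ (u := a₁ + s) (v := 0) (K := -C) (Ψ := fun x => -(C / yu) * x)
      (ψ := fun x => -(C / yu) * 1) (by linarith) (by linarith) (by linarith) (by linarith)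
      (by linarith) (by fun_prop) (fun x _ => (hasDerivAt_id x).const_mul _)
      (fun x hx => H.contr _ _ (bnd x hx).1.1 (bnd x hx).1.2 (bnd x hx).2.1 (bnd x hx).2.2)
      (fun x hx => ?_)
    · refine h1.trans ?_
      gcongr
      have h3 : δ / 2 ≤ -(a₁ + s) := by linarith
      have h4 : C / yu * (δ / 2) ≤ C / yu * -(a₁ + s) := by
        have := H.C_nonneg
        gcongr
      have h5 : C * δ / (2 * yu) = C / yu * (δ / 2) := by field_simp
      rw [h5]
      linarith
    · have h3 : √(2 * Z₁ x) + √(2 * Z₂ x) ≤ 2 * yu := by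
        linarith [(bnd x hx).1.2, (bnd x hx).2.2]
      have h4 : C / yu * (√(2 * Z₁ x) + √(2 * Z₂ x)) ≤ C / yu * (2 * yu) := by
        have := H.C_nonneg
        gcongr
      have h5 : C / yu * (2 * yu) = 2 * C := by field_simp
      linarith
  have i3 : |Z₂ (F b) - Z₁ (F b)| ≤ |Z₂ 0 - Z₁ 0| := by
    have h1 := h₁.abs_sub_le h₂ (u := 0) (v := F b) (K := 0) (Ψ := fun _ => 0)
      (ψ := fun _ => 0) hF.le (by linarith) (by linarith) (by linarith)
      (by linarith) (by fun_prop) (fun x _ => hasDerivAt_const _ _)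
      (fun x hx => ?_) (fun x hx => by simp)
    · simpa using h1
    · have g₁ := le_sqrt_two_mul_of_le
        (H.low_mid h₁ hδ x ⟨hx.1.le, le_min (by linarith [hx.2]) hx.2.le⟩)
      have g₂ := le_sqrt_two_mul_of_le
        (H.low_mid h₂ (by linarith) x ⟨hx.1.le, le_min (by linarith [hx.2]) hx.2.le⟩)
      rw [zero_mul]
      rcases le_total √(2 * Z₁ x) √(2 * Z₂ x) with hle | hle
      · exact mul_nonpos_of_nonpos_of_nonneg (sub_nonpos.2 (H.anti g₁ g₂ hle)) (sub_nonneg.2 hle)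
      · exact mul_nonpos_of_nonneg_of_nonpos (sub_nonneg.2 (H.anti g₂ g₁ hle)) (sub_nonpos.2 hle)
  have i4 : |Z₂ (F b + h) - Z₁ (F b + h)| ≤
      |Z₂ (F b) - Z₁ (F b)| * Real.exp (2 * K * h / b) := by
    have h1 := h₁.abs_sub_le h₂ (u := F b) (v := F b + h) (K := K)
      (Ψ := fun x => (2 * K / b) * x)
      (ψ := fun x => (2 * K / b) * 1) (by linarith) (by linarith) (by linarith) (by linarith)
      (by linarith) (by fun_prop) (fun x _ => (hasDerivAt_id x).const_mul _)
      (fun x hx => H.lip _ _ (Real.sqrt_nonneg _) (Real.sqrt_nonneg _))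
      (fun x hx => ?_)
    · have e1 : 2 * K / b * (F b + h) - 2 * K / b * F b = 2 * K * h / b := by ring
      rwa [e1] at h1
    · have g₁ := le_sqrt_two_mul_of_le
        (H.low_right h₁ hδ x ⟨hx.1.le, le_min (by linarith [hx.2]) hx.2.le⟩)
      have g₂ := le_sqrt_two_mul_of_le
        (H.low_right h₂ (by linarith) x ⟨hx.1.le, le_min (by linarith [hx.2]) hx.2.le⟩)
      have h3 : 2 * K / b * b ≤ 2 * K / b * (√(2 * Z₁ x) + √(2 * Z₂ x)) := by
        have := H.K_nonneg
        gcongr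
        linarith
      have h4 : 2 * K / b * b = 2 * K := by field_simp
      linarith
  have hcl : ∀ y, 0 ≤ y → F y ≤ F b + h - h := fun y hy => by linarith [H.le_b y hy]
  have i5 : |b₁ - b₂| ≤ |Z₂ (F b + h) - Z₁ (F b + h)| / h := by
    rw [abs_le]
    constructor
    · have := h₁.sub_le_of_right h₂ hb₁ hh hcl (by linarith) (by linarith) hc₁
      linarith
    · have := h₂.sub_le_of_right h₁ hb₂ hh hcl (by linarith) (by linarith) hc₂
      rw [abs_sub_comm] at this
      linarith
  have e0 : |a₁ - a₂| = a₁ - a₂ := abs_of_nonneg (by linarith)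
  calc |b₁ - b₂| ≤ |Z₂ (F b + h) - Z₁ (F b + h)| / h := i5
    _ ≤ ((((gs + r) * (a₁ - a₂)) * Real.exp (2 * K * (yd / m))) *
        Real.exp (-(C * δ / (2 * yu))) * Real.exp (2 * K * h / b)) / h := by
        refine div_le_div_of_nonneg_right (i4.trans ?_) hh.le
        refine mul_le_mul_of_nonneg_right (i3.trans (i2.trans ?_)) (Real.exp_pos _).le
        refine mul_le_mul_of_nonneg_right (i1.trans ?_) (Real.exp_pos _).le
        exact mul_le_mul_of_nonneg_right i0 (Real.exp_pos _).le
    _ = _ := by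
        rw [e0, sub_eq_add_neg (2 * K * yd / m), Real.exp_add, Real.exp_add]
        ring_nf

end UpperField

end Upper

section Lower

/-- Along arcs with at most linear damping of subcritical rate, the quadratic form
`x ^ 2 + 2 γ x y + y ^ 2` decreases at most by the factor of half a turn of the linear spiral. -/
theorem Passage.spiral {G Z : ℝ → ℝ} {a e u v γ w : ℝ} (hZ : Passage G a e Z)
    (hγ : 0 < γ) (hγ1 : γ < 1) (hw : 0 < w) (hu : a < u) (huv : u ≤ v) (hv : v ≤ e)
    (hwZ : ∀ x ∈ Icc u v, w ^ 2 / 2 ≤ Z x) (hG : ∀ y, w ≤ y → -2 * γ * y ≤ G y) :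
    (u ^ 2 + 2 * γ * u * √(2 * Z u) + √(2 * Z u) ^ 2) *
        Real.exp (-(2 * Real.pi * γ / √(1 - γ ^ 2))) ≤
      v ^ 2 + 2 * γ * v * √(2 * Z v) + √(2 * Z v) ^ 2 := by
  have hω2 : 0 < 1 - γ ^ 2 := by nlinarith
  set ω := √(1 - γ ^ 2) with hω
  have hω0 : 0 < ω := Real.sqrt_pos.2 hω2
  have hωsq : ω ^ 2 = 1 - γ ^ 2 := Real.sq_sqrt hω2.le
  set Y : ℝ → ℝ := fun x => √(2 * Z x) with hY
  have hYw : ∀ x ∈ Icc u v, w ≤ Y x := fun x hx => le_sqrt_two_mul_of_le (hwZ x hx)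
  have hYpos : ∀ x ∈ Icc u v, 0 < Y x := fun x hx => hw.trans_le (hYw x hx)
  set Q : ℝ → ℝ := fun x => x ^ 2 + 2 * γ * x * Y x + Y x ^ 2 with hQ
  have hQeq : ∀ x, Q x = (x + γ * Y x) ^ 2 + ω ^ 2 * Y x ^ 2 := fun x => by
    rw [hωsq]; ring
  have hQpos : ∀ x ∈ Icc u v, 0 < Q x := fun x hx => by
    rw [hQeq]
    have := hYpos x hx
    positivity
  have hYc : ContinuousOn Y (Icc u v) :=
    Real.continuous_sqrt.comp_continuousOn
      ((hZ.cont.mono (Icc_subset_Icc hu.le hv)).const_mul 2)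
  have hYd : ∀ x ∈ Ioo u v, HasDerivAt Y ((G (Y x) - x) / Y x) x := by
    intro x hx
    have hp := hYpos x ⟨hx.1.le, hx.2.le⟩
    have h1 := hZ.deriv x ⟨hu.trans hx.1, hx.2.trans_le hv⟩
    have h2 : 2 * Z x ≠ 0 := by
      have := hwZ x ⟨hx.1.le, hx.2.le⟩
      have : 0 < w ^ 2 := by positivity
      linarith
    refine ((h1.const_mul 2).sqrt h2).congr_deriv ?_
    rw [mul_div_mul_left _ _ (two_ne_zero)]
  have hQd : ∀ x ∈ Ioo u v, HasDerivAt Q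
      (2 * x + 2 * γ * (Y x + x * ((G (Y x) - x) / Y x)) + 2 * Y x * ((G (Y x) - x) / Y x)) x := by
    intro x hx
    have h1 := hYd x hx
    have h2 : HasDerivAt Q _ x := (((hasDerivAt_id x).pow 2).add
      (((hasDerivAt_id x).const_mul (2 * γ)).mul h1)).add (h1.pow 2)
    refine h2.congr_deriv ?_
    simp
    ring
  have hρd : ∀ x ∈ Ioo u v, HasDerivAt (fun x => (x + γ * Y x) / (ω * Y x)) _ x := fun x hx =>
    ((hasDerivAt_id x).add ((hYd x hx).const_mul γ)).div ((hYd x hx).const_mul ω)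
      (mul_pos hω0 (hYpos x ⟨hx.1.le, hx.2.le⟩)).ne'
  have hmono : MonotoneOn
      (fun x => Real.log (Q x) + 2 * γ / ω * Real.arctan ((x + γ * Y x) / (ω * Y x)))
      (Icc u v) := by
    refine monotoneOn_of_hasDerivWithinAt_nonneg
      (f' := fun x => 2 * (G (Y x) + 2 * γ * Y x) / Q x) (convex_Icc _ _) ?_
      (fun x hx => ?_) (fun x hx => ?_)
    · refine ContinuousOn.add (ContinuousOn.log ?_ fun x hx => (hQpos x hx).ne')
        (ContinuousOn.const_mul ?_ _ )
      · rw [hQ]; fun_prop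
      · refine Real.continuous_arctan.comp_continuousOn (ContinuousOn.div (by fun_prop)
          (by fun_prop) fun x hx => (mul_pos hω0 (hYpos x hx)).ne')
    · rw [interior_Icc] at hx
      have hp := hYpos x ⟨hx.1.le, hx.2.le⟩
      have hq := hQpos x ⟨hx.1.le, hx.2.le⟩
      refine HasDerivAt.hasDerivWithinAt ((((hQd x hx).log hq.ne').add
        ((hρd x hx).arctan.const_mul _)).congr_deriv ?_)
      have e1 : 1 + ((x + γ * Y x) / (ω * Y x)) ^ 2 = Q x / (ω * Y x) ^ 2 := by
        rw [hQeq]; field_simp; ring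
      rw [e1]
      have hq' : Q x ≠ 0 := hq.ne'
      field_simp
      simp only [Pi.add_apply, id]
      ring
    · rw [interior_Icc] at hx
      have := hG _ (hYw x ⟨hx.1.le, hx.2.le⟩)
      exact div_nonneg (by linarith) (hQpos x ⟨hx.1.le, hx.2.le⟩).le
  have h1 := hmono (left_mem_Icc.2 huv) (right_mem_Icc.2 huv) huv
  simp only at h1
  have h2 : 2 * γ / ω * Real.arctan ((v + γ * Y v) / (ω * Y v)) ≤ 2 * γ / ω * (Real.pi / 2) := by
    have := (Real.arctan_lt_pi_div_two ((v + γ * Y v) / (ω * Y v))).le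
    gcongr
  have h3 : 2 * γ / ω * -(Real.pi / 2) ≤ 2 * γ / ω * Real.arctan ((u + γ * Y u) / (ω * Y u)) := by
    have := (Real.neg_pi_div_two_lt_arctan ((u + γ * Y u) / (ω * Y u))).le
    gcongr
  have h4 : 2 * Real.pi * γ / ω = 2 * γ / ω * (Real.pi / 2) + 2 * γ / ω * (Real.pi / 2) := by ring
  have h5 : Real.log (Q u) + -(2 * Real.pi * γ / ω) ≤ Real.log (Q v) := by
    rw [h4]
    linarith
  have hqu := hQpos u (left_mem_Icc.2 huv)
  have hqv := hQpos v (right_mem_Icc.2 huv)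
  calc _ = Real.exp (Real.log (Q u) + -(2 * Real.pi * γ / ω)) := by
        rw [Real.exp_add, Real.exp_log hqu]
    _ ≤ Real.exp (Real.log (Q v)) := Real.exp_le_exp.2 h5
    _ = _ := Real.exp_log hqv

/-- The properties of the (reflected) friction force used for the half turns in `y < 0`. -/
structure LowerField (G : ℝ → ℝ) (r δ γ X₀ c₀ m w K : ℝ) : Prop where
  γ_pos : 0 < γ
  γ1 : γ < 1
  δ_pos : 0 < δ
  δr : δ ≤ r
  c_pos : 0 < c₀
  cX : c₀ ≤ X₀
  m_pos : 0 < m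
  w_pos : 0 < w
  wδ : w ≤ δ / 2
  wm : w ^ 2 / 2 / m ≤ c₀ / 2
  K_nonneg : 0 ≤ K
  small : 9 / 4 * δ ^ 2 <
    (1 - γ ^ 2) * (X₀ ^ 2 / 4) * Real.exp (-(2 * Real.pi * γ / √(1 - γ ^ 2)))
  nonpos : ∀ y, 0 ≤ y → G y ≤ 0
  start : ∀ y ∈ Icc 0 w, m - X₀ + c₀ / 2 ≤ G y
  spiral : ∀ y, w ≤ y → -2 * γ * y ≤ G y
  lip : ∀ y₁ y₂, 0 ≤ y₁ → 0 ≤ y₂ → (G y₂ - G y₁) * (y₂ - y₁) ≤ K * (y₂ - y₁) ^ 2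

namespace LowerField

variable {G : ℝ → ℝ} {r δ γ X₀ c₀ m w K : ℝ} {a e : ℝ} {Z : ℝ → ℝ}

theorem energy (H : LowerField G r δ γ X₀ c₀ m w K) (hZ : Passage G a e Z) :
    ∀ x ∈ Icc a e, Z x + x ^ 2 / 2 ≤ a ^ 2 / 2 := by
  intro x hx
  have hanti : AntitoneOn (fun x => Z x + x ^ 2 / 2) (Icc a e) := by
    refine antitoneOn_of_hasDerivWithinAt_nonpos
      (f' := fun x => G √(2 * Z x) - x + x) (convex_Icc _ _)
      (hZ.cont.add (by fun_prop)) (fun x hx => ?_) (fun x hx => ?_)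
    · rw [interior_Icc] at hx
      have h1 : HasDerivAt (fun x : ℝ => x ^ 2 / 2) x x :=
        (((hasDerivAt_id x).pow 2).div_const 2).congr_deriv (by simp)
      exact ((hZ.deriv x hx).add h1).hasDerivWithinAt
    · have := H.nonpos √(2 * Z x) (Real.sqrt_nonneg _)
      linarith
  have := hanti (left_mem_Icc.2 hZ.lt.le) hx hx.1
  simpa [hZ.left] using this

theorem high (H : LowerField G r δ γ X₀ c₀ m w K) (hZ : Passage G a e Z) (ha : -r ≤ a)
    (ha0 : a ≤ 0) : ∀ x ∈ Icc a e, Z x ≤ r ^ 2 / 2 := by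
  intro x hx
  have := H.energy hZ x hx
  nlinarith [sq_nonneg x]

theorem exit_le (H : LowerField G r δ γ X₀ c₀ m w K) (hZ : Passage G a e Z) (ha : -r ≤ a)
    (ha0 : a ≤ 0) : e ≤ r := by
  have h1 := H.energy hZ e (right_mem_Icc.2 hZ.lt.le)
  have h2 := hZ.nonneg e (right_mem_Icc.2 hZ.lt.le)
  by_contra! hcon
  nlinarith

theorem low_start (H : LowerField G r δ γ X₀ c₀ m w K) (hZ : Passage G a e Z) :
    ∀ x ∈ Icc a (min e (-X₀ + c₀ / 2)), min (m * (x - a)) (w ^ 2 / 2) ≤ Z x := by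
  refine hZ.min_le H.m_pos H.w_pos fun x hx hlt => ?_
  have := H.start √(2 * Z x) ⟨Real.sqrt_nonneg _, hlt.le⟩
  have := hx.2.trans_le (min_le_right _ _)
  linarith

theorem low_spiral (H : LowerField G r δ γ X₀ c₀ m w K) (hZ : Passage G a e Z) (ha : a ≤ -X₀) :
    ∀ x ∈ Icc (a + w ^ 2 / 2 / m) (min e δ), w ^ 2 / 2 ≤ Z x := by
  intro x hx
  have hm := H.m_pos
  have hw := H.w_pos
  have hc := H.c_pos
  have hδ := H.δ_pos
  have hs : 0 < w ^ 2 / 2 / m := by positivity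
  have hsc := H.wm
  set u := a + w ^ 2 / 2 / m with hu
  have hau : a < u := by linarith
  have hxe : x ≤ e := hx.2.trans (min_le_left _ _)
  have hxδ : x ≤ δ := hx.2.trans (min_le_right _ _)
  have h0 : w ^ 2 / 2 ≤ Z u := by
    have h1 := H.low_start hZ u ⟨hau.le, le_min (hx.1.trans hxe) (by linarith)⟩
    have e1 : m * (u - a) = w ^ 2 / 2 := by rw [hu]; field_simp; ring
    rwa [e1, min_self] at h1
  have := nonneg_of_deriv_pos_of_eq_zero (f := fun x => Z x - w ^ 2 / 2) (u := u) (v := x)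
    ((hZ.cont.mono (Icc_subset_Icc hau.le hxe)).sub continuousOn_const) (by linarith)
    (fun v hv hist heq => ?_) x ⟨hx.1, le_rfl⟩
  · linarith
  · have hve : v < e := hv.2.trans_le hxe
    refine ⟨_, ?_, (hZ.deriv v ⟨hau.trans_le hv.1, hve⟩).sub_const _⟩
    have hsp := hZ.spiral H.γ_pos H.γ1 hw hau hv.1 hve.le
      (fun z hz => by linarith [hist z hz]) H.spiral
    have hzv : Z v = w ^ 2 / 2 := by linarith
    have hyv : √(2 * Z v) = w := by
      rw [hzv, mul_div_cancel₀ _ (two_ne_zero), Real.sqrt_sq hw.le]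
    rw [hyv] at hsp ⊢
    by_contra! hcon
    have hG := H.spiral w le_rfl
    have hγ := H.γ_pos
    have hγ1 := H.γ1
    have hwδ := H.wδ
    have hgw : γ * w ≤ w := by nlinarith
    have hv1 : -δ ≤ v := by linarith
    have hv2 : v ≤ δ := by linarith [hv.2]
    have hq1 : v ^ 2 + 2 * γ * v * w + w ^ 2 ≤ 9 / 4 * δ ^ 2 := by
      have a1 : v ^ 2 ≤ δ ^ 2 := sq_le_sq' hv1 hv2
      have a2 : w ^ 2 ≤ (δ / 2) ^ 2 := by gcongr
      have a3 : v * (γ * w) ≤ δ * (δ / 2) := by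
        have : γ * w ≤ δ / 2 := by linarith
        have h0 : 0 ≤ γ * w := by positivity
        calc v * (γ * w) ≤ δ * (γ * w) := by gcongr
          _ ≤ _ := by gcongr
      linarith
    have hq2 : (1 - γ ^ 2) * (X₀ ^ 2 / 4) ≤
        u ^ 2 + 2 * γ * u * √(2 * Z u) + √(2 * Z u) ^ 2 := by
      have hX : X₀ / 2 ≤ -u := by linarith [H.cX]
      have hX2 : (X₀ / 2) ^ 2 ≤ (-u) ^ 2 := by
        have : 0 ≤ X₀ / 2 := by linarith [H.cX]
        gcongr
      have h1 : 0 ≤ 1 - γ ^ 2 := by nlinarith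
      have h2 : (1 - γ ^ 2) * (X₀ ^ 2 / 4) ≤ (1 - γ ^ 2) * u ^ 2 := by
        gcongr
        linarith
      nlinarith [sq_nonneg (√(2 * Z u) + γ * u)]
    have hexp := Real.exp_pos (-(2 * Real.pi * γ / √(1 - γ ^ 2)))
    have := H.small
    have := mul_le_mul_of_nonneg_right hq2 hexp.le
    linarith

theorem low (H : LowerField G r δ γ X₀ c₀ m w K) (hZ : Passage G a e Z) (ha : a ≤ -X₀) :
    ∀ x ∈ Icc a (min e δ), min (m * (x - a)) (w ^ 2 / 2) ≤ Z x := by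
  intro x hx
  rcases le_total x (a + w ^ 2 / 2 / m) with h | h
  · exact H.low_start hZ x ⟨hx.1, le_min (hx.2.trans (min_le_left _ _)) (by linarith [H.wm])⟩
  · exact (min_le_right _ _).trans (H.low_spiral hZ ha x ⟨h, hx.2⟩)

theorem abs_sub_le (H : LowerField G r δ γ X₀ c₀ m w K) {a₁ b₁ a₂ b₂ : ℝ} {Z₁ Z₂ : ℝ → ℝ}
    (h₁ : Passage G a₁ b₁ Z₁) (h₂ : Passage G a₂ b₂ Z₂) (ha : a₂ ≤ a₁) (hr : -r ≤ a₂)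
    (hX : a₁ ≤ -X₀) (hb₁ : Z₁ b₁ = 0) (hb₂ : Z₂ b₂ = 0) (hc₁ : δ < b₁) (hc₂ : δ < b₂) :
    |b₁ - b₂| ≤ r * Real.exp (2 * K * w / m + 2 * K * r / w) / δ * |a₁ - a₂| := by
  have hδ := H.δ_pos
  have hm := H.m_pos
  have hw := H.w_pos
  have hc := H.c_pos
  have hcX := H.cX
  have hδr := H.δr
  have hsc := H.wm
  set s := w ^ 2 / 2 / m with hs
  have hs0 : 0 < s := by positivity
  have i0 : |Z₂ a₁ - Z₁ a₁| ≤ r * (a₁ - a₂) :=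
    h₁.abs_sub_le_of_left h₂ ha (by linarith) fun y hy => by linarith [H.nonpos y hy]
  have i1 : |Z₂ (a₁ + s) - Z₁ (a₁ + s)| ≤ |Z₂ a₁ - Z₁ a₁| * Real.exp (2 * K * (w / m)) := by
    have h1 := h₁.abs_sub_le_of_start h₂ ha hs0.le (by linarith) (by linarith) hm H.K_nonneg
      (fun x hx => ?_) H.lip
    · have : √(2 * s / m) = w / m := by
        rw [hs, show 2 * (w ^ 2 / 2 / m) / m = (w / m) ^ 2 by field_simp,
          Real.sqrt_sq (by positivity)]
      rwa [this] at h1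
    · have h2 := H.low_start h₁ x ⟨hx.1.le, le_min (by linarith [hx.2]) (by linarith [hx.2])⟩
      have h3 : m * (x - a₁) ≤ w ^ 2 / 2 := by
        have : x - a₁ ≤ w ^ 2 / 2 / m := by linarith [hx.2]
        rw [le_div_iff₀ hm] at this; linarith
      rwa [min_eq_left h3] at h2
  have i2 : |Z₂ δ - Z₁ δ| ≤ |Z₂ (a₁ + s) - Z₁ (a₁ + s)| * Real.exp (2 * K * r / w) := by
    have h1 := h₁.abs_sub_le h₂ (u := a₁ + s) (v := δ) (K := K) (Ψ := fun x => K / w * x)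
      (ψ := fun x => K / w * 1) (by linarith) (by linarith) (by linarith) hc₁.le hc₂.le
      (by fun_prop) (fun x _ => (hasDerivAt_id x).const_mul _)
      (fun x hx => H.lip _ _ (Real.sqrt_nonneg _) (Real.sqrt_nonneg _)) (fun x hx => ?_)
    · refine h1.trans ?_
      gcongr
      have := H.K_nonneg
      have h3 : K / w * (δ - (a₁ + s)) ≤ K / w * (2 * r) := by
        gcongr
        linarith
      have h5 : 2 * K * r / w = K / w * (2 * r) := by ring
      rw [h5]
      linarith
    · have g₁ := le_sqrt_two_mul_of_le
        (H.low_spiral h₁ hX x ⟨hx.1.le, le_min (by linarith [hx.2]) hx.2.le⟩)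
      have g₂ := le_sqrt_two_mul_of_le
        (H.low_spiral h₂ (by linarith) x ⟨by linarith [hx.1], le_min (by linarith [hx.2]) hx.2.le⟩)
      have := H.K_nonneg
      have h4 : K / w * (2 * w) ≤ K / w * (√(2 * Z₁ x) + √(2 * Z₂ x)) := by
        gcongr
        linarith
      have h5 : K / w * (2 * w) = 2 * K := by field_simp
      linarith
  have hcl : ∀ y, 0 ≤ y → G y ≤ δ - δ := fun y hy => by linarith [H.nonpos y hy]
  have i5 : |b₁ - b₂| ≤ |Z₂ δ - Z₁ δ| / δ := by
    rw [abs_le]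
    constructor
    · have := h₁.sub_le_of_right h₂ hb₁ hδ hcl (by linarith) (by linarith) hc₁
      linarith
    · have := h₂.sub_le_of_right h₁ hb₂ hδ hcl (by linarith) (by linarith) hc₂
      rw [abs_sub_comm] at this
      linarith
  have e0 : |a₁ - a₂| = a₁ - a₂ := abs_of_nonneg (by linarith)
  calc |b₁ - b₂| ≤ |Z₂ δ - Z₁ δ| / δ := i5
    _ ≤ (((r * (a₁ - a₂)) * Real.exp (2 * K * (w / m))) * Real.exp (2 * K * r / w)) / δ := by
        refine div_le_div_of_nonneg_right (i2.trans ?_) hδ.le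
        refine mul_le_mul_of_nonneg_right (i1.trans ?_) (Real.exp_pos _).le
        exact mul_le_mul_of_nonneg_right i0 (Real.exp_pos _).le
    _ = _ := by
        rw [e0, Real.exp_add]
        ring_nf

end LowerField

end Lower

section Poincare

/-- A contracting first return map on the segment `[A, B] × {0}` for the flow of `v`. -/
structure ReturnMap (v : ℝ × ℝ → ℝ × ℝ) (A B A' B' τ₀ T : ℝ) (S : Set (ℝ × ℝ)) (P τ : ℝ → ℝ) :
    Prop where
  AA' : A < A'
  A'B' : A' ≤ B'
  B'B : B' < B
  τ_pos : 0 < τ₀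
  maps : ∀ s ∈ Icc A B, P s ∈ Icc A' B'
  time : ∀ s ∈ Icc A B, τ s ∈ Icc τ₀ T
  ret : ∀ s ∈ Icc A B, ∀ f : ℝ → ℝ × ℝ, (∀ t, HasDerivAt f (v (f t)) t) → f 0 = (s, 0) →
    f (τ s) = (P s, 0) ∧ ∀ t ∈ Icc 0 (τ s), f t ∈ S
  contr : ∀ s₁ ∈ Icc A B, ∀ s₂ ∈ Icc A B, |P s₁ - P s₂| ≤ 1 / 2 * |s₁ - s₂|
  trans : ∀ s ∈ Icc A' B', (v (s, 0)).2 < 0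

namespace ReturnMap

variable {v : ℝ × ℝ → ℝ × ℝ} {L : NNReal} {A B A' B' τ₀ T : ℝ} {S : Set (ℝ × ℝ)} {P τ : ℝ → ℝ}

theorem mem_of_mem (H : ReturnMap v A B A' B' τ₀ T S P τ) {s : ℝ} (hs : s ∈ Icc A' B') :
    s ∈ Icc A B := ⟨H.AA'.le.trans hs.1, hs.2.trans H.B'B.le⟩

theorem exists_fixed (H : ReturnMap v A B A' B' τ₀ T S P τ) : ∃ s ∈ Icc A' B', P s = s := by
  have hc : ContinuousOn P (Icc A B) := by
    refine LipschitzOnWith.continuousOn (K := 1) (LipschitzOnWith.of_dist_le_mul ?_)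
    intro s₁ h₁ s₂ h₂
    rw [Real.dist_eq, Real.dist_eq]
    have := H.contr s₁ h₁ s₂ h₂
    have := abs_nonneg (s₁ - s₂)
    simp only [NNReal.coe_one, one_mul]
    linarith
  have hsub : Icc A' B' ⊆ Icc A B := fun s hs => H.mem_of_mem hs
  obtain ⟨s, hs, hfix⟩ := exists_mem_Icc_isFixedPt_of_mapsTo (hc.mono hsub) H.A'B'
    fun s hs => H.maps s (hsub hs)
  exact ⟨s, hs, hfix⟩

/-- Restarting a solution at its return to the section. -/
theorem shift {f : ℝ → ℝ × ℝ} (hf : ∀ t, HasDerivAt f (v (f t)) t) (c : ℝ) (t : ℝ) :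
    HasDerivAt (fun t => f (t + c)) (v (f (t + c))) t :=
  (hf (t + c)).comp_add_const t c

variable {p : ℝ → ℝ × ℝ} {x₀ : ℝ}

theorem periodic (H : ReturnMap v A B A' B' τ₀ T S P τ) (hv : LipschitzWith L v)
    (hp : ∀ t, HasDerivAt p (v (p t)) t) (hp0 : p 0 = (x₀, 0)) (hx₀ : x₀ ∈ Icc A' B')
    (hfix : P x₀ = x₀) : Function.Periodic p (τ x₀) := by
  have h := (H.ret x₀ (H.mem_of_mem hx₀) p hp hp0).1
  rw [hfix] at h
  have := eq_of_lipschitz_ode hv (t₀ := 0) (shift hp (τ x₀)) hp (by simp [h, hp0])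
  exact fun t => congrFun this t

theorem mem_of_nonneg (H : ReturnMap v A B A' B' τ₀ T S P τ) (n : ℕ) :
    ∀ s ∈ Icc A B, ∀ f : ℝ → ℝ × ℝ, (∀ t, HasDerivAt f (v (f t)) t) → f 0 = (s, 0) →
      ∀ t, 0 ≤ t → t ≤ n * τ₀ → f t ∈ S := by
  induction n with
  | zero =>
    intro s hs f hf hf0 t ht htn
    refine (H.ret s hs f hf hf0).2 t ⟨ht, ?_⟩
    have := (H.time s hs).1
    have := H.τ_pos
    simp at htn
    linarith
  | succ n ih =>
    intro s hs f hf hf0 t ht htn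
    obtain ⟨h1, h2⟩ := H.ret s hs f hf hf0
    rcases le_total t (τ s) with h | h
    · exact h2 t ⟨ht, h⟩
    · have := ih (P s) (H.mem_of_mem (H.maps s hs)) _ (shift hf (τ s)) (by simpa using h1)
        (t - τ s) (by linarith) (by
          have := (H.time s hs).1
          push_cast at htn
          linarith)
      simpa using this

theorem infDist_le (H : ReturnMap v A B A' B' τ₀ T S P τ) (hv : LipschitzWith L v)
    (hp : ∀ t, HasDerivAt p (v (p t)) t) (hp0 : p 0 = (x₀, 0)) (hx₀ : x₀ ∈ Icc A' B')
    (hfix : P x₀ = x₀) (n : ℕ) :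
    ∀ s ∈ Icc A B, ∀ f : ℝ → ℝ × ℝ, (∀ t, HasDerivAt f (v (f t)) t) → f 0 = (s, 0) →
      ∀ t, 0 ≤ t → t ≤ n * τ₀ →
        Metric.infDist (f t) (range p) ≤ |s - x₀| * Real.exp (L * T) := by
  have short : ∀ s ∈ Icc A B, ∀ f : ℝ → ℝ × ℝ, (∀ t, HasDerivAt f (v (f t)) t) → f 0 = (s, 0) →
      ∀ t, 0 ≤ t → t ≤ τ s → Metric.infDist (f t) (range p) ≤ |s - x₀| * Real.exp (L * T) := by
    intro s hs f hf hf0 t ht hts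
    refine (Metric.infDist_le_dist_of_mem (mem_range_self t)).trans
      ((dist_le_of_lipschitz_ode hv hf hp ht).trans ?_)
    have h1 : dist (f 0) (p 0) = |s - x₀| := by
      rw [hf0, hp0, Prod.dist_eq, Real.dist_eq]; simp
    rw [h1]
    have := (H.time s hs).2
    gcongr
    linarith
  induction n with
  | zero =>
    intro s hs f hf hf0 t ht htn
    refine short s hs f hf hf0 t ht ?_
    have := (H.time s hs).1
    have := H.τ_pos
    simp at htn
    linarith
  | succ n ih =>
    intro s hs f hf hf0 t ht htn
    rcases le_total t (τ s) with h | h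
    · exact short s hs f hf hf0 t ht h
    · have h1 := (H.ret s hs f hf hf0).1
      have := ih (P s) (H.mem_of_mem (H.maps s hs)) _ (shift hf (τ s)) (by simpa using h1)
        (t - τ s) (by linarith) (by
          have := (H.time s hs).1
          push_cast at htn
          linarith)
      simp only [sub_add_cancel] at this
      refine this.trans ?_
      have h2 := H.contr s hs x₀ (H.mem_of_mem hx₀)
      rw [hfix] at h2
      have := abs_nonneg (s - x₀)
      exact mul_le_mul_of_nonneg_right (by linarith) (Real.exp_pos _).le

theorem infDist_le_pow (H : ReturnMap v A B A' B' τ₀ T S P τ) (hv : LipschitzWith L v)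
    (hp : ∀ t, HasDerivAt p (v (p t)) t) (hp0 : p 0 = (x₀, 0)) (hx₀ : x₀ ∈ Icc A' B')
    (hfix : P x₀ = x₀) (n : ℕ) :
    ∀ s ∈ Icc A B, ∀ f : ℝ → ℝ × ℝ, (∀ t, HasDerivAt f (v (f t)) t) → f 0 = (s, 0) →
      ∀ t, n * T ≤ t →
        Metric.infDist (f t) (range p) ≤ (1 / 2) ^ n * |s - x₀| * Real.exp (L * T) := by
  have hT : 0 < T := by
    have := H.time x₀ (H.mem_of_mem hx₀)
    linarith [H.τ_pos, this.1, this.2]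
  induction n with
  | zero =>
    intro s hs f hf hf0 t ht
    simp only [Nat.cast_zero, zero_mul] at ht
    obtain ⟨N, hN⟩ := exists_nat_ge (t / τ₀)
    have h1 := H.infDist_le hv hp hp0 hx₀ hfix N s hs f hf hf0 t ht
      ((div_le_iff₀ H.τ_pos).1 hN)
    simpa using h1
  | succ n ih =>
    intro s hs f hf hf0 t ht
    have h1 := (H.ret s hs f hf hf0).1
    have := ih (P s) (H.mem_of_mem (H.maps s hs)) _ (shift hf (τ s)) (by simpa using h1)
      (t - τ s) (by
        have := (H.time s hs).2
        push_cast at ht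
        linarith)
    simp only [sub_add_cancel] at this
    refine this.trans ?_
    have h2 := H.contr s hs x₀ (H.mem_of_mem hx₀)
    rw [hfix] at h2
    rw [pow_succ, mul_assoc ((1 / 2 : ℝ) ^ n) (1 / 2)]
    exact mul_le_mul_of_nonneg_right (mul_le_mul_of_nonneg_left h2 (pow_nonneg one_half_pos.le n))
      (Real.exp_pos _).le

theorem tendsto_infDist (H : ReturnMap v A B A' B' τ₀ T S P τ) (hv : LipschitzWith L v)
    (hp : ∀ t, HasDerivAt p (v (p t)) t) (hp0 : p 0 = (x₀, 0)) (hx₀ : x₀ ∈ Icc A' B')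
    (hfix : P x₀ = x₀) {s : ℝ} (hs : s ∈ Icc A B) {f : ℝ → ℝ × ℝ}
    (hf : ∀ t, HasDerivAt f (v (f t)) t) (hf0 : f 0 = (s, 0)) :
    Tendsto (fun t => Metric.infDist (f t) (range p)) atTop (𝓝 0) := by
  rw [Metric.tendsto_atTop]
  intro ε hε
  have hlim : Tendsto (fun n : ℕ => (1 / 2 : ℝ) ^ n * |s - x₀| * Real.exp (L * T)) atTop (𝓝 0) := by
    have := ((tendsto_pow_atTop_nhds_zero_of_lt_one (show (0 : ℝ) ≤ 1 / 2 by norm_num)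
      (by norm_num)).mul_const |s - x₀|).mul_const (Real.exp (L * T))
    simpa using this
  obtain ⟨n, hn⟩ := (hlim.eventually_lt_const hε).exists
  refine ⟨n * T, fun t ht => ?_⟩
  rw [Real.dist_eq, sub_zero, abs_of_nonneg Metric.infDist_nonneg]
  exact (H.infDist_le_pow hv hp hp0 hx₀ hfix n s hs f hf hf0 t ht).trans_lt hn

theorem range_eq (H : ReturnMap v A B A' B' τ₀ T S P τ) (hv : LipschitzWith L v)
    (hp : ∀ t, HasDerivAt p (v (p t)) t) (hp0 : p 0 = (x₀, 0)) (hx₀ : x₀ ∈ Icc A' B')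
    (hfix : P x₀ = x₀) {s t₀ T' : ℝ} (hs : s ∈ Icc A B) {q : ℝ → ℝ × ℝ}
    (hq : ∀ t, HasDerivAt q (v (q t)) t) (hq0 : q t₀ = (s, 0)) (hT' : 0 < T')
    (hqT : Function.Periodic q T') : range q = range p := by
  have hlim := H.tendsto_infDist hv hp hp0 hx₀ hfix hs (shift hq t₀) (by simpa using hq0)
  have hn : Tendsto (fun n : ℕ => (n : ℝ) * T') atTop atTop :=
    tendsto_natCast_atTop_atTop.atTop_mul_const hT'
  have h1 := hlim.comp hn
  have h2 : Metric.infDist (q t₀) (range p) = 0 := by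
    refine tendsto_nhds_unique (tendsto_const_nhds.congr fun n => ?_) h1
    have := hqT.nat_mul n t₀
    simp only [Function.comp]
    rw [add_comm, this]
  have hpos : 0 < τ x₀ := H.τ_pos.trans_le (H.time x₀ (H.mem_of_mem hx₀)).1
  have hper := H.periodic hv hp hp0 hx₀ hfix
  have hpc : Continuous p := continuous_iff_continuousAt.2 fun t => (hp t).continuousAt
  have hcl : IsClosed (range p) := by
    rw [← hper.image_Icc hpos 0]
    exact (isCompact_Icc.image hpc).isClosed
  obtain ⟨t₁, ht₁⟩ := (hcl.mem_iff_infDist_zero (range_nonempty p)).2 h2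
  have heq := eq_of_lipschitz_ode hv (t₀ := 0) (shift hq t₀) (shift hp t₁) (by simp [ht₁])
  have e1 : ∀ t, q (t + t₀) = p (t + t₁) := fun t => congrFun heq t
  refine Subset.antisymm ?_ ?_
  · rintro _ ⟨t, rfl⟩
    exact ⟨t - t₀ + t₁, by rw [← e1]; simp⟩
  · rintro _ ⟨t, rfl⟩
    exact ⟨t - t₁ + t₀, by rw [e1]; simp⟩

/-- Solutions starting close to the closed orbit hit the section and stay close until then. -/
theorem exists_nhds (H : ReturnMap v A B A' B' τ₀ T S P τ) (hv : LipschitzWith L v)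
    (hp : ∀ t, HasDerivAt p (v (p t)) t) (hp0 : p 0 = (x₀, 0)) (hx₀ : x₀ ∈ Icc A' B')
    (hfix : P x₀ = x₀) {ν : ℝ} (hν : 0 < ν) :
    ∃ U : Set (ℝ × ℝ), IsOpen U ∧ range p ⊆ U ∧ ∀ z ∈ U, ∀ f : ℝ → ℝ × ℝ,
      (∀ t, HasDerivAt f (v (f t)) t) → f 0 = z → ∃ t₀, 0 ≤ t₀ ∧
        (∀ t ∈ Icc 0 t₀, ∃ t', dist (f t) (p t') < ν) ∧ ∃ s ∈ Icc A B, f t₀ = (s, 0) := by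
  have hpos : 0 < τ x₀ := H.τ_pos.trans_le (H.time x₀ (H.mem_of_mem hx₀)).1
  have hper := H.periodic hv hp hp0 hx₀ hfix
  have hpc : Continuous p := continuous_iff_continuousAt.2 fun t => (hp t).continuousAt
  set ρ := min (x₀ - A) (B - x₀) with hρ
  have hρ0 : 0 < ρ := lt_min (by linarith [H.AA', hx₀.1]) (by linarith [H.B'B, hx₀.2])
  have key : ∀ s : ℝ, ∃ ζ > 0, ∀ f : ℝ → ℝ × ℝ, (∀ t, HasDerivAt f (v (f t)) t) →
      dist (f 0) (p s) < ζ → ∃ t₀, 0 ≤ t₀ ∧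
        (∀ t ∈ Icc 0 t₀, ∃ t', dist (f t) (p t') < ν) ∧ ∃ s ∈ Icc A B, f t₀ = (s, 0) := by
    intro s
    obtain ⟨n, hn⟩ := exists_nat_gt (s / τ x₀)
    have hn' : s < n * τ x₀ := (div_lt_iff₀ hpos).1 hn
    set σ := n * τ x₀ - s with hσ
    have hσ0 : 0 < σ := by linarith
    have hpσ : p (s + σ) = (x₀, 0) := by
      have := hper.nat_mul n 0
      rw [hσ]
      simpa [hp0] using this
    have hd : HasDerivAt (fun t => (p t).2) (v (x₀, 0)).2 (s + σ) := by
      have h1 := hp (s + σ)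
      rw [hpσ] at h1
      exact h1.snd
    have hneg := H.trans x₀ hx₀
    have hslope := (hasDerivAt_iff_tendsto_slope.1 hd).eventually_lt_const hneg
    rw [eventually_nhdsWithin_iff] at hslope
    have hclose : ∀ᶠ t in 𝓝 (s + σ), dist (p t) (p (s + σ)) < ρ / 2 :=
      Metric.tendsto_nhds.1 (hpc.tendsto (s + σ)) _ (by positivity)
    obtain ⟨η', hη', hball⟩ := Metric.eventually_nhds_iff.1 (hslope.and hclose)
    obtain ⟨η, hη0, hη⟩ := exists_between (lt_min hη' hσ0)
    have hηη' : η < η' := hη.trans_le (min_le_left _ _)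
    have hησ : η < σ := hη.trans_le (min_le_right _ _)
    have y₁ : 0 < (p (s + (σ - η))).2 := by
      have h1 := (hball (y := s + (σ - η)) (by
        rw [Real.dist_eq, show s + (σ - η) - (s + σ) = -η by ring, abs_neg, abs_of_pos hη0]
        exact hηη')).1 (fun h => by
          have h' : s + (σ - η) = s + σ := h
          linarith)
      rw [slope_def_field, hpσ, show s + (σ - η) - (s + σ) = -η by ring, sub_zero, div_neg,
        neg_lt_zero] at h1
      exact (div_pos_iff_of_pos_right hη0).1 h1
    have y₂ : (p (s + (σ + η))).2 < 0 := by
      have h1 := (hball (y := s + (σ + η)) (by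
        rw [Real.dist_eq, show s + (σ + η) - (s + σ) = η by ring, abs_of_pos hη0]
        exact hηη')).1 (fun h => by
          have h' : s + (σ + η) = s + σ := h
          linarith)
      rw [slope_def_field, hpσ, show s + (σ + η) - (s + σ) = η by ring, sub_zero] at h1
      by_contra! hcon
      linarith [div_nonneg hcon hη0.le]
    set E := Real.exp (L * (σ + η)) with hE
    have hE0 : 0 < E := Real.exp_pos _
    set κ := min (min (p (s + (σ - η))).2 (-(p (s + (σ + η))).2)) (min (ρ / 2) ν) with hκ
    have hκ0 : 0 < κ := lt_min (lt_min y₁ (by linarith)) (lt_min (by linarith) hν)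
    refine ⟨κ / E, by positivity, fun f hf hf0 => ?_⟩
    have hdist : ∀ t ∈ Icc 0 (σ + η), dist (f t) (p (s + t)) < κ := by
      intro t ht
      have h1 := dist_le_of_lipschitz_ode hv hf (shift hp s) ht.1
      simp only [zero_add, sub_zero] at h1
      rw [add_comm s t]
      have h2 : dist (f 0) (p s) * Real.exp (L * t) ≤ dist (f 0) (p s) * E := by
        rw [hE]
        gcongr
        exact ht.2
      have h3 : dist (f 0) (p s) * E < κ := (lt_div_iff₀ hE0).1 hf0
      linarith
    have hsnd : ∀ a b : ℝ × ℝ, |a.2 - b.2| ≤ dist a b := fun a b => by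
      rw [Prod.dist_eq, ← Real.dist_eq]; exact le_max_right _ _
    have hfst : ∀ a b : ℝ × ℝ, |a.1 - b.1| ≤ dist a b := fun a b => by
      rw [Prod.dist_eq, ← Real.dist_eq]; exact le_max_left _ _
    have hκ1 : κ ≤ (p (s + (σ - η))).2 := (min_le_left _ _).trans (min_le_left _ _)
    have hκ2 : κ ≤ -(p (s + (σ + η))).2 := (min_le_left _ _).trans (min_le_right _ _)
    have hκ3 : κ ≤ ρ / 2 := (min_le_right _ _).trans (min_le_left _ _)
    have hκ4 : κ ≤ ν := (min_le_right _ _).trans (min_le_right _ _)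
    have z₁ : 0 ≤ (f (σ - η)).2 := by
      have h1 := (hsnd _ _).trans_lt (hdist (σ - η) ⟨by linarith, by linarith⟩)
      have := (abs_lt.1 h1).1
      linarith
    have z₂ : (f (σ + η)).2 ≤ 0 := by
      have h1 := (hsnd _ _).trans_lt (hdist (σ + η) ⟨by linarith, by linarith⟩)
      have := (abs_lt.1 h1).2
      linarith
    have hfc : Continuous f := continuous_iff_continuousAt.2 fun t => (hf t).continuousAt
    obtain ⟨t₀, ht₀, hz⟩ := intermediate_value_Icc' (show σ - η ≤ σ + η by linarith)
      (hfc.snd.continuousOn) ⟨z₂, z₁⟩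
    refine ⟨t₀, by linarith [ht₀.1], fun t ht => ⟨s + t, (hdist t ⟨ht.1, ht.2.trans ht₀.2⟩).trans_le
      hκ4⟩, (f t₀).1, ?_, Prod.ext rfl hz⟩
    have h1 := (hfst _ _).trans_lt (hdist t₀ ⟨by linarith [ht₀.1], ht₀.2⟩)
    have h2 := (hball (y := s + t₀) (by
      rw [Real.dist_eq, show s + t₀ - (s + σ) = t₀ - σ by ring]
      exact (abs_le.2 ⟨by linarith [ht₀.1], by linarith [ht₀.2]⟩).trans_lt hηη')).2
    have h3 := (hfst _ _).trans_lt h2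
    rw [hpσ] at h3
    have h4 := abs_lt.1 h1
    have h5 := abs_lt.1 h3
    have h6 : ρ ≤ x₀ - A := min_le_left _ _
    have h7 : ρ ≤ B - x₀ := min_le_right _ _
    simp only at h5
    exact ⟨by linarith, by linarith⟩
  choose ζ hζ0 hζ using key
  refine ⟨⋃ s, Metric.ball (p s) (ζ s), isOpen_iUnion fun _ => Metric.isOpen_ball, ?_, ?_⟩
  · rintro _ ⟨s, rfl⟩
    exact mem_iUnion.2 ⟨s, Metric.mem_ball_self (hζ0 s)⟩
  · intro z hz f hf hf0
    obtain ⟨s, hs⟩ := mem_iUnion.1 hz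
    exact hζ s f hf (by rw [hf0]; exact hs)

end ReturnMap

end Poincare

section Turn

/-- The planar field `ẋ = y, ẏ = F y - x`. -/
def lienardField (F : ℝ → ℝ) (p : ℝ × ℝ) : ℝ × ℝ := (p.2, F p.2 - p.1)

theorem UpperField.abs_exit_sub_le {F : ℝ → ℝ} {r δ gs m yd yu K C b h : ℝ}
    (H : UpperField F r δ gs m yd yu K C b h) {a₁ b₁ a₂ b₂ : ℝ} {Z₁ Z₂ : ℝ → ℝ}
    (h₁ : Passage F a₁ b₁ Z₁) (h₂ : Passage F a₂ b₂ Z₂) (hr₁ : -r ≤ a₁) (hr₂ : -r ≤ a₂)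
    (hδ₁ : a₁ ≤ -δ) (hδ₂ : a₂ ≤ -δ) (hb₁ : Z₁ b₁ = 0) (hb₂ : Z₂ b₂ = 0) (hc₁ : F b + h < b₁)
    (hc₂ : F b + h < b₂) :
    |b₁ - b₂| ≤ (gs + r) * Real.exp (2 * K * yd / m - C * δ / (2 * yu) + 2 * K * h / b) / h *
      |a₁ - a₂| := by
  rcases le_total a₂ a₁ with ha | ha
  · exact H.abs_sub_le h₁ h₂ ha hr₂ hδ₁ hb₁ hb₂ hc₁ hc₂
  · rw [abs_sub_comm b₁, abs_sub_comm a₁]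
    exact H.abs_sub_le h₂ h₁ ha hr₁ hδ₂ hb₂ hb₁ hc₂ hc₁

theorem LowerField.abs_exit_sub_le {G : ℝ → ℝ} {r δ γ X₀ c₀ m w K : ℝ}
    (H : LowerField G r δ γ X₀ c₀ m w K) {a₁ b₁ a₂ b₂ : ℝ} {Z₁ Z₂ : ℝ → ℝ}
    (h₁ : Passage G a₁ b₁ Z₁) (h₂ : Passage G a₂ b₂ Z₂) (hr₁ : -r ≤ a₁) (hr₂ : -r ≤ a₂)
    (hX₁ : a₁ ≤ -X₀) (hX₂ : a₂ ≤ -X₀) (hb₁ : Z₁ b₁ = 0) (hb₂ : Z₂ b₂ = 0) (hc₁ : δ < b₁)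
    (hc₂ : δ < b₂) :
    |b₁ - b₂| ≤ r * Real.exp (2 * K * w / m + 2 * K * r / w) / δ * |a₁ - a₂| := by
  rcases le_total a₂ a₁ with ha | ha
  · exact H.abs_sub_le h₁ h₂ ha hr₂ hX₁ hb₁ hb₂ hc₁ hc₂
  · rw [abs_sub_comm b₁, abs_sub_comm a₁]
    exact H.abs_sub_le h₂ h₁ ha hr₁ hX₂ hb₂ hb₁ hc₂ hc₁

variable {F : ℝ → ℝ} {K' r δ γ gs mU yd yu K C b h X₀ c₀ mL w : ℝ}

/-- The lower half turn. -/
theorem LowerField.exists_half_turn (H : LowerField (fun y => -F (-y)) r δ γ X₀ c₀ mL w K')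
    {x y : ℝ → ℝ} (hx : ∀ t, HasDerivAt x (y t) t) (hy : ∀ t, HasDerivAt y (F (y t) - x t) t)
    (h0 : y 0 = 0) (hX : X₀ ≤ x 0) (hr : x 0 ≤ r) :
    ∃ t₁ ∈ Icc (X₀ / r) (w / mL + 2 * r / w + r / δ), y t₁ = 0 ∧
      (∀ t ∈ Icc 0 t₁, x t ∈ Icc (-r) r ∧ y t ∈ Icc (-r) 0) ∧ x t₁ ∈ Icc (-r) (-δ) ∧
      δ < -x t₁ ∧
      ∃ Z, Passage (fun y => -F (-y)) (-x 0) (-x t₁) Z ∧ Z (-x t₁) = 0 := by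
  have hδ := H.δ_pos
  have hδr := H.δr
  have hc := H.c_pos
  have hcX := H.cX
  have hm := H.m_pos
  have hw := H.w_pos
  have hr0 : 0 < r := hδ.trans_le hδr
  have hG0 := H.start 0 ⟨le_rfl, hw.le⟩
  obtain ⟨t₁, ht₁, hy₁, hpos, hxδ, Z, hZ, hZ1, hmem⟩ :=
    _root_.exists_half_turn (G := fun y => -F (-y)) (x := fun t => -x t) (y := fun t => -y t)
      (m := mL) (c := w) (h := δ) (xc := δ) (Y := r) hm hw hδ hr0 (fun t => (hx t).neg)
      (fun t => (hy t).neg.congr_deriv (by rw [neg_neg]; ring)) (by simp [h0])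
      (by rw [neg_zero] at hG0 ⊢; linarith) (by linarith)
      (fun e Z hZ => H.low hZ (by linarith))
      (fun e Z hZ => H.high hZ (by linarith) (by linarith))
      (fun v hv => by have := H.nonpos v hv.1; linarith)
  have hhigh := H.high hZ (by linarith) (by linarith)
  have hexit := H.exit_le hZ (by linarith) (by linarith)
  have hbox : ∀ t ∈ Icc 0 t₁, x t ∈ Icc (-r) r ∧ y t ∈ Icc (-r) 0 := by
    intro t ht
    obtain ⟨h1, h2⟩ := hmem t ht
    have h3 := hhigh _ h1
    rw [h2] at h3
    have h4 : y t ≤ 0 := by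
      rcases eq_or_lt_of_le ht.1 with h | h
      · rw [← h, h0]
      rcases eq_or_lt_of_le ht.2 with h' | h'
      · rw [h']; linarith
      · linarith [hpos t ⟨h, h'⟩]
    refine ⟨⟨by linarith [h1.2], by linarith [h1.1]⟩, ?_, h4⟩
    nlinarith
  have hy₁' : y t₁ = 0 := by linarith
  refine ⟨t₁, ⟨?_, ?_⟩, hy₁', hbox, ⟨(hbox t₁ ⟨ht₁.1.le, le_rfl⟩).1.1, by linarith⟩, hxδ, Z, hZ, hZ1⟩
  · have hmono := monotoneOn_of_hasDerivWithinAt_nonneg (f := fun t => x t + r * t)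
      (f' := fun t => y t + r * 1) (convex_Icc 0 t₁)
      (continuous_iff_continuousAt.2
        fun t => ((hx t).add ((hasDerivAt_id t).const_mul r)).continuousAt).continuousOn
      (fun t _ => ((hx t).add ((hasDerivAt_id t).const_mul r)).hasDerivWithinAt)
      (fun t ht => by
        rw [interior_Icc] at ht
        linarith [(hbox t ⟨ht.1.le, ht.2.le⟩).2.1])
    have h5 := hmono ⟨le_rfl, ht₁.1.le⟩ ⟨ht₁.1.le, le_rfl⟩ ht₁.1.le
    simp only [mul_zero, add_zero] at h5
    rw [div_le_iff₀ hr0]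
    linarith
  · refine ht₁.2.trans ?_
    gcongr
    linarith

/-- The upper half turn. -/
theorem UpperField.exists_half_turn (H : UpperField F r δ gs mU yd yu K C b h)
    (hgr : 2 * gs + 2 < r)
    {x y : ℝ → ℝ} (hx : ∀ t, HasDerivAt x (y t) t) (hy : ∀ t, HasDerivAt y (F (y t) - x t) t)
    (h0 : y 0 = 0) (hX : -r ≤ x 0) (hr : x 0 ≤ -δ) :
    ∃ t₁ ∈ Icc 0 (b / 2 / mU + (gs + 1 + r) / (b / 2) + yu / h), y t₁ = 0 ∧
      (∀ t ∈ Icc 0 t₁, x t ∈ Icc (-r) r ∧ y t ∈ Icc 0 yu) ∧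
      x t₁ ∈ Icc (F b) (2 * gs + 2) ∧ F b + h < x t₁ ∧
      ∃ Z, Passage F (x 0) (x t₁) Z ∧ Z (x t₁) = 0 := by
  have hδ := H.δ_pos
  have hm := H.m_pos
  have hb := H.b_pos
  have hh := H.h_pos
  have h1 := H.h1
  have hFb := H.Fb_pos
  have hFgs := H.Fb_le
  have hyu : 0 < yu := (hb.trans_le H.b_yd).trans_le H.yd_yu
  have hG0 := H.ge_m 0 ⟨le_rfl, hb.le.trans H.b_yd⟩
  obtain ⟨t₁, ht₁, hy₁, hpos, hxδ, Z, hZ, hZ1, hmem⟩ :=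
    _root_.exists_half_turn (G := F) (x := x) (y := y)
      (m := mU) (c := b / 2) (h := h) (xc := F b + h) (Y := yu) hm (by positivity) hh hyu hx hy h0
      (by linarith) (by linarith)
      (fun e Z hZ => H.low hZ hr)
      (fun e Z hZ => H.high hZ hX)
      (fun v hv => by have := H.le_b v hv.1; linarith)
  have hhigh := H.high hZ hX
  have hexit := H.exit_le hZ hX hr (by linarith) hZ1
  refine ⟨t₁, ⟨ht₁.1.le, ht₁.2.trans ?_⟩, hy₁, fun t ht => ?_, ⟨by linarith, hexit⟩, hxδ, Z, hZ, hZ1⟩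
  · gcongr
    linarith
  · obtain ⟨h1, h2⟩ := hmem t ht
    have h3 := hhigh _ h1
    rw [h2] at h3
    have h4 : 0 ≤ y t := by
      rcases eq_or_lt_of_le ht.1 with h | h
      · rw [← h, h0]
      rcases eq_or_lt_of_le ht.2 with h' | h'
      · rw [h', hy₁]
      · exact (hpos t ⟨h, h'⟩).le
    refine ⟨⟨by linarith [h1.1], by linarith [h1.2]⟩, h4, ?_⟩
    nlinarith

/-- A full turn around the origin, starting and ending on the positive horizontal axis. -/
theorem exists_turn (HU : UpperField F r δ gs mU yd yu K C b h)
    (HL : LowerField (fun y => -F (-y)) r δ γ X₀ c₀ mL w K') (hgr : 2 * gs + 2 < r) (hyr : yu ≤ r)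
    {f : ℝ → ℝ × ℝ} (hf : ∀ t, HasDerivAt f (lienardField F (f t)) t) {s : ℝ}
    (hf0 : f 0 = (s, 0)) (hs : s ∈ Icc X₀ r) :
    ∃ x₁ x₂ t₂, t₂ ∈ Icc (X₀ / r) (w / mL + 2 * r / w + r / δ +
        (b / 2 / mU + (gs + 1 + r) / (b / 2) + yu / h)) ∧ f t₂ = (x₂, 0) ∧
      (∀ t ∈ Icc 0 t₂, f t ∈ {p : ℝ × ℝ | |p.1| ≤ r ∧ |p.2| ≤ r ∧ p.2 ≤ yu}) ∧
      x₂ ∈ Icc (F b) (2 * gs + 2) ∧ x₁ ∈ Icc (-r) (-δ) ∧ δ < -x₁ ∧ F b + h < x₂ ∧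
      (∃ Z, Passage (fun y => -F (-y)) (-s) (-x₁) Z ∧ Z (-x₁) = 0) ∧
      ∃ Z, Passage F x₁ x₂ Z ∧ Z x₂ = 0 := by
  have hyu : 0 < yu := (HU.b_pos.trans_le HU.b_yd).trans_le HU.yd_yu
  have hx : ∀ t, HasDerivAt (fun t => (f t).1) (f t).2 t := fun t => (hf t).fst
  have hy : ∀ t, HasDerivAt (fun t => (f t).2) (F (f t).2 - (f t).1) t := fun t => (hf t).snd
  obtain ⟨t₁, ht₁, hy₁, hbox₁, hx₁, hδ₁, hZ₁⟩ :=
    HL.exists_half_turn hx hy (by simp [hf0]) (by simpa [hf0] using hs.1)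
      (by simpa [hf0] using hs.2)
  obtain ⟨t₂, ht₂, hy₂, hbox₂, hx₂, hb₂, hZ₂⟩ :=
    HU.exists_half_turn hgr (x := fun t => (f (t + t₁)).1) (y := fun t => (f (t + t₁)).2)
      (fun t => (hx (t + t₁)).comp_add_const t t₁) (fun t => (hy (t + t₁)).comp_add_const t t₁)
      (by simpa using hy₁) (by simpa using hx₁.1) (by simpa using hx₁.2)
  simp only [zero_add] at hZ₂
  simp only [hf0] at hZ₁
  refine ⟨(f t₁).1, (f (t₂ + t₁)).1, t₂ + t₁, ⟨by linarith [ht₁.1, ht₂.1], by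
    linarith [ht₁.2, ht₂.2]⟩, Prod.ext rfl hy₂, fun t ht => ?_, hx₂, hx₁, hδ₁, hb₂, hZ₁, hZ₂⟩
  rcases le_total t t₁ with h | h
  · obtain ⟨h1, h2⟩ := hbox₁ t ⟨ht.1, h⟩
    exact ⟨abs_le.2 h1, abs_le.2 ⟨h2.1, by linarith [h2.2]⟩, by linarith [h2.2]⟩
  · obtain ⟨h1, h2⟩ := hbox₂ (t - t₁) ⟨by linarith, by linarith [ht.2]⟩
    simp only [sub_add_cancel] at h1 h2
    exact ⟨abs_le.2 h1, abs_le.2 ⟨by linarith [h2.1], by linarith [h2.2]⟩, h2.2⟩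

theorem exists_returnMap (HU : UpperField F r δ gs mU yd yu K C b h)
    (HL : LowerField (fun y => -F (-y)) r δ γ X₀ c₀ mL w K') (hgr : 2 * gs + 2 < r) (hyr : yu ≤ r)
    (hXF : X₀ < F b) {L : NNReal} (hL : LipschitzWith L (lienardField F))
    (hΛ : (gs + r) * Real.exp (2 * K * yd / mU - C * δ / (2 * yu) + 2 * K * h / b) / h *
      (r * Real.exp (2 * K' * w / mL + 2 * K' * r / w) / δ) ≤ 1 / 2) :
    ∃ τ₀ T P τ, ReturnMap (lienardField F) X₀ r (F b) (2 * gs + 2) τ₀ T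
      {p : ℝ × ℝ | |p.1| ≤ r ∧ |p.2| ≤ r ∧ p.2 ≤ yu} P τ := by
  have hδ := HU.δ_pos
  have hr : 0 < r := hδ.trans_le HU.δr
  have hh := HU.h_pos
  have hFb := HU.Fb_pos
  have hFgs := HU.Fb_le
  have hturn : ∀ s : ℝ, ∃ f : ℝ → ℝ × ℝ, ∃ x₁ x₂ t₂,
      f 0 = (s, 0) ∧ (∀ t, HasDerivAt f (lienardField F (f t)) t) ∧ (s ∈ Icc X₀ r →
      t₂ ∈ Icc (X₀ / r) (w / mL + 2 * r / w + r / δ +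
        (b / 2 / mU + (gs + 1 + r) / (b / 2) + yu / h)) ∧ f t₂ = (x₂, 0) ∧
      (∀ t ∈ Icc 0 t₂, f t ∈ {p : ℝ × ℝ | |p.1| ≤ r ∧ |p.2| ≤ r ∧ p.2 ≤ yu}) ∧
      x₂ ∈ Icc (F b) (2 * gs + 2) ∧ x₁ ∈ Icc (-r) (-δ) ∧ δ < -x₁ ∧ F b + h < x₂ ∧
      (∃ Z, Passage (fun y => -F (-y)) (-s) (-x₁) Z ∧ Z (-x₁) = 0) ∧
      ∃ Z, Passage F x₁ x₂ Z ∧ Z x₂ = 0) := by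
    intro s
    obtain ⟨f, hf0, hf⟩ := exists_global_solution_of_lipschitz hL (s, 0)
    by_cases hs : s ∈ Icc X₀ r
    · obtain ⟨x₁, x₂, t₂, h⟩ := exists_turn HU HL hgr hyr hf hf0 hs
      exact ⟨f, x₁, x₂, t₂, hf0, hf, fun _ => h⟩
    · exact ⟨f, 0, 0, 0, hf0, hf, fun h => absurd h hs⟩
  choose φ Q P τ hφ0 hφ hmain using hturn
  refine ⟨X₀ / r, w / mL + 2 * r / w + r / δ +
        (b / 2 / mU + (gs + 1 + r) / (b / 2) + yu / h), P, τ, ⟨hXF, by linarith, hgr,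
    div_pos (HL.c_pos.trans_le HL.cX) hr, fun s hs => (hmain s hs).2.2.2.1, fun s hs => (hmain s hs).1,
    fun s hs f hf hf0 => ?_, fun s₁ h₁ s₂ h₂ => ?_, fun s hs => ?_⟩⟩
  · have : f = φ s := eq_of_lipschitz_ode hL (t₀ := 0) hf (hφ s) (by rw [hf0, hφ0])
    subst this
    exact ⟨(hmain s hs).2.1, (hmain s hs).2.2.1⟩
  · obtain ⟨-, -, -, -, hQ₁, hδ₁, hb₁, ⟨Z₁, hZ₁, hZ₁'⟩, Y₁, hY₁, hY₁'⟩ := hmain s₁ h₁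
    obtain ⟨-, -, -, -, hQ₂, hδ₂, hb₂, ⟨Z₂, hZ₂, hZ₂'⟩, Y₂, hY₂, hY₂'⟩ := hmain s₂ h₂
    have hU := HU.abs_exit_sub_le hY₁ hY₂ hQ₁.1 hQ₂.1 hQ₁.2 hQ₂.2 hY₁' hY₂' hb₁ hb₂
    have hLo := HL.abs_exit_sub_le hZ₁ hZ₂ (neg_le_neg h₁.2) (neg_le_neg h₂.2) (neg_le_neg h₁.1)
      (neg_le_neg h₂.1) hZ₁' hZ₂' hδ₁ hδ₂
    rw [neg_sub_neg, neg_sub_neg, abs_sub_comm, abs_sub_comm s₂] at hLo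
    have hgs : 0 < gs + r := by linarith
    calc |P s₁ - P s₂| ≤ _ := hU
      _ ≤ _ := mul_le_mul_of_nonneg_left hLo (by positivity)
      _ = _ := by rw [← mul_assoc]
      _ ≤ _ := mul_le_mul_of_nonneg_right hΛ (abs_nonneg _)
  · have hG0 := HL.start 0 ⟨le_rfl, HL.w_pos.le⟩
    have := HL.m_pos
    have := HL.c_pos
    have := hs.1
    simp only [neg_zero] at hG0
    simp only [lienardField]
    linarith

end Turn

section Cycle

theorem deriv_nonpos_of_le_left {f : ℝ → ℝ} {a t d : ℝ} (hat : a < t) (hf : HasDerivAt f d t)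
    (h : ∀ s ∈ Ioo a t, f t ≤ f s) : d ≤ 0 := by
  have h1 := (hasDerivWithinAt_iff_tendsto_slope' (s := Iio t) (by simp)).1 hf.hasDerivWithinAt
  refine le_of_tendsto h1 ?_
  filter_upwards [Ioo_mem_nhdsLT hat] with s hs
  rw [slope_def_field]
  exact div_nonpos_of_nonneg_of_nonpos (by linarith [h s hs]) (by linarith [hs.2])

theorem exists_first_hit {y : ℝ → ℝ} {u w b : ℝ} (hy : Continuous y) (huw : u ≤ w) (hu : b < y u)
    (hw : y w ≤ b) : ∃ t ∈ Ioc u w, y t = b ∧ ∀ s ∈ Ico u t, b < y s := by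
  set S := Icc u w ∩ y ⁻¹' Iic b with hS
  have hScl : IsClosed S := isClosed_Icc.inter (isClosed_Iic.preimage hy)
  have hSne : S.Nonempty := ⟨w, ⟨huw, le_rfl⟩, hw⟩
  have hSb : BddBelow S := ⟨u, fun z hz => hz.1.1⟩
  have hmem := hScl.csInf_mem hSne hSb
  set t := sInf S
  have hut : u < t := by
    rcases eq_or_lt_of_le hmem.1.1 with h | h
    · have h2 : y t ≤ b := hmem.2
      rw [← h] at h2
      linarith
    · exact h
  have hpos : ∀ s ∈ Ico u t, b < y s := by
    intro s hs
    by_contra! hle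
    have : t ≤ s := csInf_le hSb ⟨⟨hs.1, hs.2.le.trans hmem.1.2⟩, hle⟩
    linarith [hs.2]
  refine ⟨t, ⟨hut, hmem.1.2⟩, le_antisymm hmem.2 ?_, hpos⟩
  have hc : Tendsto y (𝓝[<] t) (𝓝 (y t)) := hy.continuousAt.continuousWithinAt
  refine ge_of_tendsto hc ?_
  filter_upwards [Ioo_mem_nhdsLT hut] with z hz
  exact (hpos z ⟨hz.1.le, hz.2⟩).le

theorem Function.Periodic.exists_forall_le {f : ℝ → ℝ} (hf : Continuous f) {T : ℝ} (hT : 0 < T)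
    (hp : Function.Periodic f T) : ∃ t₀, ∀ t, f t₀ ≤ f t := by
  obtain ⟨t₀, -, h⟩ := isCompact_Icc.exists_isMinOn (nonempty_Icc.2 hT.le) hf.continuousOn
    (s := Icc 0 T)
  refine ⟨t₀, fun t => ?_⟩
  obtain ⟨s, hs, hst⟩ := hp.exists_mem_Ico₀ hT t
  rw [hst]
  exact h ⟨hs.1, hs.2.le⟩

variable {F : ℝ → ℝ}

/-- The bound `F y < x` fails where `y` is maximal along a periodic solution. -/
theorem snd_lt_of_periodic {q : ℝ → ℝ × ℝ} (hq : ∀ t, HasDerivAt q (lienardField F (q t)) t)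
    {T : ℝ} (hT : 0 < T) (hqT : Function.Periodic q T) {r yu : ℝ} (hr : ∀ t, -r ≤ (q t).1)
    (hF : ∀ y, yu ≤ y → F y ≤ -r - 1) (t : ℝ) : (q t).2 < yu := by
  have hqc : Continuous q := continuous_iff_continuousAt.2 fun t => (hq t).continuousAt
  obtain ⟨t₀, ht₀⟩ := Function.Periodic.exists_forall_le (f := fun t => -(q t).2) (by fun_prop) hT
    (fun t => by simp only [hqT t])
  have hd : HasDerivAt (fun t => (q t).2) (F (q t₀).2 - (q t₀).1) t₀ := (hq t₀).snd
  have h0 : F (q t₀).2 - (q t₀).1 = 0 :=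
    IsLocalMax.hasDerivAt_eq_zero (Eventually.of_forall fun t => by linarith [ht₀ t]) hd
  have h1 : (q t₀).2 < yu := by
    by_contra! h
    linarith [hF _ h, hr t₀]
  linarith [ht₀ t]

variable {T' b r : ℝ}

/-- After the leftmost point, a trajectory with `ẏ > 0` crosses `y = b` downwards, and hence
meets the positive horizontal axis to the right of `F b`. -/
theorem exists_hit_of_pos {x y : ℝ → ℝ} (hx : ∀ t, HasDerivAt x (y t) t)
    (hy : ∀ t, HasDerivAt y (F (y t) - x t) t) (h0 : y 0 = 0) (hT' : 0 < T') (hyT : y T' = 0)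
    (hb : 0 < b) (hpos : x 0 < F 0) (hF : ∀ y ∈ Icc 0 b, F 0 + 2 * y ≤ F y) :
    ∃ t, y t = 0 ∧ F b ≤ x t := by
  have hyc : Continuous y := continuous_iff_continuousAt.2 fun t => (hy t).continuousAt
  have hd := hy 0
  rw [h0] at hd
  obtain ⟨t₁, ht₁, hy₁, hp⟩ : ∃ t ∈ Ioc 0 T', y t = 0 ∧ ∀ s ∈ Ioo 0 t, 0 < y s := by
    rcases exists_first_return_or_pos (T := T') hyc (sub_pos.2 hpos) hd h0 with h | h
    · exact h
    · exact absurd hyT (h T' ⟨hT', le_rfl⟩).ne'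
  have hnn : ∀ t ∈ Icc 0 t₁, 0 ≤ y t := by
    intro t ht
    rcases eq_or_lt_of_le ht.1 with h | h
    · rw [← h, h0]
    rcases eq_or_lt_of_le ht.2 with h' | h'
    · rw [h', hy₁]
    · exact (hp t ⟨h, h'⟩).le
  have hd₁ : F 0 - x t₁ ≤ 0 := by
    have := hy t₁
    rw [hy₁] at this
    exact deriv_nonpos_of_le_left ht₁.1 this fun s hs => by rw [hy₁]; exact (hp s hs).le
  obtain ⟨u, hu, hub⟩ : ∃ u ∈ Icc 0 t₁, b < y u := by
    by_contra! hcon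
    have hW : ∀ t, HasDerivAt (fun t => y t - (x t - F 0)) (F (y t) - x t - y t) t :=
      fun t => (hy t).sub ((hx t).sub_const _)
    have hmono := monotoneOn_of_hasDerivWithinAt_nonneg
      (f := fun t => (y t - (x t - F 0)) * Real.exp (-t))
      (f' := fun t => (F (y t) - x t - y t) * Real.exp (-t) +
        (y t - (x t - F 0)) * (Real.exp (-t) * -1)) (convex_Icc 0 t₁)
      (continuous_iff_continuousAt.2
        fun t => ((hW t).mul (hasDerivAt_neg t).exp).continuousAt).continuousOn
      (fun t _ => ((hW t).mul (hasDerivAt_neg t).exp).hasDerivWithinAt)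
      (fun t ht => by
        rw [interior_Icc] at ht
        have ht' : t ∈ Icc 0 t₁ := ⟨ht.1.le, ht.2.le⟩
        have := hF (y t) ⟨hnn t ht', hcon t ht'⟩
        have he := Real.exp_pos (-t)
        have : 0 ≤ (F (y t) - x t - y t) - (y t - (x t - F 0)) := by linarith
        nlinarith [mul_nonneg this he.le])
    have := hmono ⟨le_rfl, ht₁.1.le⟩ ⟨ht₁.1.le, le_rfl⟩ ht₁.1.le
    simp only [h0, hy₁, neg_zero, Real.exp_zero] at this
    have he := Real.exp_pos (-t₁)
    nlinarith
  obtain ⟨t₂, ht₂, hy₂, hp₂⟩ := exists_first_hit hyc hu.2 hub (by rw [hy₁]; exact hb.le)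
  have hd₂ : F b - x t₂ ≤ 0 := by
    have := hy t₂
    rw [hy₂] at this
    exact deriv_nonpos_of_le_left ht₂.1 this fun s hs => by
      rw [hy₂]; exact (hp₂ s ⟨hs.1.le, hs.2⟩).le
  have hxm := monotoneOn_of_hasDerivWithinAt_nonneg (f := x) (f' := y) (convex_Icc t₂ t₁)
    (continuous_iff_continuousAt.2 fun t => (hx t).continuousAt).continuousOn
    (fun t _ => (hx t).hasDerivWithinAt) (fun t ht => by
      rw [interior_Icc] at ht
      exact hnn t ⟨by linarith [hu.1, ht₂.1, ht.1], ht.2.le⟩)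
  have := hxm ⟨le_rfl, ht₂.2⟩ ⟨ht₂.2, le_rfl⟩ ht₂.2
  exact ⟨t₁, hy₁, by linarith⟩

/-- Every nonconstant periodic solution meets the positive horizontal axis to the right of
`F b`. -/
theorem exists_hit_of_periodic {L : NNReal} (hL : LipschitzWith L (lienardField F))
    {q : ℝ → ℝ × ℝ} (hq : ∀ t, HasDerivAt q (lienardField F (q t)) t) (hT' : 0 < T')
    (hqT : Function.Periodic q T') (hne : ∃ t₁ t₂, q t₁ ≠ q t₂) (hb : 0 < b)
    (hF : ∀ y ∈ Icc 0 b, F 0 + 2 * y ≤ F y) : ∃ t s, F b ≤ s ∧ q t = (s, 0) := by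
  have hqc : Continuous q := continuous_iff_continuousAt.2 fun t => (hq t).continuousAt
  obtain ⟨t₀, ht₀⟩ := Function.Periodic.exists_forall_le (f := fun t => (q t).1) (by fun_prop) hT'
    (fun t => by simp only [hqT t])
  have hx : ∀ t, HasDerivAt (fun t => (q (t + t₀)).1) (q (t + t₀)).2 t := fun t =>
    (ReturnMap.shift hq t₀ t).fst
  have hy : ∀ t, HasDerivAt (fun t => (q (t + t₀)).2) (F (q (t + t₀)).2 - (q (t + t₀)).1) t :=
    fun t => (ReturnMap.shift hq t₀ t).snd
  have hy0 : (q t₀).2 = 0 :=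
    IsLocalMin.hasDerivAt_eq_zero (Eventually.of_forall ht₀) (hq t₀).fst
  have hneq : (q t₀).1 ≠ F 0 := by
    intro h
    have hconst : q = fun _ => (F 0, 0) := by
      refine eq_of_lipschitz_ode hL (t₀ := t₀) hq (fun t => ?_) (Prod.ext h hy0)
      have : lienardField F (F 0, 0) = 0 := by simp [lienardField]
      rw [this]
      exact hasDerivAt_const t _
    obtain ⟨t₁, t₂, h12⟩ := hne
    exact h12 (by rw [hconst])
  have hlt : (q t₀).1 < F 0 := by
    by_contra! hcon
    have hlt : F 0 < (q t₀).1 := lt_of_le_of_ne hcon hneq.symm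
    have hd := (hy 0).neg
    simp only [zero_add, hy0] at hd
    obtain ⟨t₁, ht₁, hneg⟩ : ∃ t > 0, ∀ s ∈ Ioo 0 t, 0 < -(q (s + t₀)).2 := by
      rcases exists_first_return_or_pos (T := 1) (y := fun t => -(q (t + t₀)).2)
        (by fun_prop) (neg_pos.2 (sub_neg.2 hlt)) hd (by simp [hy0]) with ⟨t, h1, -, h3⟩ | h
      · exact ⟨t, h1.1, h3⟩
      · exact ⟨1, one_pos, fun s hs => h s ⟨hs.1, hs.2.le⟩⟩
    obtain ⟨c, hc, hc'⟩ := exists_hasDerivAt_eq_slope _ _ ht₁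
      (continuous_iff_continuousAt.2 fun t => (hx t).continuousAt).continuousOn fun t _ => hx t
    have h1 := hneg c hc
    rw [eq_div_iff (by linarith)] at hc'
    simp only [zero_add, sub_zero] at hc'
    have := ht₀ (t₁ + t₀)
    nlinarith
  obtain ⟨t, h1, h2⟩ := exists_hit_of_pos hx hy (by simpa using hy0) hT'
    (by rw [add_comm, hqT]; exact hy0) hb (by simpa using hlt) hF
  exact ⟨t + t₀, _, h2, Prod.ext rfl h1⟩

end Cycle

section Limit

variable {F F₀ : ℝ → ℝ} {K' r δ γ gs mU yd yu K C b h X₀ c₀ mL w : ℝ}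

theorem exists_limit_cycle (HU : UpperField F r δ gs mU yd yu K C b h)
    (HL : LowerField (fun y => -F (-y)) r δ γ X₀ c₀ mL w K') (hgr : 2 * gs + 2 < r) (hyr : yu ≤ r)
    (hXF : X₀ < F b) {L : NNReal} (hL : LipschitzWith L (lienardField F))
    (hΛ : (gs + r) * Real.exp (2 * K * yd / mU - C * δ / (2 * yu) + 2 * K * h / b) / h *
      (r * Real.exp (2 * K' * w / mL + 2 * K' * r / w) / δ) ≤ 1 / 2)
    (hFb : ∀ y ∈ Icc 0 b, F 0 + 2 * y ≤ F y) (hFF : ∀ y ≤ yu + 1, F y = F₀ y)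
    (hF₀ : ∀ y, yu ≤ y → F₀ y ≤ -r - 1) :
    ∃ p : ℝ → ℝ × ℝ,
      IsPeriodicSol (lienardField F₀) p ∧
      Set.range p ⊆ Metric.closedBall (0 : ℝ × ℝ) r ∧
      (∀ q : ℝ → ℝ × ℝ, IsPeriodicSol (lienardField F₀) q →
        Set.range q ⊆ Metric.closedBall (0 : ℝ × ℝ) r → Set.range q = Set.range p) ∧
      (∃ U : Set (ℝ × ℝ), IsOpen U ∧ Set.range p ⊆ U ∧
        ∀ z ∈ U, ∃ q : ℝ → ℝ × ℝ, q 0 = z ∧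
          (∀ t : ℝ, 0 ≤ t → HasDerivAt q (lienardField F₀ (q t)) t) ∧
          Filter.Tendsto (fun t => Metric.infDist (q t) (Set.range p)) Filter.atTop (nhds 0)) := by
  obtain ⟨τ₀, T, P, τ, H⟩ := exists_returnMap HU HL hgr hyr hXF hL hΛ
  obtain ⟨x₀, hx₀, hfix⟩ := H.exists_fixed
  have hx₀' := H.mem_of_mem hx₀
  obtain ⟨p, hp0, hp⟩ := exists_global_solution_of_lipschitz hL (x₀, 0)
  have hper := H.periodic hL hp hp0 hx₀ hfix
  have hfield : ∀ z : ℝ × ℝ, z.2 ≤ yu + 1 → lienardField F z = lienardField F₀ z := fun z hz => by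
    simp only [lienardField, hFF z.2 hz]
  have hnn : ∀ s ∈ Icc X₀ r, ∀ f : ℝ → ℝ × ℝ, (∀ t, HasDerivAt f (lienardField F (f t)) t) →
      f 0 = (s, 0) → ∀ t, 0 ≤ t → f t ∈ {p : ℝ × ℝ | |p.1| ≤ r ∧ |p.2| ≤ r ∧ p.2 ≤ yu} := by
    intro s hs f hf hf0 t ht
    obtain ⟨N, hN⟩ := exists_nat_ge (t / τ₀)
    exact H.mem_of_nonneg N s hs f hf hf0 t ht ((div_le_iff₀ H.τ_pos).1 hN)
  have hpS : ∀ t, p t ∈ {p : ℝ × ℝ | |p.1| ≤ r ∧ |p.2| ≤ r ∧ p.2 ≤ yu} := by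
    intro t
    have hτ : 0 < τ x₀ := H.τ_pos.trans_le (H.time x₀ hx₀').1
    obtain ⟨s, hs, hst⟩ := hper.exists_mem_Ico₀ hτ t
    rw [hst]
    exact hnn x₀ hx₀' p hp hp0 s hs.1
  have hτ : 0 < τ x₀ := H.τ_pos.trans_le (H.time x₀ hx₀').1
  refine ⟨p, ⟨fun t => ?_, ⟨τ x₀, hτ, hper⟩, ?_⟩, ?_, fun q hq hqr => ?_, ?_⟩
  · rw [← hfield _ (by linarith [(hpS t).2.2])]
    exact hp t
  · by_contra! hconst
    have h1 : p = fun _ => (x₀, 0) := funext fun t => by rw [hconst t 0, hp0]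
    have h2 := (hp 0).unique (by rw [h1]; exact hasDerivAt_const _ _)
    have h3 := H.trans x₀ hx₀
    rw [hp0] at h2
    rw [h2] at h3
    simp at h3
  · rintro _ ⟨t, rfl⟩
    rw [mem_closedBall_zero_iff, Prod.norm_def, Real.norm_eq_abs, Real.norm_eq_abs]
    exact max_le (hpS t).1 (hpS t).2.1
  · obtain ⟨hq', ⟨T', hT', hqT⟩, hne⟩ := hq
    have hball : ∀ t, |(q t).1| ≤ r := fun t => by
      have := hqr ⟨t, rfl⟩
      rw [mem_closedBall_zero_iff, Prod.norm_def, Real.norm_eq_abs] at this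
      exact (le_max_left _ _).trans this
    have hlt := snd_lt_of_periodic hq' hT' hqT (fun t => (abs_le.1 (hball t)).1) hF₀
    have hqF : ∀ t, HasDerivAt q (lienardField F (q t)) t := fun t => by
      rw [hfield _ (by linarith [hlt t])]
      exact hq' t
    obtain ⟨t, s, hs, hts⟩ := exists_hit_of_periodic hL hqF hT' hqT hne HU.b_pos hFb
    refine H.range_eq hL hp hp0 hx₀ hfix (s := s) ⟨by linarith, ?_⟩ hqF hts hT' hqT
    have := hball t
    rw [hts] at this
    exact (abs_le.1 this).2
  · obtain ⟨U, hUo, hpU, hU⟩ := H.exists_nhds hL hp hp0 hx₀ hfix one_pos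
    refine ⟨U, hUo, hpU, fun z hz => ?_⟩
    obtain ⟨f, hf0, hf⟩ := exists_global_solution_of_lipschitz hL z
    obtain ⟨t₀, ht₀, hnear, s, hs, hhit⟩ := hU z hz f hf hf0
    refine ⟨f, hf0, fun t ht => ?_, ?_⟩
    · rw [← hfield]
      · exact hf t
      rcases le_total t t₀ with htt | htt
      · obtain ⟨t', ht'⟩ := hnear t ⟨ht, htt⟩
        have h1 : |(f t).2 - (p t').2| < 1 := by
          rw [← Real.dist_eq]
          exact (le_max_right _ _).trans_lt ht'
        linarith [(hpS t').2.2, (abs_lt.1 h1).2]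
      · have := hnn s hs _ (ReturnMap.shift hf t₀) (by simpa using hhit) (t - t₀) (by linarith)
        simp only [sub_add_cancel] at this
        linarith [this.2.2]
    · have := H.tendsto_infDist hL hp hp0 hx₀ hfix hs (ReturnMap.shift hf t₀) (by simpa using hhit)
      have h2 := this.comp (tendsto_atTop_add_const_right atTop (-t₀) tendsto_id)
      refine h2.congr fun t => ?_
      simp

end Limit

section Gain

/-- The nonlinearity of the Hester system in the rescaled variable `u = y / ε`. -/
noncomputable def gain (α μ κ u : ℝ) : ℝ := μ * (Real.exp u - κ * Real.exp ((1 + α) * u))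

variable {α μ κ us : ℝ}

theorem hasDerivAt_gain (hus : κ * (1 + α) = Real.exp (-(α * us))) (u : ℝ) :
    HasDerivAt (gain α μ κ) (μ * Real.exp u * (1 - Real.exp (α * (u - us)))) u := by
  have h1 : HasDerivAt (fun u => Real.exp ((1 + α) * u)) (Real.exp ((1 + α) * u) * ((1 + α) * 1)) u :=
    ((hasDerivAt_id u).const_mul (1 + α)).exp
  refine (((Real.hasDerivAt_exp u).sub (h1.const_mul κ)).const_mul μ).congr_deriv ?_
  rw [show κ * (Real.exp ((1 + α) * u) * ((1 + α) * 1)) = κ * (1 + α) * Real.exp ((1 + α) * u) by ring,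
    hus, ← Real.exp_add, show -(α * us) + (1 + α) * u = u + α * (u - us) by ring, Real.exp_add]
  ring

theorem continuous_gain : Continuous (gain α μ κ) := by
  unfold gain
  fun_prop

theorem monotoneOn_gain (hα : 0 < α) (hμ : 0 < μ) (hus : κ * (1 + α) = Real.exp (-(α * us))) :
    MonotoneOn (gain α μ κ) (Iic us) := by
  refine monotoneOn_of_hasDerivWithinAt_nonneg (convex_Iic us) continuous_gain.continuousOn
    (fun u _ => (hasDerivAt_gain hus u).hasDerivWithinAt) fun u hu => ?_
  rw [interior_Iic] at hu
  have : Real.exp (α * (u - us)) ≤ 1 := Real.exp_le_one_iff.2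
    (mul_nonpos_of_nonneg_of_nonpos hα.le (by linarith [hu.out]))
  exact mul_nonneg (by positivity) (by linarith)

theorem antitoneOn_gain (hα : 0 < α) (hμ : 0 < μ) (hus : κ * (1 + α) = Real.exp (-(α * us))) :
    AntitoneOn (gain α μ κ) (Ici us) := by
  refine antitoneOn_of_hasDerivWithinAt_nonpos (convex_Ici us) continuous_gain.continuousOn
    (fun u _ => (hasDerivAt_gain hus u).hasDerivWithinAt) fun u hu => ?_
  rw [interior_Ici] at hu
  have : 1 ≤ Real.exp (α * (u - us)) := Real.one_le_exp_iff.2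
    (mul_nonneg hα.le (by linarith [hu.out]))
  exact mul_nonpos_of_nonneg_of_nonpos (by positivity) (by linarith)

theorem gain_le (hα : 0 < α) (hμ : 0 < μ) (hus : κ * (1 + α) = Real.exp (-(α * us))) (u : ℝ) :
    gain α μ κ u ≤ gain α μ κ us := by
  rcases le_total u us with h | h
  · exact monotoneOn_gain hα hμ hus h self_mem_Iic h
  · exact antitoneOn_gain hα hμ hus self_mem_Ici h h

theorem gain_zero : gain α μ κ 0 = μ * (1 - κ) := by simp [gain]

theorem gain_le_mul_exp (hμ : 0 < μ) (hκ : 0 < κ) (u : ℝ) : gain α μ κ u ≤ μ * Real.exp u := by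
  have : 0 ≤ κ * Real.exp ((1 + α) * u) := by positivity
  exact mul_le_mul_of_nonneg_left (by linarith) hμ.le

theorem gain_nonneg (hα : 0 < α) (hμ : 0 < μ) (hκ1 : κ ≤ 1) {u : ℝ} (hu : u ≤ 0) :
    0 ≤ gain α μ κ u := by
  have h1 : Real.exp ((1 + α) * u) ≤ Real.exp u := Real.exp_le_exp.2 (by nlinarith)
  have h2 := Real.exp_pos ((1 + α) * u)
  exact mul_nonneg hμ.le (by nlinarith)

theorem deriv_gain_le (hα : 0 < α) (hμ : 0 < μ) (u : ℝ) :
    μ * Real.exp u * (1 - Real.exp (α * (u - us))) ≤ μ * Real.exp us := by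
  rcases le_total u us with h | h
  · have h1 : Real.exp u ≤ Real.exp us := Real.exp_le_exp.2 h
    have h2 := Real.exp_pos (α * (u - us))
    have h3 : 0 < μ * Real.exp u := by positivity
    have h4 : μ * Real.exp u ≤ μ * Real.exp us := mul_le_mul_of_nonneg_left h1 hμ.le
    nlinarith
  · have : 1 ≤ Real.exp (α * (u - us)) := Real.one_le_exp_iff.2 (mul_nonneg hα.le (by linarith))
    have h3 : 0 ≤ μ * Real.exp us := by positivity
    exact (mul_nonpos_of_nonneg_of_nonpos (by positivity) (by linarith)).trans h3

theorem deriv_gain_le_neg (hα : 0 < α) (hμ : 0 < μ) {ud u : ℝ} (hd : us ≤ ud) (h0 : 0 ≤ us)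
    (hu : ud ≤ u) :
    μ * Real.exp u * (1 - Real.exp (α * (u - us))) ≤ -(μ * (Real.exp (α * (ud - us)) - 1)) := by
  have h1 : 1 ≤ Real.exp (α * (ud - us)) := Real.one_le_exp_iff.2 (mul_nonneg hα.le (by linarith))
  have h2 : Real.exp (α * (ud - us)) ≤ Real.exp (α * (u - us)) :=
    Real.exp_le_exp.2 (mul_le_mul_of_nonneg_left (by linarith) hα.le)
  have h3 : 1 ≤ Real.exp u := Real.one_le_exp_iff.2 (by linarith)
  have h4 : Real.exp (α * (ud - us)) - 1 ≤ Real.exp u * (Real.exp (α * (u - us)) - 1) := by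
    nlinarith
  nlinarith [mul_le_mul_of_nonneg_left h4 hμ.le]

theorem abs_deriv_gain_le (hα : 0 < α) (hμ : 0 < μ) {U u : ℝ} (hu : u ≤ U) :
    |μ * Real.exp u * (1 - Real.exp (α * (u - us)))| ≤
      μ * Real.exp U * (1 + Real.exp (α * (U - us))) := by
  rw [abs_mul, abs_of_pos (by positivity : 0 < μ * Real.exp u)]
  have h1 : |1 - Real.exp (α * (u - us))| ≤ 1 + Real.exp (α * (U - us)) := by
    have h2 : Real.exp (α * (u - us)) ≤ Real.exp (α * (U - us)) :=
      Real.exp_le_exp.2 (mul_le_mul_of_nonneg_left (by linarith) hα.le)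
    have h3 := Real.exp_pos (α * (u - us))
    rw [abs_le]
    constructor <;> linarith
  gcongr

theorem exists_gain_le (hα : 0 < α) (hμ : 0 < μ) (hκ : 0 < κ) (l M : ℝ) :
    ∃ u, l < u ∧ gain α μ κ u ≤ M := by
  have h1 : Tendsto (fun u => μ * Real.exp u) atTop atTop :=
    Real.tendsto_exp_atTop.const_mul_atTop hμ
  have h2 : Tendsto (fun u => 1 - κ * Real.exp (α * u)) atTop atBot := by
    have : Tendsto (fun u => κ * Real.exp (α * u)) atTop atTop :=
      (Real.tendsto_exp_atTop.comp (tendsto_id.const_mul_atTop hα)).const_mul_atTop hκ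
    simpa [sub_eq_add_neg] using tendsto_atBot_add_const_left atTop 1
      (tendsto_neg_atTop_atBot.comp this)
  have h3 := h1.atTop_mul_atBot₀ h2
  obtain ⟨u, hu, hu'⟩ := ((h3.eventually_le_atBot M).and (eventually_gt_atTop l)).exists
  refine ⟨u, hu', le_trans (le_of_eq ?_) hu⟩
  rw [gain, show (1 + α) * u = u + α * u by ring, Real.exp_add]
  ring

theorem mul_le_gain_sub (hα : 0 < α) (hμ : 0 < μ) (hus : κ * (1 + α) = Real.exp (-(α * us)))
    (h0 : 0 < us) {u : ℝ} (hu : u ∈ Icc 0 us) :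
    μ * (1 - Real.exp (-(α * us / 2))) / 2 * u ≤ gain α μ κ u - gain α μ κ 0 := by
  set k := μ * (1 - Real.exp (-(α * us / 2))) with hk
  have hk0 : 0 < k := mul_pos hμ (sub_pos.2 (Real.exp_lt_one_iff.2 (by
    have := mul_pos hα h0
    linarith)))
  have hmono : MonotoneOn (fun u => gain α μ κ u - k * u) (Icc 0 (us / 2)) := by
    refine monotoneOn_of_hasDerivWithinAt_nonneg
      (f' := fun u => μ * Real.exp u * (1 - Real.exp (α * (u - us))) - k * 1)
      (convex_Icc _ _) (continuous_gain.sub (by fun_prop)).continuousOn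
      (fun u _ => ((hasDerivAt_gain hus u).sub
        ((hasDerivAt_id u).const_mul k)).hasDerivWithinAt) fun u hu => ?_
    rw [interior_Icc] at hu
    have h1 : 1 ≤ Real.exp u := Real.one_le_exp_iff.2 hu.1.le
    have h2 : Real.exp (α * (u - us)) ≤ Real.exp (-(α * us / 2)) :=
      Real.exp_le_exp.2 (by nlinarith [hu.2])
    have h3 : Real.exp (-(α * us / 2)) < 1 := Real.exp_lt_one_iff.2 (by
      have := mul_pos hα h0
      linarith)
    have h4 : 1 - Real.exp (-(α * us / 2)) ≤ Real.exp u * (1 - Real.exp (α * (u - us))) := by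
      nlinarith
    nlinarith [mul_le_mul_of_nonneg_left h4 hμ.le]
  rcases le_total u (us / 2) with h | h
  · have := hmono ⟨le_rfl, by linarith⟩ ⟨hu.1, h⟩ hu.1
    simp only [mul_zero, sub_zero] at this
    nlinarith [hu.1]
  · have h1 := hmono ⟨le_rfl, by linarith⟩ ⟨by linarith, le_rfl⟩ (by linarith : (0 : ℝ) ≤ us / 2)
    have h2 := monotoneOn_gain hα hμ hus (show us / 2 ∈ Iic us by simp; linarith) hu.2 h
    simp only [mul_zero, sub_zero] at h1
    nlinarith [hu.2]

/-- The slope of `-2γεu + gain u` changes sign exactly once on `u ≥ 0`. -/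
theorem exists_argmax {ν : ℝ} (hα : 0 < α) (hμ : 0 < μ) (h0 : 0 < us) (hν : 0 < ν)
    (h1 : ν < μ * (α * Real.exp (-(α * us)))) (h2 : ν < μ * (1 - Real.exp (-(α * us / 2)))) :
    ∃ β ∈ Icc (us / 2) us,
      (∀ u ∈ Icc 0 β, ν ≤ μ * Real.exp u * (1 - Real.exp (α * (u - us)))) ∧
      ∀ u, β ≤ u → μ * Real.exp u * (1 - Real.exp (α * (u - us))) ≤ ν := by
  set ψ : ℝ → ℝ := fun u => μ * (1 - Real.exp (α * (u - us))) - ν * Real.exp (-u) with hψ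
  have hψc : Continuous ψ := by fun_prop
  have hanti : AntitoneOn ψ (Ici 0) := by
    have hd : ∀ u, HasDerivAt ψ
        (μ * (-(Real.exp (α * (u - us)) * (α * 1))) - ν * (Real.exp (-u) * -1)) u := fun u =>
      ((((((hasDerivAt_id u).sub_const us).const_mul α).exp).const_sub 1).const_mul μ).sub
        ((hasDerivAt_neg u).exp.const_mul ν)
    refine antitoneOn_of_hasDerivWithinAt_nonpos (convex_Ici 0) hψc.continuousOn
      (fun u _ => (hd u).hasDerivWithinAt) fun u hu => ?_
    rw [interior_Ici] at hu
    have h3 : Real.exp (-(α * us)) ≤ Real.exp (α * (u - us)) :=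
      Real.exp_le_exp.2 (by nlinarith [hu.out])
    have h4 : Real.exp (-u) ≤ 1 := Real.exp_le_one_iff.2 (by linarith [hu.out])
    have h5 : μ * (α * Real.exp (-(α * us))) ≤ μ * (α * Real.exp (α * (u - us))) := by gcongr
    nlinarith
  have key : ∀ u, μ * Real.exp u * (1 - Real.exp (α * (u - us))) - ν = Real.exp u * ψ u := by
    intro u
    have : Real.exp u * Real.exp (-u) = 1 := by rw [← Real.exp_add]; simp
    simp only [hψ]
    linear_combination ν * this
  obtain ⟨β, hβ, hβ0⟩ : ∃ β ∈ Icc (us / 2) us, ψ β = 0 := by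
    refine intermediate_value_Icc' (by linarith) hψc.continuousOn ⟨?_, ?_⟩
    · simp only [hψ, sub_self, mul_zero, Real.exp_zero, zero_sub]
      have := Real.exp_pos (-us)
      nlinarith
    · simp only [hψ]
      rw [show α * (us / 2 - us) = -(α * us / 2) by ring]
      have h4 : Real.exp (-(us / 2)) ≤ 1 := Real.exp_le_one_iff.2 (by linarith)
      nlinarith
  have hβp : 0 ≤ β := by linarith [hβ.1]
  refine ⟨β, hβ, fun u hu => ?_, fun u hu => ?_⟩
  · have h3 := hanti hu.1 hβp hu.2
    have h4 := key u
    have := mul_nonneg (Real.exp_pos u).le (hβ0 ▸ h3)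
    linarith
  · have h3 := hanti hβp (hβp.trans hu : u ∈ Ici 0) hu
    have h4 := key u
    have := mul_nonpos_of_nonneg_of_nonpos (Real.exp_pos u).le (hβ0 ▸ h3)
    linarith

theorem eventually_pow_mul_exp_le (M A B C : ℝ) {D : ℝ} (hD : 0 < D) :
    ∀ᶠ v : ℝ in atTop, M * (v ^ 4 * Real.exp (A + B * v + C * v ^ 3 - D * v ^ 4)) ≤ 1 / 2 := by
  set E := |B| + 4 + |C| with hE
  have h1 : Tendsto (fun v : ℝ => A + v ^ 3 * (E - D * v)) atTop atBot := by
    refine tendsto_atBot_add_const_left _ _ ((tendsto_pow_atTop (by norm_num)).atTop_mul_atBot₀ ?_)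
    simpa [sub_eq_add_neg] using tendsto_atBot_add_const_left atTop E
      (tendsto_neg_atTop_atBot.comp (tendsto_id.const_mul_atTop hD))
  have h2 := (Real.tendsto_exp_atBot.comp h1).const_mul |M|
  rw [mul_zero] at h2
  filter_upwards [h2.eventually_lt_const (show (0 : ℝ) < 1 / 2 by norm_num),
    eventually_ge_atTop 1] with v hv hv1
  refine le_trans ?_ hv.le
  have h3 : v ^ 4 ≤ Real.exp (4 * v) := by
    rw [show (4 : ℝ) * v = ((4 : ℕ) : ℝ) * v by norm_num, Real.exp_nat_mul]
    have := Real.add_one_le_exp v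
    gcongr
    linarith
  have h4 : v ^ 4 * Real.exp (A + B * v + C * v ^ 3 - D * v ^ 4) ≤
      Real.exp (A + v ^ 3 * (E - D * v)) := by
    refine (mul_le_mul_of_nonneg_right h3 (Real.exp_pos _).le).trans ?_
    rw [← Real.exp_add, Real.exp_le_exp]
    have h5 : v ≤ v ^ 3 := le_self_pow₀ hv1 (by norm_num)
    have h6 : B * v ≤ |B| * v ^ 3 := by
      have := le_abs_self B
      have := abs_nonneg B
      nlinarith
    have h7 : C * v ^ 3 ≤ |C| * v ^ 3 := by
      have := le_abs_self C
      gcongr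
    nlinarith
  calc M * (v ^ 4 * Real.exp (A + B * v + C * v ^ 3 - D * v ^ 4))
      ≤ |M| * (v ^ 4 * Real.exp (A + B * v + C * v ^ 3 - D * v ^ 4)) :=
        mul_le_mul_of_nonneg_right (le_abs_self M) (by positivity)
    _ ≤ |M| * Real.exp (A + v ^ 3 * (E - D * v)) :=
        mul_le_mul_of_nonneg_left h4 (abs_nonneg M)

end Gain

section Profile

/-- The Hester system is the Liénard system of this function. -/
noncomputable def hesterProfile (γ α μ κ ε y : ℝ) : ℝ := -2 * γ * y + gain α μ κ (y / ε)

variable {γ α μ κ us ud ur ε β δ r Y : ℝ}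

theorem hesterField_eq : hesterField γ α μ κ ε = lienardField (hesterProfile γ α μ κ ε) := by
  funext p
  simp only [hesterField, lienardField, hesterProfile, gain, Prod.mk.injEq, true_and]
  rw [mul_div_assoc]
  ring

theorem hasDerivAt_hesterProfile (hus : κ * (1 + α) = Real.exp (-(α * us))) (y : ℝ) :
    HasDerivAt (hesterProfile γ α μ κ ε)
      (-2 * γ + μ * Real.exp (y / ε) * (1 - Real.exp (α * (y / ε - us))) / ε) y := by
  refine (((hasDerivAt_id y).const_mul (-2 * γ)).add
    ((hasDerivAt_gain hus (y / ε)).comp y ((hasDerivAt_id y).div_const ε))).congr_deriv ?_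
  ring

theorem continuous_hesterProfile : Continuous (hesterProfile γ α μ κ ε) := by
  unfold hesterProfile
  have := continuous_gain (α := α) (μ := μ) (κ := κ)
  fun_prop

theorem antitoneOn_hesterProfile_sub (hus : κ * (1 + α) = Real.exp (-(α * us))) {s : Set ℝ}
    (hs : Convex ℝ s) {K : ℝ} (h : ∀ y ∈ interior s,
      -2 * γ + μ * Real.exp (y / ε) * (1 - Real.exp (α * (y / ε - us))) / ε ≤ K) :
    AntitoneOn (fun y => hesterProfile γ α μ κ ε y - K * y) s :=
  antitoneOn_of_hasDerivWithinAt_nonpos hs (continuous_hesterProfile.sub (by fun_prop)).continuousOn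
    (fun y _ => ((hasDerivAt_hesterProfile hus y).sub
      ((hasDerivAt_id y).const_mul K)).hasDerivWithinAt) fun y hy => by linarith [h y hy]

theorem monotoneOn_hesterProfile (hus : κ * (1 + α) = Real.exp (-(α * us))) (hε : 0 < ε)
    (hβ : ∀ u ∈ Icc 0 β, 2 * γ * ε ≤ μ * Real.exp u * (1 - Real.exp (α * (u - us)))) :
    MonotoneOn (hesterProfile γ α μ κ ε) (Icc 0 (ε * β)) := by
  refine monotoneOn_of_hasDerivWithinAt_nonneg (convex_Icc _ _)
    continuous_hesterProfile.continuousOn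
    (fun y _ => (hasDerivAt_hesterProfile hus y).hasDerivWithinAt) fun y hy => ?_
  rw [interior_Icc] at hy
  have h1 := hβ (y / ε) ⟨div_nonneg hy.1.le hε.le, by
    rw [div_le_iff₀ hε]; linarith [hy.2]⟩
  have h2 := (le_div_iff₀ hε).2 h1
  linarith

theorem antitoneOn_hesterProfile (hus : κ * (1 + α) = Real.exp (-(α * us))) (hε : 0 < ε)
    (hβ : ∀ u, β ≤ u → μ * Real.exp u * (1 - Real.exp (α * (u - us))) ≤ 2 * γ * ε) :
    AntitoneOn (hesterProfile γ α μ κ ε) (Ici (ε * β)) := by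
  have := antitoneOn_hesterProfile_sub (γ := γ) (μ := μ) (ε := ε) (K := 0) hus (convex_Ici (ε * β)) fun y hy => by
    rw [interior_Ici] at hy
    have h1 := hβ (y / ε) (by rw [le_div_iff₀ hε]; linarith [hy.out])
    have h2 := (div_le_iff₀ hε).2 h1
    linarith
  simpa using this

theorem mul_sub_le_of_antitoneOn {f : ℝ → ℝ} {s : Set ℝ} {K : ℝ}
    (h : AntitoneOn (fun y => f y - K * y) s) {y₁ y₂ : ℝ} (h₁ : y₁ ∈ s) (h₂ : y₂ ∈ s) :
    (f y₂ - f y₁) * (y₂ - y₁) ≤ K * (y₂ - y₁) ^ 2 := by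
  rcases le_total y₁ y₂ with h12 | h12
  · have := h h₁ h₂ h12
    simp only at this
    nlinarith
  · have := h h₂ h₁ h12
    simp only at this
    nlinarith

theorem antitone_trunc_sub {f : ℝ → ℝ} {K : ℝ} (hK : 0 ≤ K) (h : Antitone fun y => f y - K * y)
    (Y : ℝ) : Antitone fun y => f (min y Y) - K * y := by
  intro y₁ y₂ h12
  have h1 := h (min_le_min_right Y h12)
  simp only at h1 ⊢
  have h2 : min y₂ Y - min y₁ Y ≤ y₂ - y₁ := by
    rcases le_total y₁ Y with h3 | h3
    · rw [min_eq_left h3]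
      linarith [min_le_left y₂ Y]
    · rw [min_eq_right h3, min_eq_right (h3.trans h12)]
      linarith
  nlinarith

theorem antitone_hesterProfile_sub (hγ : 0 < γ) (hα : 0 < α) (hμ : 0 < μ)
    (hus : κ * (1 + α) = Real.exp (-(α * us))) (hε : 0 < ε) :
    Antitone fun y => hesterProfile γ α μ κ ε y - μ * Real.exp us / ε * y := by
  rw [← antitoneOn_univ]
  refine antitoneOn_hesterProfile_sub hus convex_univ fun y _ => ?_
  have := div_le_div_of_nonneg_right (deriv_gain_le (us := us) hα hμ (y / ε)) hε.le
  linarith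

theorem exists_lipschitz_trunc (hα : 0 < α) (hμ : 0 < μ) (hε : 0 < ε)
    (hus : κ * (1 + α) = Real.exp (-(α * us))) (Y : ℝ) :
    ∃ L, LipschitzWith L (lienardField fun y => hesterProfile γ α μ κ ε (min y Y)) := by
  set M := |-2 * γ| + μ * Real.exp (Y / ε) * (1 + Real.exp (α * (Y / ε - us))) / ε with hM
  obtain ⟨N, hN⟩ : ∃ N : NNReal, (N : ℝ) = M :=
    ⟨M.toNNReal, Real.coe_toNNReal _ (by positivity)⟩
  have h1 : LipschitzOnWith N (hesterProfile γ α μ κ ε) (Iic Y) := by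
    refine (convex_Iic Y).lipschitzOnWith_of_nnnorm_hasDerivWithin_le
      (fun y _ => (hasDerivAt_hesterProfile hus y).hasDerivWithinAt) fun y hy => ?_
    rw [← NNReal.coe_le_coe, coe_nnnorm, Real.norm_eq_abs, hN]
    refine (abs_add_le _ _).trans (add_le_add le_rfl ?_)
    rw [abs_div, abs_of_pos hε]
    gcongr
    exact abs_deriv_gain_le hα hμ (div_le_div_of_nonneg_right hy hε.le)
  have h2 : LipschitzWith N fun y => hesterProfile γ α μ κ ε (min y Y) := by
    refine LipschitzWith.of_dist_le_mul fun y₁ y₂ => ?_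
    refine (h1.dist_le_mul _ (min_le_right y₁ Y) _ (min_le_right y₂ Y)).trans ?_
    refine mul_le_mul_of_nonneg_left ?_ N.coe_nonneg
    simpa using (LipschitzWith.id.min_const Y).dist_le_mul y₁ y₂
  exact ⟨_, LipschitzWith.prodMk LipschitzWith.prod_snd
    ((h2.comp LipschitzWith.prod_snd).sub LipschitzWith.prod_fst)⟩

end Profile

section Fields

variable {γ α μ κ us ud ur ε β δ r η X₀ w : ℝ}

theorem gain_zero_le (hα : 0 < α) (hμ : 0 < μ) (hus : κ * (1 + α) = Real.exp (-(α * us)))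
    (h0 : 0 < us) (hdg : gain α μ κ ud = gain α μ κ 0) {u : ℝ} (hu : u ∈ Icc 0 ud) :
    gain α μ κ 0 ≤ gain α μ κ u := by
  rcases le_total u us with h | h
  · exact monotoneOn_gain hα hμ hus h0.le h hu.1
  · rw [← hdg]
    exact antitoneOn_gain hα hμ hus h (h.trans hu.2 : ud ∈ Ici us) hu.2

theorem hesterProfile_le (hγ : 0 < γ) {y : ℝ} (hy : 0 ≤ y) :
    hesterProfile γ α μ κ ε y ≤ gain α μ κ (y / ε) := by
  have := mul_nonneg hγ.le hy
  unfold hesterProfile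
  linarith

theorem hesterProfile_le_of_le (hγ : 0 < γ) (hα : 0 < α) (hμ : 0 < μ)
    (hus : κ * (1 + α) = Real.exp (-(α * us))) (h0 : 0 < us) (hε : 0 < ε) (hur : us ≤ ur)
    (hgr : gain α μ κ ur ≤ -r - 1) {y : ℝ} (hy : ε * ur ≤ y) :
    hesterProfile γ α μ κ ε y ≤ -r - 1 := by
  have h1 : ur ≤ y / ε := by rw [le_div_iff₀ hε]; linarith
  have hur0 : 0 < ur := h0.trans_le hur
  exact (hesterProfile_le hγ ((mul_pos hε hur0).le.trans hy)).trans
    ((antitoneOn_gain hα hμ hus hur (hur.trans h1 : y / ε ∈ Ici us) h1).trans hgr)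

theorem hester_upperField (hγ : 0 < γ) (hα : 0 < α) (hμ : 0 < μ)
    (hg0 : 0 < gain α μ κ 0) (hus : κ * (1 + α) = Real.exp (-(α * us)))
    (h0 : 0 < us) (hε : 0 < ε) (hδ : 0 < δ) (hδr : δ ≤ r) (hud : us < ud)
    (hdg : gain α μ κ ud = gain α μ κ 0) (hudr : ud ≤ ur) (hgr : gain α μ κ ur ≤ -r - 1)
    (hβ : β ∈ Icc (us / 2) us)
    (hβ₁ : ∀ u ∈ Icc 0 β, 2 * γ * ε ≤ μ * Real.exp u * (1 - Real.exp (α * (u - us))))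
    (hβ₂ : ∀ u, β ≤ u → μ * Real.exp u * (1 - Real.exp (α * (u - us))) ≤ 2 * γ * ε)
    (hη : 0 < η) (hη₁ : (gain α μ κ us + 1) * η ≤ us ^ 2 / 16) (he₁ : η * ε ^ 2 ≤ 1)
    (he₂ : ε * ur ≤ 2) (he₃ : 2 * γ * (ε * ud) ≤ gain α μ κ 0 / 2)
    (he₄ : (ε * ud) ^ 2 ≤ δ * (gain α μ κ 0 / 2)) :
    UpperField (fun y => hesterProfile γ α μ κ ε (min y (ε * ur + 1))) r δ (gain α μ κ us)
      (gain α μ κ 0 / 2) (ε * ud) (ε * ur) (μ * Real.exp us / ε)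
      (μ * (Real.exp (α * (ud - us)) - 1) / ε) (ε * β) (η * ε ^ 2) := by
  have hβ0 : 0 < β := by linarith [hβ.1]
  have hb : 0 < ε * β := mul_pos hε hβ0
  have hbd : ε * β ≤ ε * ud := mul_le_mul_of_nonneg_left (hβ.2.trans hud.le) hε.le
  have hdu : ε * ud ≤ ε * ur := mul_le_mul_of_nonneg_left hudr hε.le
  have hY : 0 < ε * ur + 1 := by linarith
  have hmono := monotoneOn_hesterProfile (κ := κ) (γ := γ) hus hε hβ₁
  have hanti := antitoneOn_hesterProfile (κ := κ) (γ := γ) hus hε hβ₂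
  have hK : 0 ≤ μ * Real.exp us / ε := by positivity
  have hlip := antitone_trunc_sub hK
    (antitone_hesterProfile_sub (γ := γ) (κ := κ) hγ hα hμ hus hε) (ε * ur + 1)
  refine
    { δ_pos := hδ
      δr := hδr
      m_pos := by positivity
      b_pos := hb
      b_yd := hbd
      yd_yu := hdu
      yu2 := he₂
      K_nonneg := hK
      C_nonneg := ?_
      h_pos := by positivity
      h1 := he₁
      h2 := ?_
      start := ?_
      le_gs := fun y hy => ?_
      le_b := fun y hy => ?_
      ge_m := fun y hy => ?_
      le_r := fun y hy => ?_
      lip := fun y₁ y₂ _ _ => mul_sub_le_of_antitoneOn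
        (hlip.antitoneOn univ) (mem_univ _) (mem_univ _)
      contr := fun y₁ y₂ h₁ h₂ h₃ h₄ => ?_
      anti := fun y₁ h₁ y₂ h₂ h12 => ?_ }
  · have : 1 ≤ Real.exp (α * (ud - us)) := Real.one_le_exp_iff.2
      (mul_nonneg hα.le (by linarith))
    exact div_nonneg (mul_nonneg hμ.le (by linarith)) hε.le
  · have h1 : us ^ 2 / 16 * ε ^ 2 ≤ (ε * β) ^ 2 / 4 := by
      have : (us / 2) ^ 2 ≤ β ^ 2 := by
        have := hβ.1
        gcongr
      nlinarith [sq_nonneg ε]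
    nlinarith [mul_le_mul_of_nonneg_right hη₁ (sq_nonneg ε)]
  · rw [div_div, div_le_div_iff₀ (by positivity) (by norm_num)]
    linarith
  · exact (hesterProfile_le hγ (le_min hy hY.le)).trans (gain_le hα hμ hus _)
  · rw [min_eq_left (by linarith : ε * β ≤ ε * ur + 1)]
    have hy' : 0 ≤ min y (ε * ur + 1) := le_min hy hY.le
    rcases le_total (min y (ε * ur + 1)) (ε * β) with h | h
    · exact hmono ⟨hy', h⟩ ⟨hb.le, le_rfl⟩ h
    · exact hanti self_mem_Ici h h
  · rw [min_eq_left (by linarith [hy.2])]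
    have h1 : y / ε ∈ Icc 0 ud := ⟨div_nonneg hy.1 hε.le, by
      rw [div_le_iff₀ hε]; linarith [hy.2]⟩
    have h2 := gain_zero_le hα hμ hus h0 hdg h1
    unfold hesterProfile
    have h3 : γ * y ≤ γ * (ε * ud) := mul_le_mul_of_nonneg_left hy.2 hγ.le
    linarith
  · exact hesterProfile_le_of_le hγ hα hμ hus h0 hε (hud.le.trans hudr) hgr
      (le_min hy (by linarith))
  · rw [min_eq_left (by linarith), min_eq_left (by linarith)]
    refine mul_sub_le_of_antitoneOn (antitoneOn_hesterProfile_sub hus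
      (convex_Ici (ε * ud)) fun y hy => ?_) h₁ h₃
    rw [interior_Ici] at hy
    have h5 : ud ≤ y / ε := by rw [le_div_iff₀ hε]; linarith [hy.out]
    have h6 := div_le_div_of_nonneg_right (deriv_gain_le_neg hα hμ hud.le h0.le h5) hε.le
    rw [neg_div] at h6
    linarith
  · have hbY : ε * β ≤ ε * ur + 1 := by linarith
    exact hanti (le_min h₁ hbY) (le_min h₂ hbY) (min_le_min_right _ h12)

theorem hester_lowerField {m : ℝ} (hγ : 0 < γ) (hγ1 : γ < 1) (hα : 0 < α) (hμ : 0 < μ)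
    (hκ : 0 < κ) (hκ1 : κ ≤ 1)
    (hg0 : 0 < gain α μ κ 0) (hus : κ * (1 + α) = Real.exp (-(α * us)))
    (h0 : 0 < us) (hε : 0 < ε) (hδ : 0 < δ) (hδr : δ ≤ r) (hur : 0 ≤ ε * ur)
    (hX : gain α μ κ 0 < X₀) (hm : m = (X₀ - gain α μ κ 0) / 4) (hw : 0 < w) (hwδ : w ≤ δ / 2)
    (hwm : w ^ 2 ≤ (X₀ - gain α μ κ 0) * m)
    (hsmall : 9 / 4 * δ ^ 2 < (1 - ((1 + γ) / 2) ^ 2) * (X₀ ^ 2 / 4) *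
      Real.exp (-(2 * Real.pi * ((1 + γ) / 2) / √(1 - ((1 + γ) / 2) ^ 2))))
    (hstart : 2 * γ * w ≤ m) (hspiral : μ * Real.exp (-(w / ε)) ≤ (1 - γ) * w) :
    LowerField (fun y => -hesterProfile γ α μ κ ε (min (-y) (ε * ur + 1))) r δ ((1 + γ) / 2) X₀
      (X₀ - gain α μ κ 0) m w (μ * Real.exp us / ε) := by
  have hm0 : 0 < m := by rw [hm]; linarith
  have hmin : ∀ y : ℝ, 0 ≤ y → min (-y) (ε * ur + 1) = -y := fun y hy =>
    min_eq_left (by linarith)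
  have hval : ∀ y : ℝ, -hesterProfile γ α μ κ ε (-y) = -2 * γ * y - gain α μ κ (-y / ε) := by
    intro y
    unfold hesterProfile
    ring
  have hneg : ∀ y : ℝ, 0 ≤ y → -y / ε ≤ 0 := fun y hy =>
    div_nonpos_of_nonpos_of_nonneg (by linarith) hε.le
  have hK : 0 ≤ μ * Real.exp us / ε := by positivity
  have hlip := antitone_trunc_sub hK
    (antitone_hesterProfile_sub (γ := γ) (κ := κ) hγ hα hμ hus hε) (ε * ur + 1)
  refine
    { γ_pos := by linarith
      γ1 := by linarith
      δ_pos := hδ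
      δr := hδr
      c_pos := by linarith
      cX := by linarith
      m_pos := hm0
      w_pos := hw
      wδ := hwδ
      wm := ?_
      K_nonneg := hK
      small := hsmall
      nonpos := fun y hy => ?_
      start := fun y hy => ?_
      spiral := fun y hy => ?_
      lip := fun y₁ y₂ _ _ => ?_ }
  · rw [div_div, div_le_div_iff₀ (by positivity) (by norm_num)]
    linarith
  · rw [hmin y hy, hval]
    have := gain_nonneg hα hμ hκ1 (hneg y hy)
    have := mul_nonneg hγ.le hy
    linarith
  · rw [hmin y hy.1, hval]
    have h1 := monotoneOn_gain hα hμ hus ((hneg y hy.1).trans h0.le) h0.le (hneg y hy.1)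
    have h2 : γ * y ≤ γ * w := mul_le_mul_of_nonneg_left hy.2 hγ.le
    linarith
  · rw [hmin y (hw.le.trans hy), hval]
    have h1 := gain_le_mul_exp (α := α) (κ := κ) hμ hκ (-y / ε)
    have h2 : Real.exp (-y / ε) ≤ Real.exp (-(w / ε)) := Real.exp_le_exp.2 (by
      rw [neg_div]
      exact neg_le_neg (div_le_div_of_nonneg_right hy hε.le))
    have h3 := mul_le_mul_of_nonneg_left h2 hμ.le
    have h4 : (1 - γ) * w ≤ (1 - γ) * y := mul_le_mul_of_nonneg_left hy (by linarith)
    linarith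
  · have := mul_sub_le_of_antitoneOn (hlip.antitoneOn univ) (mem_univ (-y₂)) (mem_univ (-y₁))
    calc _ = _ := by ring
      _ ≤ _ := this
      _ = _ := by ring

end Fields

section Main

theorem exists_limit_cycle_of_pos {γ α μ κ us g₀ gs X₀ mL ρ r ur ud δ η w ε : ℝ}
    (hγ : 0 < γ) (hγ1 : γ < 1) (hα : 0 < α) (hμ : 0 < μ) (hκ : 0 < κ) (hκ1 : κ ≤ 1)
    (hus : κ * (1 + α) = Real.exp (-(α * us))) (h0 : 0 < us)
    (hg₀ : gain α μ κ 0 = g₀) (hgs : gain α μ κ us = gs) (hg₀0 : 0 < g₀)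
    (hX₀ : g₀ < X₀) (hmL : mL = (X₀ - g₀) / 4)
    (hρ : ρ = 1 - Real.exp (-(α * us / 2)))
    (hr : 2 * gs + 2 < r) (hr2 : 2 ≤ r) (hud : us < ud) (hudr : ud ≤ ur)
    (hdg : gain α μ κ ud = g₀) (hgr : gain α μ κ ur ≤ -r - 1) (hδ : 0 < δ) (hδ1 : δ ≤ 1)
    (hsmall : 9 / 4 * δ ^ 2 < (1 - ((1 + γ) / 2) ^ 2) * (X₀ ^ 2 / 4) *
      Real.exp (-(2 * Real.pi * ((1 + γ) / 2) / √(1 - ((1 + γ) / 2) ^ 2))))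
    (hη : 0 < η) (hη₁ : (gs + 1) * η ≤ us ^ 2 / 16) (hw : 0 < w) (hε : ε = w ^ 2)
    (hw₁ : w < 1) (hw₂ : 2 * γ * w < μ * (α * Real.exp (-(α * us))))
    (hw₃ : 2 * γ * w < μ * ρ) (hw₄ : (2 + 2 * γ) * w < μ * ρ / 2) (hw₅ : ur * w < 2)
    (hw₆ : η * w < 1) (hw₇ : 2 * γ * ud * w < g₀ / 2) (hw₈ : ud ^ 2 * w < δ * (g₀ / 2))
    (hw₉ : w < δ / 2) (hw₁₀ : w < (X₀ - g₀) * mL) (hw₁₁ : 2 * γ * us * w < gs - X₀)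
    (hw₁₂ : 2 * γ * w < mL) (hw₁₃ : 2 * μ * w < 1 - γ)
    (hΛ : (gs + r) * r / (η * δ) * (w⁻¹ ^ 4 * Real.exp
      ((2 * (μ * Real.exp us) * ud / (g₀ / 2) + 4 * (μ * Real.exp us) * η / us)
        + 2 * (μ * Real.exp us) / mL * w⁻¹ + 2 * (μ * Real.exp us) * r * w⁻¹ ^ 3
        - μ * (Real.exp (α * (ud - us)) - 1) * δ / (2 * ur) * w⁻¹ ^ 4)) ≤ 1 / 2) :
    ∃ p : ℝ → ℝ × ℝ,
      IsPeriodicSol (hesterField γ α μ κ ε) p ∧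
      Set.range p ⊆ Metric.closedBall (0 : ℝ × ℝ) r ∧
      (∀ q : ℝ → ℝ × ℝ, IsPeriodicSol (hesterField γ α μ κ ε) q →
        Set.range q ⊆ Metric.closedBall (0 : ℝ × ℝ) r → Set.range q = Set.range p) ∧
      (∃ U : Set (ℝ × ℝ), IsOpen U ∧ Set.range p ⊆ U ∧
        ∀ z ∈ U, ∃ q : ℝ → ℝ × ℝ, q 0 = z ∧
          (∀ t : ℝ, 0 ≤ t → HasDerivAt q (hesterField γ α μ κ ε (q t)) t) ∧
          Filter.Tendsto (fun t => Metric.infDist (q t) (Set.range p)) Filter.atTop (𝓝 0)) := by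
  have hε0 : 0 < ε := by rw [hε]; positivity
  have hεw : ε ≤ w := by rw [hε, sq]; exact mul_le_of_le_one_left hw.le hw₁.le
  have hε1 : ε < 1 := hεw.trans_lt hw₁
  have hur0 : 0 < ur := h0.trans (hud.trans_le hudr)
  have hud0 : 0 < ud := h0.trans hud
  have hmL0 : 0 < mL := by rw [hmL]; linarith
  have hmono : ∀ c : ℝ, 0 ≤ c → c * ε ≤ c * w := fun c hc => mul_le_mul_of_nonneg_left hεw hc
  have hεur : ε * ur ≤ 2 := by linarith only [hmono ur hur0.le, hw₅]
  have hε2 : ε ^ 2 ≤ ε := by nlinarith only [hε1, hε0]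
  have hν₂ : 2 * γ * ε < μ * ρ := (hmono _ (by positivity)).trans_lt hw₃
  obtain ⟨β, hβ, hβ₁, hβ₂⟩ := exists_argmax hα hμ h0 (by positivity : 0 < 2 * γ * ε)
    ((hmono _ (by positivity)).trans_lt hw₂) (by rwa [hρ] at hν₂)
  have hβ0 : 0 < β := by linarith [hβ.1]
  subst hg₀ hgs
  have HU := hester_upperField (r := r) (δ := δ) (η := η) hγ hα hμ hg₀0 hus h0 hε0 hδ
    (by linarith) hud hdg hudr hgr hβ hβ₁ hβ₂ hη hη₁ ((mul_le_mul_of_nonneg_left (hε2.trans hεw) hη.le).trans hw₆.le) hεur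
    (by linarith only [hmono (2 * γ * ud) (by positivity), hw₇])
    (by
      have := mul_le_mul_of_nonneg_left (hε2.trans hεw) (sq_nonneg ud)
      rw [mul_pow]
      linarith only [this, hw₈])
  have hspiral : μ * Real.exp (-(w / ε)) ≤ (1 - γ) * w := by
    have h1 : w / ε = w⁻¹ := by rw [hε]; field_simp
    have h2 : w⁻¹ ^ 2 / 2 ≤ Real.exp w⁻¹ := by
      have := Real.quadratic_le_exp_of_nonneg (inv_pos.2 hw).le
      have := inv_pos.2 hw
      linarith
    have h3 : Real.exp (-w⁻¹) ≤ 2 * w ^ 2 := by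
      rw [Real.exp_neg]
      refine (inv_anti₀ (by positivity) h2).trans_eq ?_
      field_simp
    rw [h1]
    nlinarith only [mul_le_mul_of_nonneg_left h3 hμ.le, mul_lt_mul_of_pos_right hw₁₃ hw]
  have HL := hester_lowerField (r := r) (ε := ε) (ur := ur) hγ hγ1 hα hμ hκ hκ1 hg₀0 hus h0 hε0
    hδ (by linarith) (by positivity) hX₀ hmL hw hw₉.le ((hε ▸ hεw).trans hw₁₀.le) hsmall hw₁₂.le hspiral
  obtain ⟨L, hL⟩ := exists_lipschitz_trunc (γ := γ) hα hμ hε0 hus (ε * ur + 1)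
  have hval : ∀ y ≤ ε * ur + 1, hesterProfile γ α μ κ ε (min y (ε * ur + 1)) =
      hesterProfile γ α μ κ ε y := fun y hy => by rw [min_eq_left hy]
  have hβr : ε * β ≤ ε * ur :=
    mul_le_mul_of_nonneg_left (hβ.2.trans (hud.le.trans hudr)) hε0.le
  have hβF := antitoneOn_hesterProfile (γ := γ) (κ := κ) hus hε0 hβ₂
  rw [hesterField_eq]
  refine exists_limit_cycle HU HL hr (hεur.trans hr2) ?_ hL ?_ ?_ hval
    fun y hy => hesterProfile_le_of_le hγ hα hμ hus h0 hε0 (hud.le.trans hudr) hgr hy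
  · rw [hval _ (by linarith)]
    refine lt_of_lt_of_le ?_ (hβF self_mem_Ici (mul_le_mul_of_nonneg_left hβ.2 hε0.le)
      (mul_le_mul_of_nonneg_left hβ.2 hε0.le))
    unfold hesterProfile
    rw [mul_div_cancel_left₀ us hε0.ne']
    linarith only [hmono (2 * γ * us) (by positivity), hw₁₁]
  · have hgs0 : 0 ≤ gain α μ κ us := hg₀0.le.trans (gain_le hα hμ hus 0)
    have hr0 : 0 < r := by linarith
    set k := μ * Real.exp us with hk
    have hk0 : 0 < k := by positivity
    set c := μ * (Real.exp (α * (ud - us)) - 1) with hc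
    refine le_trans (le_of_eq_of_le (b := (gain α μ κ us + r) * r / (η * δ) * (w⁻¹ ^ 4 *
      (Real.exp (2 * (k / ε) * (ε * ud) / (gain α μ κ 0 / 2) - c / ε * δ / (2 * (ε * ur)) +
        2 * (k / ε) * (η * ε ^ 2) / (ε * β)) *
        Real.exp (2 * (k / ε) * w / mL + 2 * (k / ε) * r / w)))) ?_ ?_) hΛ
    · rw [hε]
      field_simp
    · rw [← Real.exp_add]
      gcongr
      have e1 : 2 * (k / ε) * (ε * ud) / (gain α μ κ 0 / 2) = 2 * k * ud / (gain α μ κ 0 / 2) := by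
        field_simp
      have e2 : c / ε * δ / (2 * (ε * ur)) = c * δ / (2 * ur) * w⁻¹ ^ 4 := by
        rw [hε]; field_simp
      have e3 : 2 * (k / ε) * (η * ε ^ 2) / (ε * β) ≤ 4 * k * η / us := by
        rw [show 2 * (k / ε) * (η * ε ^ 2) / (ε * β) = 2 * k * η / β by field_simp,
          div_le_div_iff₀ hβ0 h0]
        nlinarith only [hβ.1, mul_pos hk0 hη]
      have e4 : 2 * (k / ε) * w / mL = 2 * k / mL * w⁻¹ := by rw [hε]; field_simp
      have e5 : 2 * (k / ε) * r / w = 2 * k * r * w⁻¹ ^ 3 := by rw [hε]; field_simp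
      rw [e1, e2, e4, e5]
      linarith only [e3]
  · intro y hy
    have hy1 : y / ε ∈ Icc 0 us :=
      ⟨div_nonneg hy.1 hε0.le, by
        rw [div_le_iff₀ hε0]
        nlinarith only [hy.2, mul_le_mul_of_nonneg_left hβ.2 hε0.le]⟩
    have h1 := mul_le_gain_sub hα hμ hus h0 hy1
    rw [← hρ] at h1
    have h2 : (2 + 2 * γ) * y ≤ μ * ρ / 2 * (y / ε) := by
      rw [mul_div_assoc', le_div_iff₀ hε0]
      have := (hmono (2 + 2 * γ) (by positivity)).trans hw₄.le
      nlinarith only [mul_le_mul_of_nonneg_right this hy.1]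
    rw [hval y (by linarith [hy.2]), hval 0 (by positivity)]
    unfold hesterProfile
    rw [zero_div]
    linarith only [h1, h2]

theorem eventually_mul_lt (a : ℝ) {b : ℝ} (hb : 0 < b) : ∀ᶠ w : ℝ in 𝓝[>] 0, a * w < b := by
  have : Tendsto (fun w : ℝ => a * w) (𝓝[>] 0) (𝓝 (a * 0)) :=
    (Continuous.tendsto (by fun_prop) 0).mono_left nhdsWithin_le_nhds
  rw [mul_zero] at this
  exact this.eventually_lt_const hb

end Main

/-- Existence, uniqueness and attractivity of the limit cycle of the Hester system
for small `ε > 0`. -/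
theorem hester_limit_cycle (γ α μ κ : ℝ) (hγ : γ ∈ Set.Ioo (0 : ℝ) 1) (hα : 0 < α)
    (hμ : 0 < μ) (hκ : 0 < κ) (hκα : κ * (1 + α) ∈ Set.Ioo (0 : ℝ) 1) :
    ∃ R > (0 : ℝ), ∀ r : ℝ, R ≤ r → ∃ ε₀ > (0 : ℝ), ∀ ε ∈ Set.Ioo (0 : ℝ) ε₀,
      ∃ p : ℝ → ℝ × ℝ,
        IsPeriodicSol (hesterField γ α μ κ ε) p ∧
        Set.range p ⊆ Metric.closedBall (0 : ℝ × ℝ) r ∧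
        (∀ q : ℝ → ℝ × ℝ, IsPeriodicSol (hesterField γ α μ κ ε) q →
          Set.range q ⊆ Metric.closedBall (0 : ℝ × ℝ) r → Set.range q = Set.range p) ∧
        (∃ U : Set (ℝ × ℝ), IsOpen U ∧ Set.range p ⊆ U ∧
          ∀ z ∈ U, ∃ q : ℝ → ℝ × ℝ, q 0 = z ∧
            (∀ t : ℝ, 0 ≤ t → HasDerivAt q (hesterField γ α μ κ ε (q t)) t) ∧
            Filter.Tendsto (fun t => Metric.infDist (q t) (Set.range p))
              Filter.atTop (nhds 0)) := by
  obtain ⟨hγ0, hγ1⟩ := hγ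
  obtain ⟨us, h0, hus⟩ : ∃ us, 0 < us ∧ κ * (1 + α) = Real.exp (-(α * us)) := by
    refine ⟨-Real.log (κ * (1 + α)) / α, div_pos (by linarith [Real.log_neg hκα.1 hκα.2]) hα, ?_⟩
    rw [mul_div_cancel₀ _ hα.ne', neg_neg, Real.exp_log hκα.1]
  have hκ1 : κ < 1 := by nlinarith [hκα.2, mul_pos hκ hα]
  obtain ⟨g₀, hg₀⟩ : ∃ g, gain α μ κ 0 = g := ⟨_, rfl⟩
  obtain ⟨gs, hgs⟩ : ∃ g, gain α μ κ us = g := ⟨_, rfl⟩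
  obtain ⟨ρ, hρ⟩ : ∃ ρ, ρ = 1 - Real.exp (-(α * us / 2)) := ⟨_, rfl⟩
  have hρ0 : 0 < ρ := hρ ▸ sub_pos.2 (Real.exp_lt_one_iff.2 (by
    have := mul_pos hα h0
    linarith))
  have hg₀0 : 0 < g₀ := hg₀ ▸ gain_zero (α := α) (μ := μ) (κ := κ) ▸ mul_pos hμ (sub_pos.2 hκ1)
  have hg₀s : g₀ < gs := by
    have := mul_le_gain_sub hα hμ hus h0 ⟨h0.le, le_rfl⟩
    rw [← hρ, hg₀, hgs] at this
    have h2 : 0 < μ * ρ / 2 * us := by positivity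
    linarith
  obtain ⟨X₀, hX₀⟩ : ∃ X₀, X₀ = (g₀ + gs) / 2 := ⟨_, rfl⟩
  obtain ⟨mL, hmL⟩ : ∃ m, m = (X₀ - g₀) / 4 := ⟨_, rfl⟩
  have hXg : g₀ < X₀ := by linarith
  have hXs : X₀ < gs := by linarith
  have hmL0 : 0 < mL := by linarith
  obtain ⟨δ, hδ, hδ1, hsmall⟩ : ∃ δ : ℝ, 0 < δ ∧ δ ≤ 1 ∧
      9 / 4 * δ ^ 2 < (1 - ((1 + γ) / 2) ^ 2) * (X₀ ^ 2 / 4) *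
        Real.exp (-(2 * Real.pi * ((1 + γ) / 2) / √(1 - ((1 + γ) / 2) ^ 2))) := by
    set q := (1 - ((1 + γ) / 2) ^ 2) * (X₀ ^ 2 / 4) *
        Real.exp (-(2 * Real.pi * ((1 + γ) / 2) / √(1 - ((1 + γ) / 2) ^ 2))) with hq
    have hX0 : 0 < X₀ := by linarith
    have hq0 : 0 < q := mul_pos (mul_pos (by nlinarith) (by positivity)) (Real.exp_pos _)
    have hm : 0 < min 1 (q / 3) := lt_min one_pos (by positivity)
    refine ⟨min 1 (q / 3), hm, min_le_left _ _, ?_⟩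
    nlinarith [min_le_left 1 (q / 3), min_le_right 1 (q / 3)]
  refine ⟨2 * gs + 3, by linarith, fun r hr => ?_⟩
  obtain ⟨ur, hur, hgr⟩ := exists_gain_le hα hμ hκ us (-r - 1)
  obtain ⟨ud, hud, hdg⟩ := intermediate_value_Icc' hur.le
    (continuous_gain (α := α) (μ := μ) (κ := κ)).continuousOn
    (show g₀ ∈ Icc (gain α μ κ ur) (gain α μ κ us) from ⟨by linarith, by linarith⟩)
  have hud' : us < ud := lt_of_le_of_ne hud.1 (by rintro rfl; linarith)
  have hur0 : 0 < ur := h0.trans hur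
  obtain ⟨η, hη, hη₁⟩ : ∃ η : ℝ, 0 < η ∧ (gs + 1) * η ≤ us ^ 2 / 16 := by
    have : 0 < gs + 1 := by linarith
    refine ⟨us ^ 2 / 16 / (gs + 1), by positivity, ?_⟩
    rw [mul_div_cancel₀ _ this.ne']
  have hD : 0 < μ * (Real.exp (α * (ud - us)) - 1) * δ / (2 * ur) := by
    have := sub_pos.2 (Real.one_lt_exp_iff.2 (mul_pos hα (sub_pos.2 hud')))
    positivity
  have hΛ := tendsto_inv_nhdsGT_zero.eventually (eventually_pow_mul_exp_le
    ((gs + r) * r / (η * δ))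
    (2 * (μ * Real.exp us) * ud / (g₀ / 2) + 4 * (μ * Real.exp us) * η / us)
    (2 * (μ * Real.exp us) / mL) (2 * (μ * Real.exp us) * r) hD)
  obtain ⟨w₀, hw₀, hsub⟩ := mem_nhdsGT_iff_exists_Ioo_subset.1 (hΛ.and
    ((eventually_mul_lt 1 one_pos).and
    ((eventually_mul_lt (2 * γ) (by positivity : 0 < μ * (α * Real.exp (-(α * us))))).and
    ((eventually_mul_lt (2 * γ) (by positivity : 0 < μ * ρ)).and
    ((eventually_mul_lt (2 + 2 * γ) (by positivity : 0 < μ * ρ / 2)).and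
    ((eventually_mul_lt ur two_pos).and
    ((eventually_mul_lt η one_pos).and
    ((eventually_mul_lt (2 * γ * ud) (by positivity : 0 < g₀ / 2)).and
    ((eventually_mul_lt (ud ^ 2) (by positivity : 0 < δ * (g₀ / 2))).and
    ((eventually_mul_lt 1 (by positivity : 0 < δ / 2)).and
    ((eventually_mul_lt 1 (mul_pos (sub_pos.2 hXg) hmL0)).and
    ((eventually_mul_lt (2 * γ * us) (sub_pos.2 hXs)).and
    ((eventually_mul_lt (2 * γ) hmL0).and
    (eventually_mul_lt (2 * μ) (sub_pos.2 hγ1)))))))))))))))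
  have hw₀0 : 0 < w₀ := hw₀
  refine ⟨w₀ ^ 2, by positivity, fun ε hε => ?_⟩
  have hw : √ε ∈ Ioo 0 w₀ := ⟨Real.sqrt_pos.2 hε.1, (Real.sqrt_lt' hw₀0).2 hε.2⟩
  obtain ⟨hw₁₄, hw₁, hw₂, hw₃, hw₄, hw₅, hw₆, hw₇, hw₈, hw₉, hw₁₀, hw₁₁, hw₁₂, hw₁₃⟩ := hsub hw
  rw [one_mul] at hw₁ hw₉ hw₁₀
  exact exists_limit_cycle_of_pos hγ0 hγ1 hα hμ hκ hκ1.le hus h0 hg₀ hgs hg₀0 hXg hmL hρ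
    (by linarith) (by linarith) hud' hud.2 hdg hgr hδ hδ1 hsmall hη hη₁ hw.1
    (Real.sq_sqrt hε.1.le).symm hw₁ hw₂ hw₃ hw₄ hw₅ hw₆ hw₇ hw₈ hw₉ hw₁₀ hw₁₁ hw₁₂ hw₁₃ hw₁₄
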